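/- Cheeger type inequality: for all f ∈ C_c^∞(ℍ) one has ∫_ℍ |f − m_f| p dm ≲ ∫_ℍ |∇f| p dm, where p = p_1 is the heat kernel at time 1 and the implied constant depends only on (𝒦,𝒜). -/

import Mathlib

open MeasureTheory Real Complex Finset Filter Topology

noncomputable section

/-- The underlying space of the nonisotropic Heisenberg group `ℍ(𝒦,𝒜)`, where the number of
blocks is `l + 1`, the block dimensions are `k 0, …, k l` and the parameters are
`a 0 < ⋯ < a l`. A point is a pair `(z, t)` with `z i : Fin (k i) → ℂ` and `t : ℝ`. -/
abbrev Heis (l : ℕ) (k : Fin (l + 1) → ℕ) : Type :=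
  ((i : Fin (l + 1)) → (Fin (k i) → ℂ)) × ℝ

variable (l : ℕ) (k : Fin (l + 1) → ℕ) (a : Fin (l + 1) → ℝ)

/-- The group multiplication of `ℍ(𝒦,𝒜)`:
`(z,t)·(z′,t′) = (z + z′, t + t′ + 2 ∑ᵢ aᵢ Im⟨zᵢ, zᵢ′⟩)`. -/
def hmul (g g' : Heis l k) : Heis l k :=
  (g.1 + g'.1,
    g.2 + g'.2 + 2 * ∑ i, a i * (∑ j, (starRingEnd ℂ) (g.1 i j) * g'.1 i j).im)

/-- The group inversion of `ℍ(𝒦,𝒜)`: `(z,t)⁻¹ = (-z,-t)`. -/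
def hinv (g : Heis l k) : Heis l k := (-g.1, -g.2)

/-- `|z i|²`, the squared Euclidean norm of the `i`-th block of `z`. -/
def zNormSq (z : (i : Fin (l + 1)) → Fin (k i) → ℂ) (i : Fin (l + 1)) : ℝ :=
  ∑ j, Complex.normSq (z i j)

/-- The left-invariant vector field `X_{i,j} = ∂_{x_{i,j}} + 2 aᵢ y_{i,j} ∂_t`, applied to a
function `f` at a point `g`, realized as a directional (line) derivative. -/
def Xvf (i : Fin (l + 1)) (j : Fin (k i)) (f : Heis l k → ℝ) (g : Heis l k) : ℝ :=
  lineDeriv ℝ f g (Pi.single i (Pi.single j (1 : ℂ)), 2 * a i * (g.1 i j).im)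

/-- The left-invariant vector field `Y_{i,j} = ∂_{y_{i,j}} - 2 aᵢ x_{i,j} ∂_t`. -/
def Yvf (i : Fin (l + 1)) (j : Fin (k i)) (f : Heis l k → ℝ) (g : Heis l k) : ℝ :=
  lineDeriv ℝ f g (Pi.single i (Pi.single j (Complex.I)), -(2 * a i * (g.1 i j).re))

/-- The right-invariant vector field `X̂_{i,j} = ∂_{x_{i,j}} - 2 aᵢ y_{i,j} ∂_t`. -/
def XvfR (i : Fin (l + 1)) (j : Fin (k i)) (f : Heis l k → ℝ) (g : Heis l k) : ℝ :=
  lineDeriv ℝ f g (Pi.single i (Pi.single j (1 : ℂ)), -(2 * a i * (g.1 i j).im))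

/-- The right-invariant vector field `Ŷ_{i,j} = ∂_{y_{i,j}} + 2 aᵢ x_{i,j} ∂_t`. -/
def YvfR (i : Fin (l + 1)) (j : Fin (k i)) (f : Heis l k → ℝ) (g : Heis l k) : ℝ :=
  lineDeriv ℝ f g (Pi.single i (Pi.single j (Complex.I)), 2 * a i * (g.1 i j).re)

/-- `|∇f|(g)`, the Euclidean length of the horizontal (left-invariant) gradient of `f` at `g`. -/
def gradNorm (f : Heis l k → ℝ) (g : Heis l k) : ℝ :=
  Real.sqrt (∑ i, ∑ j, ((Xvf l k a i j f g) ^ 2 + (Yvf l k a i j f g) ^ 2))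

/-- The heat kernel `p_h(z,t)` at time `h` of `ℍ(𝒦,𝒜)`, as a complex integral:
`p_h(z,t) = (2(4πh)^{n+1})⁻¹ ∫_ℝ ∏ⱼ (aⱼλ/sinh(aⱼλ))^{kⱼ}
  exp((4h)⁻¹(iλt − ∑ⱼ |zⱼ|² aⱼλ coth(aⱼλ))) dλ`. -/
def heatKernelC (h : ℝ) (g : Heis l k) : ℂ :=
  (2 * (4 * Real.pi * h) ^ ((∑ i, k i) + 1) : ℂ)⁻¹ *
    ∫ lam : ℝ,
      ((∏ j, ((a j * lam) / Real.sinh (a j * lam)) ^ (k j) : ℝ) : ℂ) *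
        Complex.exp ((4 * (h : ℂ))⁻¹ *
          (Complex.I * (lam : ℂ) * (g.2 : ℂ) -
            ∑ j, ((zNormSq l k g.1 j : ℝ) : ℂ) *
              ((a j * lam * (Real.cosh (a j * lam) / Real.sinh (a j * lam)) : ℝ) : ℂ)))

/-- The (real-valued) heat kernel `p_h` of `ℍ(𝒦,𝒜)`. -/
def heatKernel (h : ℝ) (g : Heis l k) : ℝ := (heatKernelC l k a h g).re

/-- The heat semigroup: `e^{hΔ} f (g) = ∫_ℍ f(g·g′) p_h(g′) dm(g′)`, with `m` the Lebesgue
(Haar) measure on `ℍ(𝒦,𝒜)`. -/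
def heatSemigroup (h : ℝ) (f : Heis l k → ℝ) (g : Heis l k) : ℝ :=
  ∫ g' : Heis l k, f (hmul l k a g g') * heatKernel l k a h g'

/-- `μ(ω) = (2ω − sin 2ω)/(2 sin²ω)`; note that at `ω = 0` Lean's convention `0/0 = 0`
gives exactly the continuous extension `μ(0) = 0`. -/
def muF (ω : ℝ) : ℝ := (2 * ω - Real.sin (2 * ω)) / (2 * Real.sin ω ^ 2)

/-- `x / sin x`, extended continuously by `1` at `x = 0`. -/
def sdiv (x : ℝ) : ℝ := if x = 0 then 1 else x / Real.sin x

/-- The angle `θ(z,t) ∈ (−π,π)` solving `t = ∑ⱼ aⱼ μ(aⱼθ)|zⱼ|²`, chosen by the epsilon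
operator (whenever a solution exists it is unique, and `thetaOf` is that solution). -/
def thetaOf (g : Heis l k) : ℝ :=
  Classical.epsilon fun θ : ℝ => θ ∈ Set.Ioo (-Real.pi) Real.pi ∧
    g.2 = ∑ j, a j * muF (a j * θ) * zNormSq l k g.1 j

/-- The squared Carnot–Carathéodory distance from `g = (z,t)` to the origin:
if `z_l ≠ 0`, or `z_l = 0` and `|t| < ∑_{j<l} aⱼ μ(aⱼπ)|zⱼ|²`, it is
`∑ⱼ (aⱼθ/sin(aⱼθ))² |zⱼ|²` with `θ = θ(z,t)`; otherwise it is
`π(|t| + ∑_{j<l} aⱼ cot(aⱼπ)|zⱼ|²)`. -/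
def ccDistSq (g : Heis l k) : ℝ :=
  if g.1 (Fin.last l) ≠ 0 ∨
      |g.2| < ∑ j ∈ Finset.univ.erase (Fin.last l),
        a j * muF (a j * Real.pi) * zNormSq l k g.1 j then
    ∑ j, (sdiv (a j * thetaOf l k a g)) ^ 2 * zNormSq l k g.1 j
  else
    Real.pi * (|g.2| + ∑ j ∈ Finset.univ.erase (Fin.last l),
      a j * (Real.cos (a j * Real.pi) / Real.sin (a j * Real.pi)) * zNormSq l k g.1 j)

/-- The Carnot–Carathéodory distance from `g` to the origin. -/
def ccDist (g : Heis l k) : ℝ := Real.sqrt (ccDistSq l k a g)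

/-- The Carnot–Carathéodory unit ball `B` of `ℍ(𝒦,𝒜)`. -/
def ballCC : Set (Heis l k) := {g | ccDist l k a g < 1}

/-- `m_f`, the mean of `f` over the Carnot–Carathéodory unit ball. -/
def meanB (f : Heis l k → ℝ) : ℝ :=
  (∫ g in ballCC l k a, f g) / (volume (ballCC l k a)).toReal

/-- The polar coordinates map
`Ψ(u,η) = ((1−e^{−2ia₁η})u₁, …, (1−e^{−2ia_lη})u_l, ∑ⱼ 2aⱼ|uⱼ|²(2aⱼη − sin(2aⱼη)))`. -/
def Psi (u : (i : Fin (l + 1)) → Fin (k i) → ℂ) (η : ℝ) : Heis l k :=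
  (fun i => fun j => (1 - Complex.exp (-(2 * Complex.I * (a i : ℂ) * (η : ℂ)))) * u i j,
    ∑ j, 2 * a j * zNormSq l k u j * (2 * a j * η - Real.sin (2 * a j * η)))

/-- `U = (4 ∑ⱼ aⱼ²|uⱼ|²)^{1/2}`. -/
def Ufun (u : (i : Fin (l + 1)) → Fin (k i) → ℂ) : ℝ :=
  Real.sqrt (4 * ∑ j, (a j) ^ 2 * zNormSq l k u j)

/-- The Jacobian determinant `J(u,η)` of `Ψ` at `(u,η)` (the determinant of the total
derivative of `Ψ` as a map of the real vector space `ℍ ≅ ℝ^{2n+1}`). -/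
def jacPsi (u : (i : Fin (l + 1)) → Fin (k i) → ℂ) (η : ℝ) : ℝ :=
  LinearMap.det
    ((fderiv ℝ (fun q : Heis l k => Psi l k a q.1 q.2) (u, η)) : Heis l k →ₗ[ℝ] Heis l k)


namespace Cheeger

/-- Log-concavity (in the multiplicative, zero-tolerant form). -/
def LC (F : ℝ → ℝ) : Prop := ∀ x y d, x ≤ y → 0 ≤ d → F x * F (y + d) ≤ F (x + d) * F y

theorem sym_int (A B α β : ℝ → ℝ) (h1 : Integrable (fun u => A u * α u))
    (h2 : Integrable (fun u => A u * β u)) (h3 : Integrable (fun u => B u * α u))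
    (h4 : Integrable (fun u => B u * β u))
    (H : ∀ u v, 0 ≤ (A u * B v - A v * B u) * (α u * β v - β u * α v)) :
    (∫ u, A u * β u) * (∫ u, B u * α u) ≤ (∫ u, A u * α u) * (∫ u, B u * β u) := by
  have e : ∀ z : ℝ × ℝ, (A z.1 * B z.2 - A z.2 * B z.1) * (α z.1 * β z.2 - β z.1 * α z.2)
      = ((A z.1 * α z.1) * (B z.2 * β z.2) + (B z.1 * β z.1) * (A z.2 * α z.2))
       - ((A z.1 * β z.1) * (B z.2 * α z.2) + (B z.1 * α z.1) * (A z.2 * β z.2)) := by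
    intro z; ring
  have h0 : 0 ≤ ∫ z : ℝ × ℝ,
      (A z.1 * B z.2 - A z.2 * B z.1) * (α z.1 * β z.2 - β z.1 * α z.2) :=
    integral_nonneg fun z => H z.1 z.2
  simp_rw [e] at h0
  have i1 : Integrable (fun z : ℝ × ℝ => (A z.1 * α z.1) * (B z.2 * β z.2)) := h1.mul_prod h4
  have i2 : Integrable (fun z : ℝ × ℝ => (B z.1 * β z.1) * (A z.2 * α z.2)) := h4.mul_prod h1
  have i3 : Integrable (fun z : ℝ × ℝ => (A z.1 * β z.1) * (B z.2 * α z.2)) := h2.mul_prod h3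
  have i4 : Integrable (fun z : ℝ × ℝ => (B z.1 * α z.1) * (A z.2 * β z.2)) := h3.mul_prod h2
  have j1 : Integrable (fun z : ℝ × ℝ => (A z.1 * α z.1) * (B z.2 * β z.2) +
      (B z.1 * β z.1) * (A z.2 * α z.2)) := i1.add i2
  have j2 : Integrable (fun z : ℝ × ℝ => (A z.1 * β z.1) * (B z.2 * α z.2) +
      (B z.1 * α z.1) * (A z.2 * β z.2)) := i3.add i4
  rw [integral_sub j1 j2, integral_add i1 i2, integral_add i3 i4] at h0
  have p1 : ∫ z : ℝ × ℝ, (A z.1 * α z.1) * (B z.2 * β z.2) = (∫ u, A u * α u) * (∫ u, B u * β u) :=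
    integral_prod_mul (fun u => A u * α u) (fun u => B u * β u)
  have p2 : ∫ z : ℝ × ℝ, (B z.1 * β z.1) * (A z.2 * α z.2) = (∫ u, B u * β u) * (∫ u, A u * α u) :=
    integral_prod_mul (fun u => B u * β u) (fun u => A u * α u)
  have p3 : ∫ z : ℝ × ℝ, (A z.1 * β z.1) * (B z.2 * α z.2) = (∫ u, A u * β u) * (∫ u, B u * α u) :=
    integral_prod_mul (fun u => A u * β u) (fun u => B u * α u)
  have p4 : ∫ z : ℝ × ℝ, (B z.1 * α z.1) * (A z.2 * β z.2) = (∫ u, B u * α u) * (∫ u, A u * β u) :=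
    integral_prod_mul (fun u => B u * α u) (fun u => A u * β u)
  rw [p1, p2, p3, p4] at h0
  linarith

theorem integrable_conv {h F : ℝ → ℝ} (hh : Integrable h) (hF : Continuous F) {C : ℝ}
    (hC : ∀ s, |F s| ≤ C) (s d : ℝ) : Integrable (fun u => F (s - u) * h (u - d)) := by
  refine (hh.comp_sub_right d).bdd_mul (c := C) (by fun_prop) ?_
  exact Eventually.of_forall fun u => by simpa using hC (s - u)

theorem LC.conv {h F : ℝ → ℝ} (hh : Integrable h) (hF : Continuous F) {C : ℝ}
    (hC : ∀ s, |F s| ≤ C) (lh : LC h) (lF : LC F) : LC (fun s => ∫ u, F (s - u) * h u) := by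
  intro x y d hxy hd
  have key := sym_int (fun u => F (x + d - u)) (fun u => F (y + d - u)) h (fun u => h (u - d))
    (by simpa using integrable_conv hh hF hC (x + d) 0) (integrable_conv hh hF hC (x + d) d)
    (by simpa using integrable_conv hh hF hC (y + d) 0) (integrable_conv hh hF hC (y + d) d) ?_
  · have e : ∀ x, ∫ u, F (x + d - u) * h (u - d) = ∫ u, F (x - u) * h u := by
      intro x
      rw [← integral_sub_right_eq_self (fun u => F (x - u) * h u) d]
      congr 1; ext u; congr 2; ring
    rw [e, e] at key
    exact key
  · have main : ∀ u v, u ≤ v → 0 ≤ (F (x + d - u) * F (y + d - v) - F (x + d - v) * F (y + d - u)) *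
        (h u * h (v - d) - h (u - d) * h v) := by
      intro u v huv
      have h1 := lh (u - d) (v - d) d (by linarith) hd
      have h2 := lF (x + d - v) (y + d - v) (v - u) (by linarith) (by linarith)
      have e1 : y + d - v + (v - u) = y + d - u := by ring
      have e2 : x + d - v + (v - u) = x + d - u := by ring
      rw [e1, e2] at h2
      simp only [sub_add_cancel] at h1
      exact mul_nonneg (by linarith) (by linarith)
    intro u v
    rcases le_total u v with huv | huv
    · exact main u v huv
    · have := main v u huv
      linarith

/-- complex transform -/
def Ps (A : ℝ → ℂ) (s : ℝ) : ℂ := ∫ x : ℝ, A x * Complex.exp (Complex.I * x * s)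

theorem norm_expI (x s : ℝ) : ‖Complex.exp (Complex.I * x * s)‖ = 1 := by
  have : Complex.I * (x : ℂ) * s = ((x * s : ℝ) : ℂ) * Complex.I := by push_cast; ring
  rw [this, Complex.norm_exp_ofReal_mul_I]

theorem integrable_Ps {A : ℝ → ℂ} (hA : Integrable A) (s : ℝ) :
    Integrable (fun x : ℝ => A x * Complex.exp (Complex.I * x * s)) := by
  refine hA.mul_bdd (c := 1) (by fun_prop) (Eventually.of_forall fun x => ?_)
  rw [norm_expI]

theorem continuous_Ps {A : ℝ → ℂ} (hA : Integrable A) : Continuous (Ps A) := by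
  refine continuous_of_dominated (bound := fun x => ‖A x‖) ?_ ?_ hA.norm ?_
  · intro s; exact (integrable_Ps hA s).aestronglyMeasurable
  · intro s; refine Eventually.of_forall fun x => ?_
    rw [norm_mul, norm_expI, mul_one]
  · refine Eventually.of_forall fun x => ?_
    fun_prop

theorem norm_Ps_le {A : ℝ → ℂ} (s : ℝ) : ‖Ps A s‖ ≤ ∫ x, ‖A x‖ := by
  refine (norm_integral_le_integral_norm _).trans (le_of_eq ?_)
  congr 1; ext x; rw [norm_mul, norm_expI, mul_one]

/-- complex transform of a real kernel -/
def hat (h : ℝ → ℝ) (x : ℝ) : ℂ := ∫ u : ℝ, (h u : ℂ) * Complex.exp (-(Complex.I * x * u))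

theorem norm_expI' (x s : ℝ) : ‖Complex.exp (-(Complex.I * x * s))‖ = 1 := by
  have := norm_expI x (-s); push_cast at this; rw [← this]; congr 2; ring

theorem norm_hat_le (h : ℝ → ℝ) (x : ℝ) : ‖hat h x‖ ≤ ∫ u, |h u| := by
  refine (norm_integral_le_integral_norm _).trans (le_of_eq ?_)
  congr 1; ext x; rw [norm_mul, norm_expI', mul_one]; simp

theorem continuous_hat {h : ℝ → ℝ} (hh : Integrable h) : Continuous (hat h) := by
  have hm : AEStronglyMeasurable (fun u => (h u : ℂ)) :=
    (Complex.continuous_ofReal.comp_aestronglyMeasurable hh.aestronglyMeasurable)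
  refine continuous_of_dominated (bound := fun x => |h x|) ?_ ?_ hh.norm ?_
  · intro s; exact hm.mul (by fun_prop)
  · intro s; refine Eventually.of_forall fun x => ?_
    rw [norm_mul, norm_expI', mul_one]; simp
  · refine Eventually.of_forall fun x => ?_
    fun_prop

theorem integrable_mul_hat {A : ℝ → ℂ} (hA : Integrable A) {h : ℝ → ℝ} (hh : Integrable h) :
    Integrable (fun x => A x * hat h x) :=
  hA.mul_bdd (c := ∫ u, |h u|) (continuous_hat hh).aestronglyMeasurable
    (Eventually.of_forall fun x => norm_hat_le h x)

theorem Ps_mul_hat {A : ℝ → ℂ} (hA : Integrable A) {h : ℝ → ℝ} (hh : Integrable h) (s : ℝ) :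
    Ps (fun x => A x * hat h x) s = ∫ u, Ps A (s - u) * (h u : ℂ) := by
  unfold Ps hat
  have hhc : Integrable (fun u => (h u : ℂ)) := hh.ofReal
  have h2 : Integrable (Function.uncurry fun (x u : ℝ) =>
      A x * Complex.exp (Complex.I * x * s) * ((h u : ℂ) * Complex.exp (-(Complex.I * x * u)))) := by
    have h3 : Integrable (fun z : ℝ × ℝ => A z.1 * (h z.2 : ℂ)) := hA.mul_prod hhc
    have h4 := h3.mul_bdd (c := 1) (g := fun z : ℝ × ℝ => Complex.exp (Complex.I * z.1 * s) *
      Complex.exp (-(Complex.I * z.1 * z.2))) (by fun_prop)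
      (Eventually.of_forall fun z => by rw [norm_mul, norm_expI, norm_expI', mul_one])
    refine h4.congr (Eventually.of_forall fun z => ?_)
    simp only [Function.uncurry]; ring
  calc ∫ x : ℝ, (A x * ∫ u : ℝ, (h u : ℂ) * Complex.exp (-(Complex.I * x * u))) *
        Complex.exp (Complex.I * x * s)
      = ∫ x : ℝ, ∫ u : ℝ, A x * Complex.exp (Complex.I * x * s) *
          ((h u : ℂ) * Complex.exp (-(Complex.I * x * u))) := by
        congr 1; ext x; rw [integral_const_mul]; ring
    _ = ∫ u : ℝ, ∫ x : ℝ, A x * Complex.exp (Complex.I * x * s) *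
          ((h u : ℂ) * Complex.exp (-(Complex.I * x * u))) := integral_integral_swap h2
    _ = _ := by
        congr 1; ext u; rw [← integral_mul_const]; congr 1; ext x
        have : Complex.exp (Complex.I * x * ((s - u : ℝ) : ℂ)) =
          Complex.exp (Complex.I * x * s) * Complex.exp (-(Complex.I * x * u)) := by
          rw [← Complex.exp_add]; congr 1; push_cast; ring
        rw [this]; ring

/-- `A` is integrable with real nonnegative log-concave transform. -/
structure LCC (A : ℝ → ℂ) : Prop where
  int : Integrable A
  re : ∀ s, Ps A s = ((Ps A s).re : ℂ)
  nn : ∀ s, 0 ≤ (Ps A s).re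
  lc : LC (fun s => (Ps A s).re)

theorem LCC.mul_hat {A : ℝ → ℂ} (hA : LCC A) {h : ℝ → ℝ} (hh : Integrable h) (h0 : ∀ u, 0 ≤ h u)
    (lh : LC h) : LCC (fun x => A x * hat h x) := by
  have e : ∀ s, Ps (fun x => A x * hat h x) s = ((∫ u, (Ps A (s - u)).re * h u : ℝ) : ℂ) := by
    intro s
    rw [Ps_mul_hat hA.int hh, ← integral_complex_ofReal]
    congr 1; ext u; rw [hA.re]; simp
  have e' : ∀ s, (Ps (fun x => A x * hat h x) s).re = ∫ u, (Ps A (s - u)).re * h u := by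
    intro s; rw [e, Complex.ofReal_re]
  refine ⟨integrable_mul_hat hA.int hh, fun s => ?_, fun s => ?_, ?_⟩
  · rw [e' s, e s]
  · rw [e' s]; exact integral_nonneg fun u => mul_nonneg (hA.nn _) (h0 u)
  · simp_rw [e']
    have hc : Continuous fun s => (Ps A s).re := Complex.continuous_re.comp (continuous_Ps hA.int)
    exact LC.conv hh hc (C := ∫ x, ‖A x‖)
      (fun s => (Complex.abs_re_le_norm _).trans (norm_Ps_le s)) lh hA.lc

theorem Ps_neg (A : ℝ → ℂ) (s : ℝ) : Ps (fun x => A (-x)) s = Ps A (-s) := by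
  unfold Ps
  rw [← integral_neg_eq_self]
  congr 1; ext x; push_cast; congr 2
  · simp
  · ring

theorem LCC.neg {A : ℝ → ℂ} (hA : LCC A) : LCC (fun x => A (-x)) := by
  refine ⟨hA.int.comp_neg, fun s => ?_, fun s => ?_, ?_⟩
  · rw [Ps_neg]; exact hA.re _
  · rw [Ps_neg]; exact hA.nn _
  · simp_rw [Ps_neg]
    intro x y d hxy hd
    have := hA.lc (-(y + d)) (-(x + d)) d (by linarith) hd
    simp only [neg_add_rev] at this ⊢
    have e1 : -d + -x + d = -x := by ring
    have e2 : -d + -y + d = -y := by ring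
    rw [e1, e2] at this
    linarith

theorem LCC.mul_hat2 {A : ℝ → ℂ} (hA : LCC A) {h : ℝ → ℝ} (hh : Integrable h) (h0 : ∀ u, 0 ≤ h u)
    (lh : LC h) : LCC (fun x => A x * (hat h x * hat h (-x))) := by
  have := (((hA.mul_hat hh h0 lh).neg).mul_hat hh h0 lh).neg
  refine cast (congrArg LCC ?_) this
  ext x; simp only [neg_neg]; ring

theorem LCC.limit {A : ℕ → ℝ → ℂ} {B : ℝ → ℂ} (hA : ∀ n, LCC (A n)) (hB : Integrable B)
    (hb : ∀ n x, ‖A n x‖ ≤ ‖B x‖) (hl : ∀ x, Tendsto (fun n => A n x) atTop (𝓝 (B x))) :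
    LCC B := by
  have ht : ∀ s, Tendsto (fun n => Ps (A n) s) atTop (𝓝 (Ps B s)) := by
    intro s
    refine tendsto_integral_of_dominated_convergence (fun x => ‖B x‖) ?_ hB.norm ?_ ?_
    · intro n; exact (integrable_Ps (hA n).int s).aestronglyMeasurable
    · intro n; refine Eventually.of_forall fun x => ?_
      rw [norm_mul, norm_expI, mul_one]; exact hb n x
    · exact Eventually.of_forall fun x => (hl x).mul_const _
  have htr : ∀ s, Tendsto (fun n => (Ps (A n) s).re) atTop (𝓝 (Ps B s).re) := fun s =>
    (Complex.continuous_re.tendsto _).comp (ht s)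
  refine ⟨hB, fun s => ?_, fun s => ge_of_tendsto' (htr s) fun n => (hA n).nn s, ?_⟩
  · refine tendsto_nhds_unique (ht s) ?_
    refine ((Complex.continuous_ofReal.tendsto _).comp (htr s)).congr fun n => ?_
    exact ((hA n).re s).symm
  · intro x y d hxy hd
    exact le_of_tendsto_of_tendsto' ((htr x).mul (htr (y + d))) ((htr (x + d)).mul (htr y))
      fun n => (hA n).lc x y d hxy hd

theorem LCC.gauss {η : ℝ} (hη : 0 < η) : LCC (fun x : ℝ => Complex.exp (-η * (x : ℂ) ^ 2)) := by
  have e : ∀ s : ℝ, Ps (fun x : ℝ => Complex.exp (-η * (x : ℂ) ^ 2)) s =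
      (((π / η) ^ (1 / 2 : ℝ) * Real.exp (-s ^ 2 / (4 * η)) : ℝ) : ℂ) := by
    intro s
    have := fourierIntegral_gaussian (b := (η : ℂ)) (by simpa using hη) (s : ℂ)
    unfold Ps
    simp_rw [mul_comm (Complex.exp (-(η : ℂ) * _))]
    have e2 : ∀ x : ℝ, Complex.I * (x : ℂ) * s = Complex.I * s * x := fun x => by ring
    simp_rw [e2]
    rw [this]
    push_cast
    rw [Complex.ofReal_cpow (by positivity)]
    push_cast; rfl
  have hinteg : Integrable (fun x : ℝ => Complex.exp (-η * (x : ℂ) ^ 2)) := by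
    exact integrable_cexp_neg_mul_sq (by simpa using hη)
  refine ⟨hinteg, fun s => by rw [e, Complex.ofReal_re], fun s => ?_, ?_⟩
  · rw [e, Complex.ofReal_re]; positivity
  · simp_rw [e, Complex.ofReal_re]
    intro x y d hxy hd
    have hC : 0 ≤ (π / η) ^ (1 / 2 : ℝ) := by positivity
    have : Real.exp (-x ^ 2 / (4 * η)) * Real.exp (-(y + d) ^ 2 / (4 * η)) ≤
      Real.exp (-(x + d) ^ 2 / (4 * η)) * Real.exp (-y ^ 2 / (4 * η)) := by
      rw [← Real.exp_add, ← Real.exp_add, Real.exp_le_exp, ← add_div, ← add_div]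
      apply div_le_div_of_nonneg_right _ (by positivity)
      nlinarith [mul_nonneg (sub_nonneg.2 hxy) hd]
    calc _ = (π / η) ^ (1 / 2 : ℝ) * (π / η) ^ (1 / 2 : ℝ) *
          (Real.exp (-x ^ 2 / (4 * η)) * Real.exp (-(y + d) ^ 2 / (4 * η))) := by ring
      _ ≤ (π / η) ^ (1 / 2 : ℝ) * (π / η) ^ (1 / 2 : ℝ) *
          (Real.exp (-(x + d) ^ 2 / (4 * η)) * Real.exp (-y ^ 2 / (4 * η))) := by gcongr
      _ = _ := by ring

end Cheeger

namespace Cheeger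

theorem summable_ser {cs : ℕ → ℝ} (h : ∀ n, |cs n| ≤ 1 / (n.factorial : ℝ)) (y : ℝ) :
    Summable (fun n => cs n * y ^ n) := by
  refine Summable.of_norm_bounded (Real.summable_pow_div_factorial |y|) fun n => ?_
  rw [norm_mul, norm_pow, Real.norm_eq_abs, Real.norm_eq_abs]
  calc |cs n| * |y| ^ n ≤ 1 / (n.factorial : ℝ) * |y| ^ n := by gcongr; exact h n
    _ = _ := by ring

theorem hasDerivAt_ser {cs : ℕ → ℝ} (h : ∀ n, |cs n| ≤ 1 / (n.factorial : ℝ)) (y : ℝ) :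
    HasDerivAt (fun y => ∑' n, cs n * y ^ n) (∑' n : ℕ, ((n + 1 : ℝ) * cs (n + 1)) * y ^ n) y := by
  set R := |y| + 1 with hR
  have hu : Summable (fun n : ℕ => (n : ℝ) * R ^ (n - 1) / (n.factorial : ℝ)) := by
    rw [← summable_nat_add_iff 1]
    refine (Real.summable_pow_div_factorial R).congr fun n => ?_
    rw [Nat.factorial_succ]; push_cast
    have : (n.factorial : ℝ) ≠ 0 := by positivity
    try simp only [add_tsub_cancel_right]
    field_simp
  have hb : ∀ n : ℕ, ∀ z ∈ Metric.ball (0 : ℝ) R, ‖cs n * (n * z ^ (n - 1))‖ ≤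
      (n : ℝ) * R ^ (n - 1) / (n.factorial : ℝ) := by
    intro n z hz
    have hz' : |z| ≤ R := by simpa using (Metric.mem_ball.1 hz).le
    rw [norm_mul, norm_mul, norm_pow, Real.norm_eq_abs, Real.norm_eq_abs]
    try simp only [Real.norm_natCast, Nat.abs_cast]
    calc |cs n| * ((n : ℝ) * |z| ^ (n - 1)) ≤ 1 / (n.factorial : ℝ) * ((n : ℝ) * R ^ (n - 1)) := by
          gcongr; exact h n
      _ = _ := by ring
  have hy : y ∈ Metric.ball (0 : ℝ) R := by simp [hR]
  have := hasDerivAt_tsum_of_isPreconnected hu Metric.isOpen_ball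
    (convex_ball (0 : ℝ) R).isPreconnected (g := fun n y => cs n * y ^ n)
    (g' := fun n y => cs n * (n * y ^ (n - 1))) (fun n z _ => (hasDerivAt_pow n z).const_mul _)
    hb hy (summable_ser h y) hy
  have hs : Summable fun n : ℕ => cs n * (n * y ^ (n - 1)) :=
    Summable.of_norm_bounded hu fun n => hb n y hy
  rw [hs.tsum_eq_zero_add] at this
  convert! this using 1
  simp only [Nat.cast_zero, zero_mul, mul_zero, zero_add]
  congr 1; ext n; push_cast; (try simp only [add_tsub_cancel_right]); ring

/-- coefficients `1/(n!(n+j)!)` -/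
def bc (j n : ℕ) : ℝ := 1 / ((n.factorial : ℝ) * ((n + j).factorial : ℝ))

def bf (j : ℕ) (y : ℝ) : ℝ := ∑' n, bc j n * y ^ n

theorem bc_nonneg (j n : ℕ) : 0 ≤ bc j n := by unfold bc; positivity

theorem bc_le (j n : ℕ) : |bc j n| ≤ 1 / (n.factorial : ℝ) := by
  rw [abs_of_nonneg (bc_nonneg j n)]
  unfold bc
  have h1 : (1 : ℝ) ≤ ((n + j).factorial : ℝ) := by exact_mod_cast Nat.factorial_pos _
  have h2 : (0 : ℝ) < n.factorial := by positivity
  apply one_div_le_one_div_of_le h2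
  nlinarith

theorem hasDerivAt_bf (j : ℕ) (y : ℝ) : HasDerivAt (bf j) (bf (j + 1) y) y := by
  have := hasDerivAt_ser (bc_le j) y
  convert! this using 1
  unfold bf; congr 1; ext n; congr 1
  unfold bc
  rw [Nat.factorial_succ, show n + 1 + j = n + (j + 1) by ring]
  have h2 : (n.factorial : ℝ) ≠ 0 := by positivity
  have h3 : ((n + (j + 1)).factorial : ℝ) ≠ 0 := by positivity
  push_cast; field_simp

theorem bf_ode (y : ℝ) : y * bf 2 y + bf 1 y = bf 0 y := by
  unfold bf
  have s0 := summable_ser (bc_le 0) y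
  have s1 := summable_ser (bc_le 1) y
  have s2 := summable_ser (bc_le 2) y
  rw [← tsum_mul_left, s1.tsum_eq_zero_add, s0.tsum_eq_zero_add]
  have s1' := (summable_nat_add_iff 1).2 s1
  rw [add_comm (bc 1 0 * y ^ 0), ← add_assoc, ← (s2.mul_left y).tsum_add s1', add_comm]
  congr 1
  congr 1; ext n
  unfold bc
  rw [Nat.add_zero, show n + 1 + 1 = (n + 1) + 1 by rfl, show n + 2 = (n + 1) + 1 by rfl,
    Nat.factorial_succ (n + 1), Nat.factorial_succ n]
  have h2 : (n.factorial : ℝ) ≠ 0 := by positivity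
  push_cast; field_simp; ring

theorem bf_nonneg (j : ℕ) {y : ℝ} (hy : 0 ≤ y) : 0 ≤ bf j y :=
  tsum_nonneg fun n => mul_nonneg (bc_nonneg j n) (pow_nonneg hy n)

theorem bf_zero (j : ℕ) : bf j 0 = 1 / (j.factorial : ℝ) := by
  unfold bf
  rw [tsum_eq_single 0 (fun n hn => by simp [hn])]
  simp [bc]

theorem bf_pos {y : ℝ} (hy : 0 ≤ y) : 0 < bf 0 y := by
  unfold bf
  refine (summable_ser (bc_le 0) y).tsum_pos
    (fun n => mul_nonneg (bc_nonneg 0 n) (pow_nonneg hy n)) 0 ?_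
  simp [bc]

theorem continuous_bf (j : ℕ) : Continuous (bf j) :=
  continuous_iff_continuousAt.2 fun y => (hasDerivAt_bf j y).continuousAt

theorem bf_logconc {y : ℝ} (hy : 0 < y) : bf 0 y * bf 2 y ≤ bf 1 y ^ 2 := by
  have hd : ∀ y, HasDerivAt (fun y => y * bf 1 y ^ 2 - bf 0 y ^ 2 + bf 0 y * bf 1 y)
      (bf 0 y * bf 2 y) y := by
    intro y
    have h0 := hasDerivAt_bf 0 y
    have h1 := hasDerivAt_bf 1 y
    have := (((hasDerivAt_id y).mul (h1.pow 2)).sub (h0.pow 2)).add (h0.mul h1)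
    convert! this using 1
    have ho := bf_ode y
    simp only [id, zero_add, one_add_one_eq_two, Pi.pow_apply, Nat.cast_ofNat]
    norm_num
    rw [← ho]; ring
  have hm : MonotoneOn (fun y => y * bf 1 y ^ 2 - bf 0 y ^ 2 + bf 0 y * bf 1 y) (Set.Ici 0) := by
    refine monotoneOn_of_deriv_nonneg (convex_Ici 0)
      (fun y _ => (hd y).continuousAt.continuousWithinAt)
      (fun y _ => (hd y).differentiableAt.differentiableWithinAt) fun y hy => ?_
    rw [(hd y).deriv]
    have : 0 ≤ y := by rw [interior_Ici] at hy; exact le_of_lt hy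
    exact mul_nonneg (bf_nonneg 0 this) (bf_nonneg 2 this)
  have := hm (Set.mem_Ici.2 le_rfl) (Set.mem_Ici.2 hy.le) hy.le
  simp only [bf_zero] at this
  norm_num at this
  have ho := bf_ode y
  have : 0 ≤ y * (bf 1 y ^ 2 - bf 0 y * bf 2 y) := by
    have e : y * (bf 1 y ^ 2 - bf 0 y * bf 2 y) = y * bf 1 y ^ 2 - bf 0 y * (bf 0 y - bf 1 y) := by
      rw [← ho]; ring
    rw [e]; nlinarith
  have := nonneg_of_mul_nonneg_right this hy
  linarith

theorem bf_concave : ConcaveOn ℝ (Set.Ici 0) (fun y => Real.log (bf 0 y)) := by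
  have hd : ∀ y, 0 ≤ y → HasDerivAt (fun y => Real.log (bf 0 y)) (bf 1 y / bf 0 y) y := fun y hy =>
    (hasDerivAt_bf 0 y).log (bf_pos hy).ne'
  refine AntitoneOn.concaveOn_of_deriv (convex_Ici 0)
    (fun y hy => (hd y hy).continuousAt.continuousWithinAt)
    (fun y hy => (hd y (interior_subset hy)).differentiableAt.differentiableWithinAt) ?_
  have hq : AntitoneOn (fun y => bf 1 y / bf 0 y) (interior (Set.Ici 0)) := by
    have hd2 : ∀ y, 0 < y → HasDerivAt (fun y => bf 1 y / bf 0 y)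
      ((bf 2 y * bf 0 y - bf 1 y * bf 1 y) / bf 0 y ^ 2) y := fun y hy =>
      (hasDerivAt_bf 1 y).div (hasDerivAt_bf 0 y) (bf_pos hy.le).ne'
    rw [interior_Ici]
    refine antitoneOn_of_deriv_nonpos (convex_Ioi 0)
      (fun y hy => (hd2 y hy).continuousAt.continuousWithinAt)
      (fun y hy => (hd2 y (interior_subset hy)).differentiableAt.differentiableWithinAt)
      fun y hy => ?_
    have hy' : 0 < y := interior_subset hy
    rw [(hd2 y hy').deriv]
    apply div_nonpos_of_nonpos_of_nonneg _ (by positivity)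
    nlinarith [bf_logconc hy']
  intro x hx y hy hxy
  rw [(hd x (interior_subset hx)).deriv, (hd y (interior_subset hy)).deriv]
  exact hq hx hy hxy

theorem bf_LC {x y d : ℝ} (hx : 0 ≤ x) (hxy : x ≤ y) (hd : 0 ≤ d) :
    bf 0 x * bf 0 (y + d) ≤ bf 0 (x + d) * bf 0 y := by
  have hy : 0 ≤ y := hx.trans hxy
  rcases hd.eq_or_lt with rfl | hd'
  · simp
  have hlt : x < y + d := by linarith
  set w := y + d - x
  have hw : 0 < w := by simp only [w]; linarith
  have c1 := bf_concave.2 (Set.mem_Ici.2 hx) (Set.mem_Ici.2 (show 0 ≤ y + d by linarith))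
    (show 0 ≤ (y - x) / w from div_nonneg (by linarith) hw.le) (show 0 ≤ d / w by positivity)
    (by rw [← add_div, div_eq_one_iff_eq hw.ne']; simp only [w]; ring)
  have c2 := bf_concave.2 (Set.mem_Ici.2 hx) (Set.mem_Ici.2 (show 0 ≤ y + d by linarith))
    (show 0 ≤ d / w by positivity) (show 0 ≤ (y - x) / w from div_nonneg (by linarith) hw.le)
    (by rw [← add_div, div_eq_one_iff_eq hw.ne']; simp only [w]; ring)
  simp only [smul_eq_mul] at c1 c2
  have e1 : (y - x) / w * x + d / w * (y + d) = x + d := by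
    field_simp; simp only [w]; ring
  have e2 : d / w * x + (y - x) / w * (y + d) = y := by
    field_simp; simp only [w]; ring
  have e3 : (y - x) / w + d / w = 1 := by
    rw [← add_div, div_eq_one_iff_eq hw.ne']; simp only [w]; ring
  rw [e1] at c1; rw [e2] at c2
  have hs : Real.log (bf 0 x) + Real.log (bf 0 (y + d)) ≤
      Real.log (bf 0 (x + d)) + Real.log (bf 0 y) := by
    have : Real.log (bf 0 x) + Real.log (bf 0 (y + d)) =
      ((y - x) / w + d / w) * (Real.log (bf 0 x) + Real.log (bf 0 (y + d))) := by rw [e3, one_mul]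
    rw [this]; linarith
  have p1 := bf_pos hx
  have p2 := bf_pos hy
  have p3 := bf_pos (show 0 ≤ y + d by linarith)
  have p4 := bf_pos (show 0 ≤ x + d by linarith)
  rw [← Real.log_mul p1.ne' p3.ne', ← Real.log_mul p4.ne' p2.ne'] at hs
  exact (Real.log_le_log_iff (by positivity) (by positivity)).1 hs

/-- one-sided kernel -/
def hk (c q : ℝ) (x : ℝ) : ℝ :=
  Set.indicator (Set.Ici 0) (fun x => c * Real.exp (-q) * (Real.exp (-c * x) * bf 0 (q * c * x))) x

theorem hk_nonneg {c q : ℝ} (hc : 0 < c) (hq : 0 ≤ q) (x : ℝ) : 0 ≤ hk c q x := by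
  unfold hk
  apply Set.indicator_nonneg
  intro x hx
  have : 0 ≤ bf 0 (q * c * x) := bf_nonneg 0 (mul_nonneg (mul_nonneg hq hc.le) hx)
  positivity

theorem hk_LC {c q : ℝ} (hc : 0 < c) (hq : 0 ≤ q) : LC (hk c q) := by
  intro x y d hxy hd
  by_cases hx : 0 ≤ x
  · unfold hk
    rw [Set.indicator_of_mem (Set.mem_Ici.2 hx),
      Set.indicator_of_mem (Set.mem_Ici.2 (show 0 ≤ y + d by linarith)),
      Set.indicator_of_mem (Set.mem_Ici.2 (show 0 ≤ x + d by linarith)),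
      Set.indicator_of_mem (Set.mem_Ici.2 (show 0 ≤ y by linarith))]
    have hqc : 0 ≤ q * c := by positivity
    have h1 := bf_LC (x := q * c * x) (y := q * c * y) (d := q * c * d) (by positivity)
      (by gcongr) (by positivity)
    rw [← mul_add, ← mul_add] at h1
    have h2 : Real.exp (-c * x) * Real.exp (-c * (y + d)) =
      Real.exp (-c * (x + d)) * Real.exp (-c * y) := by
      rw [← Real.exp_add, ← Real.exp_add]; congr 1; ring
    calc _ = (c * Real.exp (-q)) ^ 2 * ((Real.exp (-c * x) * Real.exp (-c * (y + d))) *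
          (bf 0 (q * c * x) * bf 0 (q * c * (y + d)))) := by ring
      _ ≤ (c * Real.exp (-q)) ^ 2 * ((Real.exp (-c * x) * Real.exp (-c * (y + d))) *
          (bf 0 (q * c * (x + d)) * bf 0 (q * c * y))) := by gcongr
      _ = _ := by rw [h2]; ring
  · have : hk c q x = 0 := Set.indicator_of_notMem (by simpa using hx) _
    rw [this, zero_mul]
    exact mul_nonneg (hk_nonneg hc hq _) (hk_nonneg hc hq _)

theorem integrableOn_pow_exp {c : ℝ} (hc : 0 < c) (n : ℕ) :
    IntegrableOn (fun x : ℝ => x ^ n * Real.exp (-c * x)) (Set.Ioi 0) := by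
  have := integrableOn_rpow_mul_exp_neg_mul_rpow (p := 1) (s := n) (b := c)
    (by have : (0 : ℝ) ≤ n := by positivity
        linarith) one_pos hc
  refine this.congr_fun (fun x _ => ?_) measurableSet_Ioi
  simp

theorem norm_powexp {w : ℂ} (n : ℕ) {x : ℝ} (hx : 0 < x) :
    ‖(x : ℂ) ^ n * Complex.exp (-w * x)‖ = x ^ n * Real.exp (-w.re * x) := by
  rw [norm_mul, norm_pow, Complex.norm_exp, Complex.norm_real, Real.norm_of_nonneg hx.le]
  simp

theorem integrableOn_pow_cexp {w : ℂ} (hw : 0 < w.re) (n : ℕ) :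
    IntegrableOn (fun x : ℝ => (x : ℂ) ^ n * Complex.exp (-w * x)) (Set.Ioi 0) := by
  refine (integrable_norm_iff (Continuous.aestronglyMeasurable (by fun_prop))).1 ?_
  refine (integrableOn_pow_exp hw n).congr_fun (fun x hx => ?_) measurableSet_Ioi
  exact (norm_powexp n hx).symm

theorem integral_pow_cexp {w : ℂ} (hw : 0 < w.re) (n : ℕ) :
    ∫ x in Set.Ioi (0 : ℝ), (x : ℂ) ^ n * Complex.exp (-w * x) = n.factorial / w ^ (n + 1) := by
  have hw0 : w ≠ 0 := fun h => by simp [h] at hw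
  have hd : ∀ x : ℝ, HasDerivAt (fun x : ℝ => Complex.exp (-w * x))
      (Complex.exp (-w * x) * -w) x := by
    intro x
    have h := ((hasDerivAt_id (x : ℂ)).const_mul (-w)).cexp.comp_ofReal
    simpa using h
  have hlim : ∀ n : ℕ, Tendsto (fun x : ℝ => (x : ℂ) ^ n * Complex.exp (-w * x)) atTop (𝓝 0) := by
    intro n
    rw [tendsto_zero_iff_norm_tendsto_zero]
    have := tendsto_rpow_mul_exp_neg_mul_atTop_nhds_zero n w.re hw
    refine this.congr' ?_
    filter_upwards [eventually_gt_atTop 0] with x hx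
    rw [norm_powexp n hx]; simp
  induction n with
  | zero =>
    have := integral_Ioi_of_hasDerivAt_of_tendsto' (a := (0 : ℝ))
      (fun x _ => hd x) (by
        have : IntegrableOn (fun x : ℝ => (x : ℂ) ^ 0 * Complex.exp (-w * x) * -w) (Set.Ioi 0) :=
          (integrableOn_pow_cexp hw 0).mul_const (-w)
        simpa using this) (by simpa using hlim 0)
    rw [integral_mul_const] at this
    simp only [pow_zero, one_mul, Nat.factorial_zero, Nat.cast_one, zero_add, pow_one]
    field_simp
    simp at this ⊢
    linear_combination this
  | succ n ih =>
    have hd2 : ∀ x : ℝ, HasDerivAt (fun x : ℝ => (x : ℂ) ^ (n + 1) * Complex.exp (-w * x))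
        ((n + 1 : ℂ) * ((x : ℂ) ^ n * Complex.exp (-w * x)) -
          w * ((x : ℂ) ^ (n + 1) * Complex.exp (-w * x))) x := by
      intro x
      have h1 : HasDerivAt (fun x : ℝ => (x : ℂ) ^ (n + 1)) ((n + 1 : ℂ) * (x : ℂ) ^ n) x := by
        have := (hasDerivAt_pow (n + 1) (x : ℂ)).comp_ofReal
        simpa using this
      convert! h1.mul (hd x) using 1
      ring
    have i1 := (integrableOn_pow_cexp hw n).const_mul (n + 1 : ℂ)
    have i2 := (integrableOn_pow_cexp hw (n + 1)).const_mul w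
    have := integral_Ioi_of_hasDerivAt_of_tendsto' (a := (0 : ℝ))
      (fun x _ => hd2 x) (i1.sub i2) (hlim (n + 1))
    rw [integral_sub i1 i2, integral_const_mul, integral_const_mul, ih] at this
    simp only [Complex.ofReal_zero, ne_eq, Nat.add_eq_zero_iff, one_ne_zero, and_false,
      not_false_eq_true, zero_pow, zero_mul, sub_zero] at this
    rw [Nat.factorial_succ]; push_cast
    field_simp
    field_simp at this
    linear_combination -this

end Cheeger

namespace Cheeger

theorem bf_le {q c x : ℝ} (hq : 0 ≤ q) (hcx : 0 ≤ c * x) :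
    bf 0 (q * c * x) ≤ Real.exp (2 * q) * Real.exp (c * x / 2) := by
  rw [Real.exp_eq_exp_ℝ, NormedSpace.exp_eq_tsum_div]
  simp only
  rw [← tsum_mul_left]
  unfold bf
  refine Summable.tsum_le_tsum (fun n => ?_) (summable_ser (bc_le 0) _)
    ((Real.summable_pow_div_factorial _).mul_left _)
  have h1 : (2 * q) ^ n / (n.factorial : ℝ) ≤ NormedSpace.exp (2 * q) := by
    rw [← Real.exp_eq_exp_ℝ]; exact Real.pow_div_factorial_le_exp _ (by positivity) n
  rw [NormedSpace.exp_eq_tsum_div] at h1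
  calc bc 0 n * (q * c * x) ^ n = (2 * q) ^ n / (n.factorial : ℝ) * ((c * x / 2) ^ n / n.factorial) := by
        unfold bc
        rw [div_pow, Nat.add_zero]
        rw [show (q * c * x) ^ n = q ^ n * (c * x) ^ n by rw [← mul_pow]; ring, mul_pow 2 q]
        field_simp
    _ ≤ _ := by
        apply mul_le_mul_of_nonneg_right h1; positivity

theorem integrable_hk {c q : ℝ} (hc : 0 < c) (hq : 0 ≤ q) : Integrable (hk c q) := by
  unfold hk
  rw [show (fun x => Set.indicator (Set.Ici 0) (fun x => c * Real.exp (-q) *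
    (Real.exp (-c * x) * bf 0 (q * c * x))) x) = Set.indicator (Set.Ici 0) (fun x => c * Real.exp (-q) *
    (Real.exp (-c * x) * bf 0 (q * c * x))) from rfl, integrable_indicator_iff measurableSet_Ici,
    integrableOn_Ici_iff_integrableOn_Ioi]
  have hcont : Continuous (fun x => c * Real.exp (-q) *
    (Real.exp (-c * x) * bf 0 (q * c * x))) := by
    have := continuous_bf 0
    fun_prop
  have h1 : IntegrableOn (fun x : ℝ => c * Real.exp (-q) * Real.exp (2 * q) *
      (x ^ 0 * Real.exp (-(c / 2) * x))) (Set.Ioi 0) :=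
    (integrableOn_pow_exp (half_pos hc) 0).const_mul _
  refine Integrable.mono' h1 hcont.aestronglyMeasurable ?_
  refine (ae_restrict_iff' measurableSet_Ioi).2 (Eventually.of_forall fun x hx => ?_)
  have hx0 : 0 < x := hx
  have hb := bf_le (q := q) (c := c) (x := x) hq (by positivity)
  have h0 := bf_nonneg 0 (show 0 ≤ q * c * x by positivity)
  rw [Real.norm_of_nonneg (by positivity)]
  calc c * Real.exp (-q) * (Real.exp (-c * x) * bf 0 (q * c * x))
      ≤ c * Real.exp (-q) * (Real.exp (-c * x) * (Real.exp (2 * q) * Real.exp (c * x / 2))) := by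
        gcongr
    _ = c * Real.exp (-q) * Real.exp (2 * q) * (Real.exp (-c * x) * Real.exp (c * x / 2)) := by ring
    _ = _ := by rw [← Real.exp_add, pow_zero, one_mul]; congr 2; ring

theorem hat_hk {c q : ℝ} (hc : 0 < c) (hq : 0 ≤ q) (x : ℝ) :
    hat (hk c q) x = c / (c + Complex.I * x) * Complex.exp (-q * (Complex.I * x / (c + Complex.I * x))) := by
  set w : ℂ := c + Complex.I * x with hw
  have hwre : w.re = c := by simp [hw]
  have hw0 : w ≠ 0 := fun h => by rw [h] at hwre; simp at hwre; exact hc.ne hwre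
  set F : ℕ → ℝ → ℂ := fun n u => ((c * Real.exp (-q) * bc 0 n * (q * c) ^ n : ℝ) : ℂ) *
    ((u : ℂ) ^ n * Complex.exp (-w * u)) with hF
  have hFint : ∀ n, Integrable (F n) (volume.restrict (Set.Ioi 0)) := fun n =>
    (integrableOn_pow_cexp (by rw [hwre]; exact hc) n).const_mul _
  have hnorm : ∀ n, ∫ u in Set.Ioi (0 : ℝ), ‖F n u‖ = Real.exp (-q) * (q ^ n / n.factorial) := by
    intro n
    have h1 : ∫ u in Set.Ioi (0 : ℝ), ‖F n u‖ = ∫ u in Set.Ioi (0 : ℝ),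
        (c * Real.exp (-q) * bc 0 n * (q * c) ^ n) * (u ^ n * Real.exp (-c * u)) := by
      refine setIntegral_congr_fun measurableSet_Ioi fun u hu => ?_
      simp only [hF]
      rw [norm_mul, norm_powexp n hu, hwre, Complex.norm_real, Real.norm_of_nonneg]
      have := bc_nonneg 0 n; positivity
    have h2 : ∫ u in Set.Ioi (0 : ℝ), u ^ n * Real.exp (-c * u) = n.factorial / c ^ (n + 1) := by
      have := integral_pow_cexp (w := (c : ℂ)) (by simpa using hc) n
      have h3 : ∫ x in Set.Ioi (0 : ℝ), (x : ℂ) ^ n * Complex.exp (-(c : ℂ) * x) =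
        ((∫ x in Set.Ioi (0 : ℝ), x ^ n * Real.exp (-c * x) : ℝ) : ℂ) := by
        rw [← integral_complex_ofReal]; congr 1; ext x; push_cast; rfl
      rw [h3] at this
      exact_mod_cast this
    rw [h1, integral_const_mul, h2]
    unfold bc
    have : (n.factorial : ℝ) ≠ 0 := by positivity
    rw [Nat.add_zero, mul_pow]; field_simp; ring
  have hs := hasSum_integral_of_summable_integral_norm hFint (by
    simp_rw [hnorm]; exact (Real.summable_pow_div_factorial q).mul_left _)
  have hI : ∀ n, ∫ u in Set.Ioi (0 : ℝ), F n u = c / w * Complex.exp (-q) * ((q * c / w) ^ n / n.factorial) := by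
    intro n
    simp only [hF]
    rw [integral_const_mul, integral_pow_cexp (by rw [hwre]; exact hc) n]
    unfold bc
    have : (n.factorial : ℂ) ≠ 0 := by exact_mod_cast n.factorial_ne_zero
    push_cast
    rw [Nat.add_zero, div_pow]; field_simp; ring
  have hsum : ∀ u ∈ Set.Ioi (0 : ℝ), ∑' n, F n u = (hk c q u : ℂ) * Complex.exp (-(Complex.I * x * u)) := by
    intro u hu
    have hu' : u ∈ Set.Ici (0 : ℝ) := (Set.mem_Ioi.1 hu).le
    unfold hk
    rw [Set.indicator_of_mem hu']
    have e1 : Complex.exp (-w * u) = Complex.exp (-c * u) * Complex.exp (-(Complex.I * x * u)) := by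
      rw [← Complex.exp_add]; congr 1; rw [hw]; ring
    have e2 : ∀ n, F n u = (c * Complex.exp (-q) * (Complex.exp (-c * u)) * Complex.exp (-(Complex.I * x * u))) *
        ((bc 0 n * (q * c * u) ^ n : ℝ) : ℂ) := by
      intro n; simp only [hF]; rw [e1]; push_cast; ring
    simp_rw [e2]
    rw [tsum_mul_left, ← Complex.ofReal_tsum]
    unfold bf; push_cast; ring
  unfold hat
  have hsupp : ∫ u : ℝ, (hk c q u : ℂ) * Complex.exp (-(Complex.I * x * u)) =
      ∫ u in Set.Ioi (0 : ℝ), (hk c q u : ℂ) * Complex.exp (-(Complex.I * x * u)) := by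
    rw [← integral_Ici_eq_integral_Ioi, setIntegral_eq_integral_of_forall_compl_eq_zero]
    intro u hu
    have : hk c q u = 0 := Set.indicator_of_notMem hu _
    rw [this]; simp
  rw [hsupp, ← setIntegral_congr_fun measurableSet_Ioi hsum, ← hs.tsum_eq]
  simp_rw [hI]
  have hE : ∑' n : ℕ, (q * c / w) ^ n / (n.factorial : ℂ) = Complex.exp (q * c / w) := by
    rw [Complex.exp_eq_exp_ℂ, NormedSpace.exp_eq_tsum_div]
  rw [tsum_mul_left, hE, mul_assoc, ← Complex.exp_add]
  congr 2
  field_simp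
  rw [hw]; ring

def Lf (c : ℝ) (x : ℝ) : ℝ := c ^ 2 / (c ^ 2 + x ^ 2)
def Ef (c q : ℝ) (x : ℝ) : ℝ := Real.exp (-(2 * q * x ^ 2) / (c ^ 2 + x ^ 2))

theorem hat_hk_sq {c q : ℝ} (hc : 0 < c) (hq : 0 ≤ q) (x : ℝ) :
    hat (hk c q) x * hat (hk c q) (-x) = ((Lf c x * Ef c q x : ℝ) : ℂ) := by
  rw [hat_hk hc hq, hat_hk hc hq]
  unfold Lf Ef
  have h1 : (c : ℂ) + Complex.I * x ≠ 0 := fun h => by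
    have := congrArg Complex.re h; simp at this; exact hc.ne' this
  have h2 : (c : ℂ) - Complex.I * x ≠ 0 := fun h => by
    have := congrArg Complex.re h; simp at this; exact hc.ne' this
  have h3 : (c : ℂ) ^ 2 + x ^ 2 = (c + Complex.I * x) * (c - Complex.I * x) := by
    ring_nf; rw [Complex.I_sq]; ring
  push_cast
  rw [h3, mul_mul_mul_comm, ← Complex.exp_add]
  have e : (c : ℂ) + Complex.I * -x = c - Complex.I * x := by ring
  rw [e]
  congr 1
  · field_simp
  · congr 1; field_simp
    ring_nf; rw [Complex.I_sq]; ring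

theorem LCC.mul_LE {A : ℝ → ℂ} (hA : LCC A) {c q : ℝ} (hc : 0 < c) (hq : 0 ≤ q) :
    LCC (fun x => A x * ((Lf c x * Ef c q x : ℝ) : ℂ)) := by
  have := hA.mul_hat2 (integrable_hk hc hq) (hk_nonneg hc hq) (hk_LC hc hq)
  simp_rw [hat_hk_sq hc hq] at this
  exact this

theorem LCC.mul_prod {ι : Type*} (t : Finset ι) {c q : ι → ℝ} (hc : ∀ i, 0 < c i) (hq : ∀ i, 0 ≤ q i)
    {A : ℝ → ℂ} (hA : LCC A) :
    LCC (fun x => A x * ((∏ i ∈ t, Lf (c i) x * Ef (c i) (q i) x : ℝ) : ℂ)) := by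
  classical
  induction t using Finset.induction_on with
  | empty => simpa using hA
  | insert i t hi ih =>
    have := ih.mul_LE (hc i) (hq i)
    refine cast (congrArg LCC ?_) this
    ext x; rw [Finset.prod_insert hi]; push_cast; ring

theorem LCC.prod {ι : Type*} (t : Finset ι) {c q : ι → ℝ} (hc : ∀ i, 0 < c i) (hq : ∀ i, 0 ≤ q i)
    (hinteg : Integrable (fun x => ∏ i ∈ t, Lf (c i) x * Ef (c i) (q i) x)) :
    LCC (fun x => ((∏ i ∈ t, Lf (c i) x * Ef (c i) (q i) x : ℝ) : ℂ)) := by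
  refine LCC.limit (A := fun n : ℕ => fun x => Complex.exp (-((1 / ((n : ℝ) + 1) : ℝ) : ℂ) * (x : ℂ) ^ 2) *
    ((∏ i ∈ t, Lf (c i) x * Ef (c i) (q i) x : ℝ) : ℂ)) (fun n => ?_) hinteg.ofReal ?_ ?_
  · exact (LCC.gauss (η := 1 / ((n : ℝ) + 1)) (by positivity)).mul_prod t hc hq
  · intro n x
    rw [norm_mul]
    refine mul_le_of_le_one_left (norm_nonneg _) ?_
    rw [Complex.norm_exp]
    apply Real.exp_le_one_iff.2
    rw [← Complex.ofReal_neg, ← Complex.ofReal_pow, ← Complex.ofReal_mul, Complex.ofReal_re]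
    have : 0 ≤ 1 / ((n : ℝ) + 1) * x ^ 2 := by positivity
    linarith
  · intro x
    have h1 : Tendsto (fun n : ℕ => ((1 / ((n : ℝ) + 1) : ℝ) : ℂ)) atTop (𝓝 ((0 : ℝ) : ℂ)) :=
      (Complex.continuous_ofReal.tendsto _).comp tendsto_one_div_add_atTop_nhds_zero_nat
    have h2 := ((Complex.continuous_exp.tendsto _).comp ((h1.neg).mul_const ((x : ℂ) ^ 2))).mul_const
      (((∏ i ∈ t, Lf (c i) x * Ef (c i) (q i) x : ℝ) : ℂ))
    simpa using h2

end Cheeger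

namespace Cheeger

/-- real cosine transform -/
def RP (A : ℝ → ℝ) (s : ℝ) : ℝ := ∫ x, A x * Real.cos (x * s)

theorem re_expI (b x s : ℝ) : ((b : ℂ) * Complex.exp (Complex.I * x * s)).re = b * Real.cos (x * s) := by
  have : Complex.I * (x : ℂ) * s = ((x * s : ℝ) : ℂ) * Complex.I := by push_cast; ring
  rw [this, Complex.re_ofReal_mul, Complex.exp_ofReal_mul_I_re]

theorem RP_eq {A : ℝ → ℝ} (hA : Integrable A) (s : ℝ) :
    RP A s = (Ps (fun x => (A x : ℂ)) s).re := by
  unfold RP Ps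
  have h := integrable_Ps (A := fun x => (A x : ℂ)) hA.ofReal s
  have := integral_re h
  simp only [RCLike.re_to_complex] at this
  rw [← this]
  congr 1; ext x; rw [re_expI]

theorem integrable_RP {A : ℝ → ℝ} (hA : Integrable A) (s : ℝ) :
    Integrable (fun x => A x * Real.cos (x * s)) :=
  hA.mul_bdd (c := 1) (by fun_prop) (Eventually.of_forall fun x => Real.abs_cos_le_one _)

theorem continuous_RP {A : ℝ → ℝ} (hA : Integrable A) : Continuous (RP A) := by
  have := Complex.continuous_re.comp (continuous_Ps (A := fun x => (A x : ℂ)) hA.ofReal)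
  exact this.congr fun s => (RP_eq hA s).symm

theorem abs_RP_le {A : ℝ → ℝ} (hA : Integrable A) (s : ℝ) : |RP A s| ≤ ∫ x, |A x| := by
  rw [RP_eq hA]
  refine (Complex.abs_re_le_norm _).trans ((norm_Ps_le s).trans (le_of_eq ?_))
  simp

theorem RP_neg (A : ℝ → ℝ) (s : ℝ) : RP A (-s) = RP A s := by
  unfold RP; simp

def lapk (c u : ℝ) : ℝ := c / 2 * Real.exp (-c * |u|)

theorem lapk_nonneg {c : ℝ} (hc : 0 < c) (u : ℝ) : 0 ≤ lapk c u := by unfold lapk; positivity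

theorem lap_aux {c : ℝ} (γ : ℂ) (h : |γ.re| < c) :
    Integrable (fun u : ℝ => (lapk c u : ℂ) * Complex.exp (γ * u)) ∧
    ∫ u : ℝ, (lapk c u : ℂ) * Complex.exp (γ * u) = c ^ 2 / (c ^ 2 - γ ^ 2) := by
  have h1 := abs_lt.1 h
  have e1 : ∀ u ∈ Set.Ioi (0 : ℝ), (c / 2 : ℂ) * Complex.exp ((γ - c) * u) =
      (lapk c u : ℂ) * Complex.exp (γ * u) := by
    intro u hu
    unfold lapk; rw [abs_of_pos hu]; push_cast; rw [mul_assoc, ← Complex.exp_add]; ring_nf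
  have e2 : ∀ u ∈ Set.Iic (0 : ℝ), (c / 2 : ℂ) * Complex.exp ((γ + c) * u) =
      (lapk c u : ℂ) * Complex.exp (γ * u) := by
    intro u hu
    unfold lapk; rw [abs_of_nonpos hu]; push_cast; rw [mul_assoc, ← Complex.exp_add]; ring_nf
  have r1 : (γ - c).re < 0 := by simp; linarith
  have r2 : 0 < (γ + c).re := by simp; linarith
  have n1 : γ - c ≠ 0 := fun h => by rw [h] at r1; simp at r1
  have n2 : γ + c ≠ 0 := fun h => by rw [h] at r2; simp at r2
  have i1 : IntegrableOn (fun u : ℝ => (lapk c u : ℂ) * Complex.exp (γ * u)) (Set.Ioi 0) :=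
    IntegrableOn.congr_fun ((integrableOn_exp_mul_complex_Ioi r1 0).const_mul (c / 2 : ℂ)) e1
      measurableSet_Ioi
  have i2 : IntegrableOn (fun u : ℝ => (lapk c u : ℂ) * Complex.exp (γ * u)) (Set.Iic 0) :=
    IntegrableOn.congr_fun ((integrableOn_exp_mul_complex_Iic r2 0).const_mul (c / 2 : ℂ)) e2
      measurableSet_Iic
  constructor
  · rw [← integrableOn_univ, ← Set.Iic_union_Ioi (a := (0 : ℝ))]; exact i2.union i1
  · rw [← intervalIntegral.integral_Iic_add_Ioi i2 i1, ← setIntegral_congr_fun measurableSet_Ioi e1,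
      ← setIntegral_congr_fun measurableSet_Iic e2, integral_const_mul, integral_const_mul,
      integral_exp_mul_complex_Ioi r1, integral_exp_mul_complex_Iic r2]
    have n3 : (c : ℂ) ^ 2 - γ ^ 2 ≠ 0 := by
      have : (c : ℂ) ^ 2 - γ ^ 2 = - ((γ - c) * (γ + c)) := by ring
      rw [this]; exact neg_ne_zero.2 (mul_ne_zero n1 n2)
    simp
    field_simp
    ring

theorem lap_exp {c γ : ℝ} (h : |γ| < c) :
    Integrable (fun u : ℝ => lapk c u * Real.exp (γ * u)) ∧
    ∫ u : ℝ, lapk c u * Real.exp (γ * u) = c ^ 2 / (c ^ 2 - γ ^ 2) := by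
  obtain ⟨h1, h2⟩ := lap_aux (c := c) (γ : ℂ) (by simpa using h)
  have e : ∀ u : ℝ, (lapk c u : ℂ) * Complex.exp (γ * u) = ((lapk c u * Real.exp (γ * u) : ℝ) : ℂ) := by
    intro u; push_cast; rfl
  simp_rw [e] at h1 h2
  rw [integral_complex_ofReal] at h2
  constructor
  · exact_mod_cast h1.re
  · exact_mod_cast h2

theorem integrable_lapk {c : ℝ} (hc : 0 < c) : Integrable (lapk c) := by
  have := (lap_exp (c := c) (γ := 0) (by simpa using hc)).1
  simpa using this

theorem integral_lapk {c : ℝ} (hc : 0 < c) : ∫ u, lapk c u = 1 := by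
  have := (lap_exp (c := c) (γ := 0) (by simpa using hc)).2
  simp at this
  rw [this]; field_simp

theorem hat_lapk {c : ℝ} (hc : 0 < c) (x : ℝ) : hat (lapk c) x = ((Lf c x : ℝ) : ℂ) := by
  have := (lap_aux (c := c) (-(Complex.I * x)) (by simpa using hc)).2
  unfold hat Lf
  rw [show (fun u : ℝ => (lapk c u : ℂ) * Complex.exp (-(Complex.I * x * u))) =
    fun u : ℝ => (lapk c u : ℂ) * Complex.exp (-(Complex.I * x) * u) by ext u; congr 2; ring, this]
  push_cast; congr 1; rw [neg_sq, mul_pow, Complex.I_sq]; ring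

theorem Lf_pos {c : ℝ} (hc : 0 < c) (x : ℝ) : 0 < Lf c x := by unfold Lf; positivity
theorem Lf_le {c : ℝ} (hc : 0 < c) (x : ℝ) : Lf c x ≤ 1 := by
  unfold Lf; rw [div_le_one (by positivity)]; nlinarith [sq_nonneg x]
theorem continuous_Lf {c : ℝ} (hc : 0 < c) : Continuous (Lf c) := by
  unfold Lf
  refine Continuous.div (by fun_prop) (by fun_prop) fun x => ?_
  positivity

theorem integrable_mul_L {A : ℝ → ℝ} (hA : Integrable A) {c : ℝ} (hc : 0 < c) :
    Integrable (fun x => A x * Lf c x) :=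
  hA.mul_bdd (c := 1) (continuous_Lf hc).aestronglyMeasurable
    (Eventually.of_forall fun x => by
      rw [Real.norm_of_nonneg (Lf_pos hc x).le]; exact Lf_le hc x)

theorem integrable_RP_lapk {A : ℝ → ℝ} (hA : Integrable A) {c : ℝ} (hc : 0 < c) (s : ℝ) :
    Integrable (fun u => RP A (s - u) * lapk c u) := by
  simpa using integrable_conv (integrable_lapk hc) (continuous_RP hA) (fun s => abs_RP_le hA s) s 0

theorem RP_mul_L {A : ℝ → ℝ} (hA : Integrable A) {c : ℝ} (hc : 0 < c) (s : ℝ) :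
    RP (fun x => A x * Lf c x) s = ∫ u, RP A (s - u) * lapk c u := by
  rw [RP_eq (integrable_mul_L hA hc)]
  have h := Ps_mul_hat (A := fun x => (A x : ℂ)) hA.ofReal (integrable_lapk hc) s
  simp_rw [hat_lapk hc] at h
  push_cast
  rw [h]
  have hi : Integrable (fun u => Ps (fun x => (A x : ℂ)) (s - u) * (lapk c u : ℂ)) := by
    refine (integrable_lapk hc).ofReal.bdd_mul (c := ∫ x, ‖(A x : ℂ)‖)
      ((continuous_Ps (A := fun x => (A x : ℂ)) hA.ofReal).comp (by fun_prop : Continuous fun u : ℝ => s - u)).aestronglyMeasurable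
      (Eventually.of_forall fun u => norm_Ps_le _)
  have := integral_re hi
  simp only [RCLike.re_to_complex] at this
  rw [← this]
  congr 1; ext u; rw [Complex.re_mul_ofReal, RP_eq hA]

theorem RP_L_nonneg {A : ℝ → ℝ} (hA : Integrable A) (h0 : ∀ s, 0 ≤ RP A s) {c : ℝ} (hc : 0 < c) (s : ℝ) :
    0 ≤ RP (fun x => A x * Lf c x) s := by
  rw [RP_mul_L hA hc]
  exact integral_nonneg fun u => mul_nonneg (h0 _) (lapk_nonneg hc u)

theorem RP_L_shift {A : ℝ → ℝ} (hA : Integrable A) (h0 : ∀ s, 0 ≤ RP A s) {c : ℝ} (hc : 0 < c) (s v : ℝ) :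
    RP (fun x => A x * Lf c x) (s + v) ≤ Real.exp (c * |v|) * RP (fun x => A x * Lf c x) s := by
  rw [RP_mul_L hA hc, RP_mul_L hA hc]
  have : ∫ u, RP A (s + v - u) * lapk c u = ∫ u, RP A (s - u) * lapk c (u + v) := by
    rw [← integral_add_right_eq_self (fun u => RP A (s + v - u) * lapk c u) v]
    congr 1; ext u; congr 2; ring
  rw [this, ← integral_const_mul]
  refine integral_mono ?_ ((integrable_RP_lapk hA hc s).const_mul _) fun u => ?_
  · simpa using integrable_conv (integrable_lapk hc) (continuous_RP hA) (fun s => abs_RP_le hA s) s (-v)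
  · have : lapk c (u + v) ≤ Real.exp (c * |v|) * lapk c u := by
      unfold lapk
      have h1 : |u| ≤ |u + v| + |v| := by
        calc |u| = |(u + v) - v| := by ring_nf
          _ ≤ _ := abs_sub _ _
      have : Real.exp (-c * |u + v|) ≤ Real.exp (c * |v|) * Real.exp (-c * |u|) := by
        rw [← Real.exp_add, Real.exp_le_exp]; nlinarith
      nlinarith
    calc _ ≤ RP A (s - u) * (Real.exp (c * |v|) * lapk c u) := by gcongr; exact h0 _
      _ = _ := by ring

theorem RP_L_lower {A : ℝ → ℝ} (hA : Integrable A) {c d : ℝ} (hc : 0 < c) (hd : 0 ≤ d) (s : ℝ)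
    (h : ∀ u, Real.exp (-d * |u|) * RP A s ≤ RP A (s - u)) :
    c / (c + d) * RP A s ≤ RP (fun x => A x * Lf c x) s := by
  rw [RP_mul_L hA hc]
  have e : c / (c + d) * RP A s = ∫ u, c / (c + d) * RP A s * lapk (c + d) u := by
    rw [integral_const_mul, integral_lapk (by linarith), mul_one]
  rw [e]
  refine integral_mono ((integrable_lapk (by linarith)).const_mul _) (integrable_RP_lapk hA hc s) fun u => ?_
  have : c / (c + d) * RP A s * lapk (c + d) u = Real.exp (-d * |u|) * RP A s * lapk c u := by
    unfold lapk
    have : Real.exp (-(c + d) * |u|) = Real.exp (-d * |u|) * Real.exp (-c * |u|) := by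
      rw [← Real.exp_add]; ring_nf
    rw [this]
    have : c + d ≠ 0 := by positivity
    field_simp
  simp only [this]
  exact mul_le_mul_of_nonneg_right (h u) (lapk_nonneg hc u)

theorem RP_L_upper {A : ℝ → ℝ} (hA : Integrable A) {c γ B B' : ℝ} (hγ : |γ| < c) (s : ℝ)
    (h : ∀ u, RP A (s - u) ≤ B * Real.exp (γ * u) + B' * Real.exp (-γ * u)) (u : ℝ) :
    RP (fun x => A x * Lf c x) (s - u) ≤
      c ^ 2 / (c ^ 2 - γ ^ 2) * (B * Real.exp (γ * u) + B' * Real.exp (-γ * u)) := by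
  have hc : 0 < c := lt_of_le_of_lt (abs_nonneg _) hγ
  rw [RP_mul_L hA hc]
  obtain ⟨i1, e1⟩ := lap_exp hγ
  obtain ⟨i2, e2⟩ := lap_exp (c := c) (γ := -γ) (by rwa [abs_neg])
  have : c ^ 2 / (c ^ 2 - γ ^ 2) * (B * Real.exp (γ * u) + B' * Real.exp (-γ * u)) =
    ∫ v, (B * Real.exp (γ * u)) * (lapk c v * Real.exp (γ * v)) +
      (B' * Real.exp (-γ * u)) * (lapk c v * Real.exp (-γ * v)) := by
    rw [integral_add (i1.const_mul _) (i2.const_mul _), integral_const_mul, integral_const_mul, e1, e2]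
    rw [neg_sq]; ring
  rw [this]
  refine integral_mono (integrable_RP_lapk hA hc _) ((i1.const_mul _).add (i2.const_mul _)) fun v => ?_
  have h1 := mul_le_mul_of_nonneg_right (h (u + v)) (lapk_nonneg hc v)
  rw [mul_add, mul_add, Real.exp_add, Real.exp_add] at h1
  rw [show s - u - v = s - (u + v) by ring]
  calc _ ≤ _ := h1
    _ = _ := by ring

theorem RP_L_pow {A : ℝ → ℝ} (hA : Integrable A) (h0 : ∀ s, 0 ≤ RP A s) {c : ℝ} (hc : 0 < c) (n : ℕ) :
    Integrable (fun x => A x * Lf c x ^ n) ∧ ∀ s, 0 ≤ RP (fun x => A x * Lf c x ^ n) s := by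
  induction n with
  | zero => simpa using ⟨hA, h0⟩
  | succ n ih =>
    have e : (fun x => A x * Lf c x ^ (n + 1)) = fun x => (A x * Lf c x ^ n) * Lf c x := by
      ext x; ring
    rw [e]
    exact ⟨integrable_mul_L ih.1 hc, RP_L_nonneg ih.1 ih.2 hc⟩

theorem Ef_eq {c : ℝ} (hc : 0 < c) (q x : ℝ) :
    Ef c q x = Real.exp (-(2 * q)) * Real.exp (2 * q * Lf c x) := by
  unfold Ef Lf
  rw [← Real.exp_add]; congr 1
  have : c ^ 2 + x ^ 2 ≠ 0 := by positivity
  field_simp; ring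

theorem RP_E_nonneg {A : ℝ → ℝ} (hA : Integrable A) (h0 : ∀ s, 0 ≤ RP A s) {c q : ℝ} (hc : 0 < c)
    (hq : 0 ≤ q) (s : ℝ) : 0 ≤ RP (fun x => A x * Ef c q x) s := by
  set F : ℕ → ℝ → ℝ := fun n x => (2 * q) ^ n / n.factorial * ((A x * Lf c x ^ n) * Real.cos (x * s)) with hF
  have hFi : ∀ n, Integrable (F n) := fun n =>
    (integrable_RP (RP_L_pow hA h0 hc n).1 s).const_mul _
  have hs := hasSum_integral_of_summable_integral_norm hFi (by
    refine Summable.of_nonneg_of_le (fun n => integral_nonneg fun x => norm_nonneg _) (fun n => ?_)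
      ((Real.summable_pow_div_factorial (2 * q)).mul_right (∫ x, |A x|))
    rw [← integral_const_mul]
    refine integral_mono (hFi n).norm (hA.abs.const_mul _) fun x => ?_
    simp only [hF]
    rw [norm_mul, Real.norm_of_nonneg (by positivity)]
    refine mul_le_mul_of_nonneg_left ?_ (by positivity)
    rw [norm_mul, norm_mul, Real.norm_eq_abs, Real.norm_eq_abs, Real.norm_eq_abs]
    have h1 : |Lf c x ^ n| ≤ 1 := by
      rw [abs_of_nonneg (by have := Lf_pos hc x; positivity)]
      exact pow_le_one₀ (Lf_pos hc x).le (Lf_le hc x)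
    have h2 := Real.abs_cos_le_one (x * s)
    calc |A x| * |Lf c x ^ n| * |Real.cos (x * s)| ≤ |A x| * 1 * 1 := by gcongr
      _ = |A x| := by ring)
  have e : RP (fun x => A x * Ef c q x) s = Real.exp (-(2 * q)) * ∫ x, ∑' n, F n x := by
    unfold RP
    rw [← integral_const_mul]
    congr 1; ext x
    have : ∀ n, F n x = (A x * Real.cos (x * s)) * ((2 * q * Lf c x) ^ n / n.factorial) := by
      intro n; simp only [hF]; rw [mul_pow (2 * q)]; ring
    simp_rw [this]
    rw [tsum_mul_left, Ef_eq hc, Real.exp_eq_exp_ℝ, NormedSpace.exp_eq_tsum_div]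
    ring
  rw [e, ← hs.tsum_eq]
  refine mul_nonneg (Real.exp_pos _).le (tsum_nonneg fun n => ?_)
  simp only [hF]; rw [integral_const_mul]
  exact mul_nonneg (by positivity) ((RP_L_pow hA h0 hc n).2 s)

theorem Ef_pos (c q x : ℝ) : 0 < Ef c q x := Real.exp_pos _
theorem Ef_le {c q : ℝ} (hq : 0 ≤ q) (x : ℝ) : Ef c q x ≤ 1 := by
  unfold Ef
  apply Real.exp_le_one_iff.2
  apply div_nonpos_of_nonpos_of_nonneg
  · have : 0 ≤ 2 * q * x ^ 2 := by positivity
    linarith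
  · positivity
theorem continuous_Ef {c : ℝ} (hc : 0 < c) (q : ℝ) : Continuous (Ef c q) := by
  unfold Ef
  refine Real.continuous_exp.comp (Continuous.div (by fun_prop) (by fun_prop) fun x => ?_)
  positivity

end Cheeger

namespace Cheeger

/-- sine transform (minus the derivative of the cosine transform) -/
def RS (A : ℝ → ℝ) (s : ℝ) : ℝ := ∫ x, A x * (x * Real.sin (x * s))

theorem hasDerivAt_RP {A : ℝ → ℝ} (hA : Integrable A) (hA1 : Integrable (fun x => x * A x)) (s : ℝ) :
    HasDerivAt (RP A) (-RS A s) s := by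
  have := (hasDerivAt_integral_of_dominated_loc_of_deriv_le (μ := volume)
    (F := fun s x => A x * Real.cos (x * s)) (F' := fun s x => - (A x * (x * Real.sin (x * s))))
    (x₀ := s) (bound := fun x => |x * A x|) (s := Set.univ) univ_mem
    (Eventually.of_forall fun s => (integrable_RP hA s).aestronglyMeasurable)
    (integrable_RP hA s) ?_ ?_ hA1.abs ?_).2
  · unfold RS; rw [← integral_neg]; exact this
  · have : AEStronglyMeasurable (fun x => -((x * A x) * Real.sin (x * s))) :=
      (hA1.aestronglyMeasurable.mul (by fun_prop)).neg
    refine this.congr (Eventually.of_forall fun x => ?_)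
    ring
  · refine Eventually.of_forall fun x s _ => ?_
    rw [norm_neg, show A x * (x * Real.sin (x * s)) = (x * A x) * Real.sin (x * s) by ring, norm_mul]
    refine mul_le_of_le_one_right (norm_nonneg _) (Real.abs_sin_le_one _)
  · refine Eventually.of_forall fun x s _ => ?_
    have h1 : HasDerivAt (fun s => x * s) x s := by simpa using (hasDerivAt_id s).const_mul x
    have := (h1.cos).const_mul (A x)
    convert! this using 1; ring

/-- Facts about a positive, even, log-concave `C¹` function `P` with derivative `-D`. -/
structure LogC (P D : ℝ → ℝ) : Prop where
  pos : ∀ s, 0 < P s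
  der : ∀ s, HasDerivAt P (-D s) s
  even : ∀ s, P (-s) = P s
  lc : LC P

variable {P D : ℝ → ℝ}

theorem LogC.mono (h : LogC P D) {x y : ℝ} (hxy : x ≤ y) : D x * P y ≤ P x * D y := by
  have h1 : Tendsto (fun d => d⁻¹ * (P (x + d) - P x) * P y) (𝓝[>] 0) (𝓝 (-D x * P y)) := by
    have := (hasDerivAt_iff_tendsto_slope_zero.1 (h.der x)).mono_left
      (nhdsWithin_mono 0 (fun d (hd : d ∈ Set.Ioi 0) => ne_of_gt hd))
    exact (this.mul_const (P y)).congr fun d => by simp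
  have h2 : Tendsto (fun d => P x * (d⁻¹ * (P (y + d) - P y))) (𝓝[>] 0) (𝓝 (P x * -D y)) := by
    have := (hasDerivAt_iff_tendsto_slope_zero.1 (h.der y)).mono_left
      (nhdsWithin_mono 0 (fun d (hd : d ∈ Set.Ioi 0) => ne_of_gt hd))
    exact (this.const_mul (P x)).congr fun d => by simp
  have := le_of_tendsto_of_tendsto h2 h1 (by
    filter_upwards [self_mem_nhdsWithin] with d hd
    have hd' : 0 < d := hd
    have := h.lc x y d hxy hd'.le
    have hi : 0 < d⁻¹ := inv_pos.2 hd'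
    have : d⁻¹ * (P x * P (y + d)) ≤ d⁻¹ * (P (x + d) * P y) := by gcongr
    nlinarith)
  linarith

theorem LogC.odd (h : LogC P D) (s : ℝ) : D (-s) = -D s := by
  have h1 := (h.der (-s)).scomp s (hasDerivAt_neg s)
  have h2 : (P ∘ fun x => -x) = P := by ext s; simp [h.even]
  simp only [h2] at h1
  have := h1.unique (h.der s)
  simp at this; linarith

theorem LogC.D_nonneg (h : LogC P D) {s : ℝ} (hs : 0 ≤ s) : 0 ≤ D s := by
  have h0 : D 0 = 0 := by have := h.odd 0; simp at this; linarith
  have := h.mono hs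
  rw [h0, zero_mul] at this
  exact nonneg_of_mul_nonneg_right this (h.pos 0)

theorem LogC.tangent (h : LogC P D) (s u : ℝ) : P (s - u) ≤ P s * Real.exp (D s / P s * u) := by
  set e := D s / P s with he
  have hD : D s = e * P s := by rw [he]; field_simp [(h.pos s).ne']
  set g : ℝ → ℝ := fun v => P v * Real.exp (e * (v - s)) with hg
  have hd : ∀ v, HasDerivAt g ((-D v + e * P v) * Real.exp (e * (v - s))) v := by
    intro v
    have h1 : HasDerivAt (fun v => e * (v - s)) e v := by
      simpa using ((hasDerivAt_id v).sub_const s).const_mul e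
    convert! (h.der v).mul h1.exp using 1; ring
  have key : g (s - u) ≤ g s := by
    have hps := h.pos s
    rcases le_total 0 u with hu | hu
    · have : MonotoneOn g (Set.Iic s) := by
        refine monotoneOn_of_deriv_nonneg (convex_Iic s)
          (fun y _ => (hd y).continuousAt.continuousWithinAt)
          (fun y _ => (hd y).differentiableAt.differentiableWithinAt) fun v hv => ?_
        rw [(hd v).deriv]
        have := h.mono (Set.mem_Iic.1 (interior_subset hv))
        rw [hD] at this
        refine mul_nonneg ?_ (Real.exp_pos _).le
        have : P s * D v ≤ P s * (e * P v) := by nlinarith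
        linarith [le_of_mul_le_mul_left this hps]
      exact this (Set.mem_Iic.2 (by linarith)) (Set.mem_Iic.2 le_rfl) (by linarith)
    · have : AntitoneOn g (Set.Ici s) := by
        refine antitoneOn_of_deriv_nonpos (convex_Ici s)
          (fun y _ => (hd y).continuousAt.continuousWithinAt)
          (fun y _ => (hd y).differentiableAt.differentiableWithinAt) fun v hv => ?_
        rw [(hd v).deriv]
        have := h.mono (Set.mem_Ici.1 (interior_subset hv))
        rw [hD] at this
        refine mul_nonpos_of_nonpos_of_nonneg ?_ (Real.exp_pos _).le
        have : P s * (e * P v) ≤ P s * D v := by nlinarith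
        linarith [le_of_mul_le_mul_left this hps]
      exact this (Set.mem_Ici.2 le_rfl) (Set.mem_Ici.2 (by linarith)) (by linarith)
  simp only [hg] at key
  rw [sub_self, mul_zero, Real.exp_zero, mul_one] at key
  have h3 : Real.exp (e * (s - u - s)) = (Real.exp (e * u))⁻¹ := by
    rw [← Real.exp_neg]; congr 1; ring
  rw [h3] at key
  have hp := Real.exp_pos (e * u)
  rwa [← div_eq_mul_inv, div_le_iff₀ hp] at key

/-- If `F' = -s P`, `F → 0`, and `D s > P s / 2`, then `F s ≤ (2 s + 4) P s`. -/
theorem LogC.F_upper (h : LogC P D) {F : ℝ → ℝ} (hF : ∀ s, HasDerivAt F (-(s * P s)) s)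
    (hF0 : Tendsto F atTop (𝓝 0)) {s : ℝ} (hs : 0 ≤ s) (hD : P s / 2 ≤ D s) :
    F s ≤ (2 * s + 4) * P s := by
  set Z : ℝ → ℝ := fun v => P s * ((2 * v + 4) * Real.exp (-(v - s) / 2)) with hZ
  have hZd : ∀ v, HasDerivAt Z (-(v * (P s * Real.exp (-(v - s) / 2)))) v := by
    intro v
    have h1 : HasDerivAt (fun v => -(v - s) / 2) (-1 / 2) v := by
      simpa using (((hasDerivAt_id v).sub_const s).neg).div_const 2
    have h2 : HasDerivAt (fun v : ℝ => 2 * v + 4) 2 v := by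
      simpa using ((hasDerivAt_id v).const_mul 2).add_const 4
    convert! (h2.mul h1.exp).const_mul (P s) using 1; ring
  have hZ0 : Tendsto Z atTop (𝓝 0) := by
    have h1 := tendsto_rpow_mul_exp_neg_mul_atTop_nhds_zero 1 (1 / 2) (by norm_num)
    have h2 := tendsto_rpow_mul_exp_neg_mul_atTop_nhds_zero 0 (1 / 2) (by norm_num)
    have h3 := ((h1.const_mul 2).add (h2.const_mul 4)).const_mul (P s * Real.exp (s / 2))
    simp only [mul_zero, add_zero] at h3
    refine h3.congr fun v => ?_
    simp only [hZ, Real.rpow_one, Real.rpow_zero]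
    have : Real.exp (-(v - s) / 2) = Real.exp (s / 2) * Real.exp (-(1 / 2) * v) := by
      rw [← Real.exp_add]; congr 1; ring
    rw [this]; ring
  have hm : MonotoneOn (fun v => F v - Z v) (Set.Ici s) := by
    refine monotoneOn_of_deriv_nonneg (convex_Ici s)
      (fun y _ => ((hF y).sub (hZd y)).continuousAt.continuousWithinAt)
      (fun y _ => ((hF y).sub (hZd y)).differentiableAt.differentiableWithinAt) fun v hv => ?_
    rw [((hF v).fun_sub (hZd v)).deriv]
    have hv' : s ≤ v := Set.mem_Ici.1 (interior_subset hv)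
    have ht := h.tangent s (s - v)
    rw [sub_sub_cancel] at ht
    have : Real.exp (D s / P s * (s - v)) ≤ Real.exp (-(v - s) / 2) := by
      apply Real.exp_le_exp.2
      have : 1 / 2 ≤ D s / P s := by rw [le_div_iff₀ (h.pos s)]; linarith
      nlinarith
    have h2 : P v ≤ P s * Real.exp (-(v - s) / 2) :=
      ht.trans (mul_le_mul_of_nonneg_left this (h.pos s).le)
    nlinarith [hs.trans hv']
  have hlim : Tendsto (fun v => F v - Z v) atTop (𝓝 0) := by simpa using hF0.sub hZ0
  have := ge_of_tendsto hlim (b := F s - Z s) (by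
    filter_upwards [eventually_ge_atTop s] with v hv
    exact hm (Set.mem_Ici.2 le_rfl) (Set.mem_Ici.2 hv) hv)
  have hZs : Z s = (2 * s + 4) * P s := by simp [hZ]; ring
  linarith

/-- If `D s < ε P s`, `s ≥ 2/ε`, then `F (s/2) ≥ (s/2) ε⁻¹ e⁻¹ P (s/2)`. -/
theorem LogC.F_lower (h : LogC P D) {F : ℝ → ℝ} (hF : ∀ s, HasDerivAt F (-(s * P s)) s)
    (hF0 : ∀ s, 0 ≤ F s) {s ε : ℝ} (hε : 0 < ε) (hs : 2 / ε ≤ s) (hD : D s < ε * P s) :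
    s / 2 * (1 / ε) * (Real.exp (-1) * P (s / 2)) ≤ F (s / 2) ∧ D (s / 2) ≤ ε * P (s / 2) := by
  have hs0 : 0 < s := lt_of_lt_of_le (by positivity) hs
  have hle : ∀ v, v ≤ s → D v ≤ ε * P v := by
    intro v hv
    have h1 := h.mono hv
    have h2 : P s * D v ≤ P s * (ε * P v) := by
      nlinarith [h.pos v, h.pos s, mul_le_mul_of_nonneg_left hD.le (h.pos v).le]
    exact le_of_mul_le_mul_left h2 (h.pos s)
  refine ⟨?_, hle _ (by linarith)⟩
  set x := s / 2 with hx
  have hx0 : 0 < x := by positivity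
  set L := 1 / ε with hL
  have hL0 : 0 < L := by positivity
  have hxL : x + L ≤ s := by
    have : 2 / ε = 2 * L := by rw [hL]; ring
    rw [this] at hs; rw [hx]; linarith
  set g : ℝ → ℝ := fun v => P v * Real.exp (ε * (v - x)) with hg
  have hd : ∀ v, HasDerivAt g ((-D v + ε * P v) * Real.exp (ε * (v - x))) v := by
    intro v
    have h1 : HasDerivAt (fun v => ε * (v - x)) ε v := by
      simpa using ((hasDerivAt_id v).sub_const x).const_mul ε
    convert! (h.der v).mul h1.exp using 1; ring
  have hgm : MonotoneOn g (Set.Iic s) := by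
    refine monotoneOn_of_deriv_nonneg (convex_Iic s)
      (fun y _ => (hd y).continuousAt.continuousWithinAt)
      (fun y _ => (hd y).differentiableAt.differentiableWithinAt) fun v hv => ?_
    rw [(hd v).deriv]
    have := hle v (Set.mem_Iic.1 (interior_subset hv))
    exact mul_nonneg (by linarith) (Real.exp_pos _).le
  have hP : ∀ v ∈ Set.Icc x (x + L), Real.exp (-1) * P x ≤ P v := by
    intro v hv
    have h1 := hgm (Set.mem_Iic.2 (by linarith)) (Set.mem_Iic.2 (hv.2.trans hxL)) hv.1
    simp only [hg] at h1
    rw [sub_self, mul_zero, Real.exp_zero, mul_one] at h1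
    have h2 : Real.exp (ε * (v - x)) ≤ Real.exp 1 := by
      apply Real.exp_le_exp.2
      have : ε * (v - x) ≤ ε * L := by apply mul_le_mul_of_nonneg_left _ hε.le; linarith [hv.2]
      rwa [hL, mul_one_div_cancel hε.ne'] at this
    have h3 : P x ≤ P v * Real.exp 1 := h1.trans (mul_le_mul_of_nonneg_left h2 (h.pos v).le)
    calc Real.exp (-1) * P x ≤ Real.exp (-1) * (P v * Real.exp 1) := by gcongr
      _ = P v * (Real.exp (-1) * Real.exp 1) := by ring
      _ = P v := by rw [← Real.exp_add]; simp
  have hH : AntitoneOn (fun v => F v + (x * (Real.exp (-1) * P x)) * v) (Set.Icc x (x + L)) := by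
    have hd2 : ∀ v, HasDerivAt (fun v => F v + (x * (Real.exp (-1) * P x)) * v)
        (-(v * P v) + (x * (Real.exp (-1) * P x))) v := by
      intro v
      have := (hF v).fun_add ((hasDerivAt_id v).const_mul (x * (Real.exp (-1) * P x)))
      simpa using this
    refine antitoneOn_of_deriv_nonpos (convex_Icc _ _)
      (fun y _ => (hd2 y).continuousAt.continuousWithinAt)
      (fun y _ => (hd2 y).differentiableAt.differentiableWithinAt) fun v hv => ?_
    rw [(hd2 v).deriv]
    have hv' := interior_subset hv
    have := hP v hv'
    have h5 : 0 ≤ Real.exp (-1) * P x := mul_nonneg (Real.exp_pos _).le (h.pos x).le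
    nlinarith [hv'.1]
  have := hH (Set.left_mem_Icc.2 (by linarith)) (Set.right_mem_Icc.2 (by linarith)) (by linarith)
  simp only at this
  have := hF0 (x + L)
  nlinarith

end Cheeger

namespace Cheeger

variable {κ : Type*} [Fintype κ] [DecidableEq κ]

def phi (t : Finset κ) (c q : κ → ℝ) (x : ℝ) : ℝ := ∏ i ∈ t, Lf (c i) x * Ef (c i) (q i) x

structure Good (c q : κ → ℝ) (i1 i2 i3 : κ) : Prop where
  hc : ∀ i, Real.pi ≤ c i
  hq : ∀ i, 0 ≤ q i
  h12 : i1 ≠ i2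
  h13 : i1 ≠ i3
  h23 : i2 ≠ i3
  c1 : c i1 = Real.pi
  c2 : c i2 = 2 * Real.pi

def om (c q : κ → ℝ) (i1 i2 : κ) (x : ℝ) : ℝ :=
  phi ((univ.erase i1).erase i2) c q x * Ef (c i1) (q i1) x * Ef (c i2) (q i2) x

variable {c q : κ → ℝ} {i1 i2 i3 : κ}

theorem Good.cpos (h : Good c q i1 i2 i3) (i : κ) : 0 < c i := Real.pi_pos.trans_le (h.hc i)

theorem Good.phi_eq (h : Good c q i1 i2 i3) (x : ℝ) :
    phi univ c q x = om c q i1 i2 x * Lf (2 * Real.pi) x * Lf Real.pi x := by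
  unfold om phi
  rw [← Finset.mul_prod_erase univ _ (Finset.mem_univ i1),
    ← Finset.mul_prod_erase (univ.erase i1) _ (Finset.mem_erase.2 ⟨h.h12.symm, Finset.mem_univ i2⟩),
    h.c1, h.c2]
  ring

theorem phi_pos (hc : ∀ i, 0 < c i) (t : Finset κ) (x : ℝ) : 0 < phi t c q x :=
  Finset.prod_pos fun i _ => mul_pos (Lf_pos (hc i) x) (Ef_pos _ _ _)

theorem continuous_phi (hc : ∀ i, 0 < c i) (t : Finset κ) : Continuous (phi t c q) := by
  unfold phi
  exact continuous_finsetProd _ fun i _ => (continuous_Lf (hc i)).mul (continuous_Ef (hc i) _)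

theorem phi_le (hc : ∀ i, 0 < c i) (hq : ∀ i, 0 ≤ q i) {t : Finset κ} {i : κ} (hi : i ∈ t) (x : ℝ) :
    phi t c q x ≤ Lf (c i) x := by
  unfold phi
  rw [← Finset.mul_prod_erase t _ hi]
  have h1 : ∏ i ∈ t.erase i, Lf (c i) x * Ef (c i) (q i) x ≤ 1 :=
    Finset.prod_le_one (fun j _ => (mul_pos (Lf_pos (hc j) x) (Ef_pos _ _ _)).le)
      fun j _ => mul_le_one₀ (Lf_le (hc j) x) (Ef_pos _ _ _).le (Ef_le (hq j) x)
  have h0 : 0 ≤ ∏ i ∈ t.erase i, Lf (c i) x * Ef (c i) (q i) x :=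
    Finset.prod_nonneg fun j _ => (mul_pos (Lf_pos (hc j) x) (Ef_pos _ _ _)).le
  have h2 := Ef_le (c := c i) (hq i) x
  have h3 := Ef_pos (c i) (q i) x
  have h4 := Lf_pos (hc i) x
  calc _ ≤ (Lf (c i) x * 1) * 1 := by gcongr
    _ = _ := by ring

theorem integrable_Lf {c : ℝ} (hc : 0 < c) : Integrable (Lf c) := by
  have h := (integrable_inv_one_add_sq.comp_mul_left' (R := c⁻¹) (by positivity))
  refine h.congr (Eventually.of_forall fun x => ?_)
  unfold Lf; field_simp

theorem integrable_phi (hc : ∀ i, 0 < c i) (hq : ∀ i, 0 ≤ q i) {t : Finset κ} {i : κ} (hi : i ∈ t) :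
    Integrable (phi t c q) := by
  refine (integrable_Lf (hc i)).mono' (continuous_phi hc t).aestronglyMeasurable
    (Eventually.of_forall fun x => ?_)
  rw [Real.norm_of_nonneg (phi_pos hc t x).le]
  exact phi_le hc hq hi x

theorem integrable_mul_E {A : ℝ → ℝ} (hA : Integrable A) {c q : ℝ} (hc : 0 < c) (hq : 0 ≤ q) :
    Integrable (fun x => A x * Ef c q x) :=
  hA.mul_bdd (c := 1) (continuous_Ef hc q).aestronglyMeasurable
    (Eventually.of_forall fun x => by
      rw [Real.norm_of_nonneg (Ef_pos c q x).le]; exact Ef_le hq x)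

theorem Good.int_phit (h : Good c q i1 i2 i3) : Integrable (phi ((univ.erase i1).erase i2) c q) :=
  integrable_phi h.cpos h.hq (i := i3)
    (by simp only [Finset.mem_erase, Finset.mem_univ, and_true]; exact ⟨h.h23.symm, h.h13.symm⟩)

theorem Good.int_om (h : Good c q i1 i2 i3) : Integrable (om c q i1 i2) :=
  integrable_mul_E (integrable_mul_E h.int_phit (h.cpos _) (h.hq _)) (h.cpos _) (h.hq _)

theorem RP_phi_nonneg (hc : ∀ i, 0 < c i) (hq : ∀ i, 0 ≤ q i) {t : Finset κ}
    (hinteg : Integrable (phi t c q)) : (∀ s, 0 ≤ RP (phi t c q) s) ∧ LC (RP (phi t c q)) := by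
  have h := LCC.prod t hc hq hinteg
  have e : ∀ s, RP (phi t c q) s = (Ps (fun x => ((phi t c q x : ℝ) : ℂ)) s).re := fun s => RP_eq hinteg s
  refine ⟨fun s => ?_, ?_⟩
  · rw [e]; exact h.nn s
  · have : RP (phi t c q) = fun s => (Ps (fun x => ((phi t c q x : ℝ) : ℂ)) s).re := funext e
    rw [this]; exact h.lc

theorem Good.RP_om (h : Good c q i1 i2 i3) (s : ℝ) : 0 ≤ RP (om c q i1 i2) s := by
  have h1 := RP_E_nonneg h.int_phit (RP_phi_nonneg h.cpos h.hq h.int_phit).1 (h.cpos i1) (h.hq i1)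
  exact RP_E_nonneg (integrable_mul_E h.int_phit (h.cpos _) (h.hq _)) h1 (h.cpos i2) (h.hq i2) s

theorem Good.int_phi (h : Good c q i1 i2 i3) : Integrable (phi univ c q) :=
  integrable_phi h.cpos h.hq (Finset.mem_univ i1)

/-- the intermediate density `om * L_{2π}` -/
def ph2 (c q : κ → ℝ) (i1 i2 : κ) (x : ℝ) : ℝ := om c q i1 i2 x * Lf (2 * Real.pi) x

theorem Good.int_ph2 (h : Good c q i1 i2 i3) : Integrable (ph2 c q i1 i2) :=
  integrable_mul_L h.int_om (by positivity)

theorem Good.phi_fun (h : Good c q i1 i2 i3) :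
    phi univ c q = fun x => ph2 c q i1 i2 x * Lf Real.pi x := by
  ext x; rw [h.phi_eq]; rfl

theorem Good.RP_ph2 (h : Good c q i1 i2 i3) (s : ℝ) : 0 ≤ RP (ph2 c q i1 i2) s :=
  RP_L_nonneg h.int_om h.RP_om (by positivity) s

theorem Good.shift (h : Good c q i1 i2 i3) (s v : ℝ) :
    RP (phi univ c q) (s + v) ≤ Real.exp (Real.pi * |v|) * RP (phi univ c q) s := by
  rw [h.phi_fun]; exact RP_L_shift h.int_ph2 h.RP_ph2 Real.pi_pos s v

theorem Good.shift' (h : Good c q i1 i2 i3) (s u : ℝ) :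
    Real.exp (-Real.pi * |u|) * RP (phi univ c q) s ≤ RP (phi univ c q) (s - u) := by
  have := h.shift (s - u) u
  rw [sub_add_cancel] at this
  calc _ ≤ Real.exp (-Real.pi * |u|) * (Real.exp (Real.pi * |u|) * RP (phi univ c q) (s - u)) := by gcongr
    _ = _ := by rw [← mul_assoc, ← Real.exp_add]; simp

theorem Good.Q_le (h : Good c q i1 i2 i3) (s : ℝ) :
    RP (ph2 c q i1 i2) s ≤ 3 * RP (phi univ c q) s := by
  have := RP_L_lower h.int_ph2 Real.pi_pos (d := 2 * Real.pi) (by positivity) s (by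
    intro u
    have := RP_L_shift h.int_om h.RP_om (c := 2 * Real.pi) (by positivity) (s - u) u
    rw [sub_add_cancel] at this
    calc Real.exp (-(2 * Real.pi) * |u|) * RP (ph2 c q i1 i2) s ≤ Real.exp (-(2 * Real.pi) * |u|) *
          (Real.exp (2 * Real.pi * |u|) * RP (ph2 c q i1 i2) (s - u)) := by gcongr; exact this
      _ = _ := by rw [← mul_assoc, ← Real.exp_add]; simp)
  rw [← h.phi_fun] at this
  have e : Real.pi / (Real.pi + 2 * Real.pi) = 1 / 3 := by
    have := Real.pi_pos.ne'
    field_simp; norm_num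
  rw [e] at this; linarith

theorem sq_mul_Lf {c : ℝ} (hc : 0 < c) (x : ℝ) : x ^ 2 * Lf c x = c ^ 2 * (1 - Lf c x) := by
  unfold Lf; have : c ^ 2 + x ^ 2 ≠ 0 := by positivity
  field_simp; ring

theorem Good.sq_phi (h : Good c q i1 i2 i3) (x : ℝ) :
    x ^ 2 * phi univ c q x = Real.pi ^ 2 * (ph2 c q i1 i2 x - phi univ c q x) := by
  rw [h.phi_fun]
  have := sq_mul_Lf Real.pi_pos x
  linear_combination (ph2 c q i1 i2 x) * this

theorem Good.int_sq (h : Good c q i1 i2 i3) : Integrable (fun x => x ^ 2 * phi univ c q x) := by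
  simp_rw [h.sq_phi]; exact (h.int_ph2.sub h.int_phi).const_mul _

theorem Good.int_x (h : Good c q i1 i2 i3) : Integrable (fun x => x * phi univ c q x) := by
  refine (h.int_phi.add h.int_sq).mono'
    ((continuous_id.mul (continuous_phi h.cpos univ)).aestronglyMeasurable)
    (Eventually.of_forall fun x => ?_)
  have h0 := phi_pos (q := q) h.cpos univ x
  rw [norm_mul, Real.norm_eq_abs, Real.norm_of_nonneg h0.le]
  simp only [Pi.add_apply]
  have : |x| ≤ 1 + x ^ 2 := by nlinarith [sq_nonneg (|x| - 1), sq_abs x, abs_nonneg x]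
  nlinarith

theorem Good.P0_pos (h : Good c q i1 i2 i3) : 0 < RP (phi univ c q) 0 := by
  unfold RP
  simp only [mul_zero, Real.cos_zero, mul_one]
  rw [integral_pos_iff_support_of_nonneg (fun x => (phi_pos h.cpos univ x).le) h.int_phi]
  have : Function.support (phi univ c q) = Set.univ := by
    ext x; simp [(phi_pos (q := q) h.cpos univ x).ne']
  rw [this]; simp

theorem Good.P_lower (h : Good c q i1 i2 i3) (s : ℝ) :
    Real.exp (-Real.pi * |s|) * RP (phi univ c q) 0 ≤ RP (phi univ c q) s := by
  have := h.shift' 0 (-s); simpa using this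

theorem Good.logC (h : Good c q i1 i2 i3) : LogC (RP (phi univ c q)) (RS (phi univ c q)) := by
  refine ⟨fun s => lt_of_lt_of_le (mul_pos (Real.exp_pos _) h.P0_pos) (h.P_lower s),
    hasDerivAt_RP h.int_phi h.int_x, RP_neg _, (RP_phi_nonneg h.cpos h.hq h.int_phi).2⟩

/-! convolution bounds -/

theorem Good.L_lower (h : Good c q i1 i2 i3) {d : ℝ} (hd : Real.pi ≤ d) (s : ℝ) :
    1 / 2 * RP (phi univ c q) s ≤ RP (fun x => phi univ c q x * Lf d x) s := by
  have h1 := RP_L_lower h.int_phi (c := d) (d := Real.pi) (Real.pi_pos.trans_le hd) Real.pi_pos.le s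
    (h.shift' s)
  refine le_trans ?_ h1
  refine mul_le_mul_of_nonneg_right ?_ (h.logC.pos s).le
  have := Real.pi_pos
  rw [div_le_div_iff₀ (by positivity) (by linarith)]; linarith

theorem Good.LL_lower (h : Good c q i1 i2 i3) {d : ℝ} (hd : Real.pi ≤ d) (s : ℝ) :
    1 / 4 * RP (phi univ c q) s ≤ RP (fun x => phi univ c q x * Lf d x * Lf d x) s := by
  have hdp := Real.pi_pos.trans_le hd
  have hpos : ∀ s, 0 ≤ RP (phi univ c q) s := fun s => (h.logC.pos s).le
  have e1 : (fun x => phi univ c q x * Lf d x) = fun x => (ph2 c q i1 i2 x * Lf d x) * Lf Real.pi x := by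
    rw [h.phi_fun]; ext x; ring
  have h0 : ∀ u, Real.exp (-Real.pi * |u|) * RP (fun x => phi univ c q x * Lf d x) s ≤
      RP (fun x => phi univ c q x * Lf d x) (s - u) := by
    intro u
    have := RP_L_shift (integrable_mul_L h.int_ph2 hdp) (RP_L_nonneg h.int_ph2 h.RP_ph2 hdp)
      Real.pi_pos (s - u) u
    rw [sub_add_cancel, ← e1] at this
    calc _ ≤ Real.exp (-Real.pi * |u|) * (Real.exp (Real.pi * |u|) *
          RP (fun x => phi univ c q x * Lf d x) (s - u)) := by gcongr
      _ = _ := by rw [← mul_assoc, ← Real.exp_add]; simp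
  have h1 := RP_L_lower (integrable_mul_L h.int_phi hdp) (c := d) (d := Real.pi) hdp Real.pi_pos.le s h0
  refine le_trans ?_ h1
  have h2 := h.L_lower hd s
  have : 1 / 2 ≤ d / (d + Real.pi) := by
    have := Real.pi_pos
    rw [div_le_div_iff₀ (by positivity) (by linarith)]; linarith
  nlinarith [hpos s]

theorem ratio_le {d γ B : ℝ} (hB : 1 < B) (hd : 0 < d) (h : B * γ ^ 2 ≤ (B - 1) * d ^ 2) (hg : γ ^ 2 < d ^ 2) :
    d ^ 2 / (d ^ 2 - γ ^ 2) ≤ B := by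
  rw [div_le_iff₀ (by linarith)]; nlinarith

theorem Good.L_upper (h : Good c q i1 i2 i3) {d e : ℝ} (he : |e| < d) (s : ℝ)
    (hD : RS (phi univ c q) s = e * RP (phi univ c q) s) (u : ℝ) :
    RP (fun x => phi univ c q x * Lf d x) (s - u) ≤
      d ^ 2 / (d ^ 2 - e ^ 2) * (RP (phi univ c q) s * Real.exp (e * u)) := by
  have hp := h.logC.pos s
  have he' : RS (phi univ c q) s / RP (phi univ c q) s = e := by rw [hD]; field_simp
  have := RP_L_upper h.int_phi he s (B := RP (phi univ c q) s) (B' := 0) (by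
    intro u
    have := h.logC.tangent s u
    rw [he'] at this; linarith) u
  simpa using this

theorem Good.LL_upper (h : Good c q i1 i2 i3) {d e : ℝ} (he : |e| < d) (s : ℝ)
    (hD : RS (phi univ c q) s = e * RP (phi univ c q) s) :
    RP (fun x => phi univ c q x * Lf d x * Lf d x) s ≤
      (d ^ 2 / (d ^ 2 - e ^ 2)) ^ 2 * RP (phi univ c q) s := by
  have hd : 0 < d := lt_of_le_of_lt (abs_nonneg _) he
  have := RP_L_upper (integrable_mul_L h.int_phi hd) he s
    (B := d ^ 2 / (d ^ 2 - e ^ 2) * RP (phi univ c q) s) (B' := 0) (by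
    intro u
    have := h.L_upper he s hD u
    linarith) 0
  simp only [sub_zero, mul_zero, Real.exp_zero, mul_one, add_zero, zero_mul] at this
  calc _ ≤ _ := this
    _ = _ := by ring

/-- bound on the tail terms of `N` -/
theorem Good.tail_upper (h : Good c q i1 i2 i3) {d : ℝ} (hd : 2 * Real.pi ≤ d) (s : ℝ) :
    RP (phi univ c q) s - RP (fun x => phi univ c q x * Lf d x) s ≤
      8 * Real.pi ^ 2 / d ^ 2 * RP (phi univ c q) s := by
  have hpi := Real.pi_pos
  have hdp : 0 < d := by linarith
  have iL := integrable_mul_L h.int_phi hdp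
  have iQ := integrable_mul_L h.int_ph2 hdp
  have e1 : RP (phi univ c q) s - RP (fun x => phi univ c q x * Lf d x) s =
      Real.pi ^ 2 / d ^ 2 * (RP (fun x => ph2 c q i1 i2 x * Lf d x) s - RP (fun x => phi univ c q x * Lf d x) s) := by
    unfold RP
    rw [← integral_sub (integrable_RP h.int_phi s) (integrable_RP iL s),
      ← integral_sub (integrable_RP iQ s) (integrable_RP iL s), ← integral_const_mul]
    congr 1; ext x
    have a1 := sq_mul_Lf hdp x
    have a2 := h.sq_phi x
    have a3 : 1 - Lf d x = x ^ 2 * Lf d x / d ^ 2 := by rw [a1]; field_simp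
    calc phi univ c q x * Real.cos (x * s) - phi univ c q x * Lf d x * Real.cos (x * s)
        = phi univ c q x * (1 - Lf d x) * Real.cos (x * s) := by ring
      _ = (x ^ 2 * phi univ c q x) * Lf d x / d ^ 2 * Real.cos (x * s) := by rw [a3]; ring
      _ = _ := by rw [a2]; ring
  have h2 : RP (fun x => ph2 c q i1 i2 x * Lf d x) s ≤ 3 * RP (fun x => phi univ c q x * Lf d x) s := by
    rw [RP_mul_L h.int_ph2 hdp, RP_mul_L h.int_phi hdp, ← integral_const_mul]
    refine integral_mono (integrable_RP_lapk h.int_ph2 hdp s)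
      ((integrable_RP_lapk h.int_phi hdp s).const_mul 3) fun u => ?_
    have := mul_le_mul_of_nonneg_right (h.Q_le (s - u)) (lapk_nonneg hdp u)
    simp only; linarith
  have h3 : RP (fun x => phi univ c q x * Lf d x) s ≤ 4 / 3 * (2 * RP (phi univ c q) s) := by
    have := RP_L_upper h.int_phi (c := d) (γ := Real.pi) (B := RP (phi univ c q) s)
      (B' := RP (phi univ c q) s) (by rw [abs_of_pos hpi]; linarith) s (by
        intro u
        have h1 := h.shift s (-u)
        rw [← sub_eq_add_neg, abs_neg] at h1
        have hp := h.logC.pos s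
        rcases le_total 0 u with hu | hu
        · rw [abs_of_nonneg hu] at h1
          have := mul_pos hp (Real.exp_pos (-Real.pi * u))
          linarith
        · rw [abs_of_nonpos hu] at h1
          have := mul_pos hp (Real.exp_pos (Real.pi * u))
          rw [show Real.pi * -u = -Real.pi * u by ring] at h1
          linarith) 0
    simp only [sub_zero, mul_zero, Real.exp_zero, mul_one] at this
    refine this.trans ?_
    have hr := ratio_le (d := d) (γ := Real.pi) (B := 4 / 3) (by norm_num) hdp (by nlinarith) (by nlinarith)
    have hp := h.logC.pos s
    calc _ = d ^ 2 / (d ^ 2 - Real.pi ^ 2) * (2 * RP (phi univ c q) s) := by ring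
      _ ≤ _ := by gcongr
  rw [e1]
  have h4 : 0 ≤ RP (fun x => phi univ c q x * Lf d x) s :=
    RP_L_nonneg h.int_phi (fun s => (h.logC.pos s).le) hdp s
  have : RP (fun x => ph2 c q i1 i2 x * Lf d x) s - RP (fun x => phi univ c q x * Lf d x) s ≤
    8 * RP (phi univ c q) s := by linarith
  calc _ ≤ Real.pi ^ 2 / d ^ 2 * (8 * RP (phi univ c q) s) := by gcongr
    _ = _ := by ring

theorem Good.tail_upper1 (h : Good c q i1 i2 i3) {d : ℝ} (hd : 0 < d) (s : ℝ) :
    RP (phi univ c q) s - RP (fun x => phi univ c q x * Lf d x) s ≤ RP (phi univ c q) s := by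
  have h4 : 0 ≤ RP (fun x => phi univ c q x * Lf d x) s :=
    RP_L_nonneg h.int_phi (fun s => (h.logC.pos s).le) hd s
  linarith

theorem Good.tail_lower (h : Good c q i1 i2 i3) {d : ℝ} (hd : 3 ≤ d) (s : ℝ)
    (hD : |RS (phi univ c q) s| ≤ 1 / 2 * RP (phi univ c q) s) :
    -(1 / (2 * d ^ 2)) * RP (phi univ c q) s ≤
      RP (phi univ c q) s - RP (fun x => phi univ c q x * Lf d x) s := by
  have hp := h.logC.pos s
  set e := RS (phi univ c q) s / RP (phi univ c q) s with he
  have hD' : RS (phi univ c q) s = e * RP (phi univ c q) s := by rw [he]; field_simp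
  have hea : |e| ≤ 1 / 2 := by rw [he, abs_div, abs_of_pos hp, div_le_iff₀ hp]; exact hD
  have he2 : e ^ 2 ≤ 1 / 4 := by nlinarith [sq_abs e, abs_nonneg e]
  have := h.L_upper (d := d) (by linarith) s hD' 0
  simp only [sub_zero, mul_zero, Real.exp_zero, mul_one] at this
  have hr : d ^ 2 / (d ^ 2 - e ^ 2) ≤ 1 + 1 / (2 * d ^ 2) := by
    have h9 : 9 ≤ d ^ 2 := by nlinarith
    have hd2 : 0 < d ^ 2 := by linarith
    rw [div_le_iff₀ (by linarith), show 1 / (2 * d ^ 2) = (1 / 2) / d ^ 2 by field_simp]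
    have : (1 + 1 / 2 / d ^ 2) * (d ^ 2 - e ^ 2) = d ^ 2 - e ^ 2 + 1 / 2 - (e ^ 2 / 2) / d ^ 2 := by
      field_simp
      ring
    rw [this]
    have : (e ^ 2 / 2) / d ^ 2 ≤ 1 / 4 := by rw [div_le_iff₀ hd2]; nlinarith [sq_nonneg e]
    linarith
  have : d ^ 2 / (d ^ 2 - e ^ 2) * RP (phi univ c q) s ≤ (1 + 1 / (2 * d ^ 2)) * RP (phi univ c q) s := by
    gcongr
  linarith

end Cheeger

namespace Cheeger

variable {κ : Type*} [Fintype κ] [DecidableEq κ] {c q : κ → ℝ} {i1 i2 i3 : κ}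

/-- logarithmic derivative weight -/
def Kf (t : Finset κ) (c q : κ → ℝ) (x : ℝ) : ℝ :=
  ∑ i ∈ t, (2 / c i ^ 2 * Lf (c i) x + 4 * q i / c i ^ 2 * (Lf (c i) x * Lf (c i) x))

theorem hasDerivAt_LE {c : ℝ} (hc : 0 < c) (q x : ℝ) :
    HasDerivAt (fun x => Lf c x * Ef c q x)
      (-(x * (2 / c ^ 2 * Lf c x + 4 * q / c ^ 2 * (Lf c x * Lf c x))) * (Lf c x * Ef c q x)) x := by
  have hp : c ^ 2 + x ^ 2 ≠ 0 := by positivity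
  have h0 : HasDerivAt (fun x : ℝ => c ^ 2 + x ^ 2) (2 * x) x := by
    have := (hasDerivAt_pow 2 x).const_add (c ^ 2)
    simpa using this
  have h1 : HasDerivAt (fun x => Lf c x) (-(c ^ 2 * (2 * x)) / (c ^ 2 + x ^ 2) ^ 2) x := by
    unfold Lf
    have := (hasDerivAt_const x (c ^ 2)).fun_div h0 hp
    simpa using this
  have h2 : HasDerivAt (fun x => Ef c q x) (Ef c q x *
      ((-(2 * q * (2 * x)) * (c ^ 2 + x ^ 2) - (-(2 * q * x ^ 2)) * (2 * x)) / (c ^ 2 + x ^ 2) ^ 2)) x := by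
    unfold Ef
    have h3 : HasDerivAt (fun x : ℝ => -(2 * q * x ^ 2)) (-(2 * q * (2 * x))) x := by
      have := ((hasDerivAt_pow 2 x).const_mul (2 * q)).fun_neg
      simpa using this
    exact (h3.fun_div h0 hp).exp
  convert! h1.fun_mul h2 using 1
  unfold Lf
  field_simp
  ring

theorem hasDerivAt_phi (hc : ∀ i, 0 < c i) (t : Finset κ) (x : ℝ) :
    HasDerivAt (phi t c q) (-(x * Kf t c q x) * phi t c q x) x := by
  induction t using Finset.induction_on with
  | empty =>
    have : phi (∅ : Finset κ) c q = fun _ => 1 := by ext; simp [phi]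
    rw [this]; simpa [Kf] using hasDerivAt_const x (1 : ℝ)
  | insert i t hi ih =>
    have e : phi (insert i t) c q = fun x => (Lf (c i) x * Ef (c i) (q i) x) * phi t c q x := by
      ext y; simp [phi, Finset.prod_insert hi]
    have e2 : Kf (insert i t) c q x = (2 / c i ^ 2 * Lf (c i) x + 4 * q i / c i ^ 2 * (Lf (c i) x * Lf (c i) x))
      + Kf t c q x := by simp [Kf, Finset.sum_insert hi]
    rw [e2, e]
    convert! (hasDerivAt_LE (hc i) (q i) x).fun_mul ih using 1
    ring

theorem continuous_Kf (hc : ∀ i, 0 < c i) (t : Finset κ) : Continuous (Kf t c q) := by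
  unfold Kf
  refine continuous_finsetSum _ fun i _ => ?_
  have := continuous_Lf (hc i)
  fun_prop

theorem Kf_bd (hc : ∀ i, 0 < c i) (hq : ∀ i, 0 ≤ q i) (t : Finset κ) (x : ℝ) :
    0 ≤ Kf t c q x ∧ Kf t c q x ≤ ∑ i ∈ t, (2 / c i ^ 2 + 4 * q i / c i ^ 2) := by
  have h0 := fun i => Lf_pos (hc i) x
  have h1 := fun i => Lf_le (hc i) x
  constructor
  · exact Finset.sum_nonneg fun i _ => by have := hc i; have := hq i; have := h0 i; positivity
  · refine Finset.sum_le_sum fun i _ => ?_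
    have a1 := hc i; have a2 := hq i; have a3 := h0 i; have a4 := h1 i
    have a5 : 0 ≤ 2 / c i ^ 2 := by positivity
    have a6 : 0 ≤ 4 * q i / c i ^ 2 := by positivity
    have a7 : Lf (c i) x * Lf (c i) x ≤ 1 := by nlinarith
    have := mul_le_mul_of_nonneg_left a4 a5
    have := mul_le_mul_of_nonneg_left a7 a6
    linarith

theorem mul_Kf_int {A : ℝ → ℝ} (hA : Integrable A) (hc : ∀ i, 0 < c i) (hq : ∀ i, 0 ≤ q i) (t : Finset κ) :
    Integrable (fun x => A x * Kf t c q x) :=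
  hA.mul_bdd (continuous_Kf hc t).aestronglyMeasurable
    (Eventually.of_forall fun x => by
      rw [Real.norm_of_nonneg (Kf_bd hc hq t x).1]; exact (Kf_bd hc hq t x).2)

/-- the auxiliary function `F` -/
def Ff (c q : κ → ℝ) : ℝ → ℝ := RP (fun x => phi univ c q x * Kf univ c q x)

theorem Good.RS_K (h : Good c q i1 i2 i3) (s : ℝ) :
    RS (fun x => phi univ c q x * Kf univ c q x) s = s * RP (phi univ c q) s := by
  have hinteg := h.int_phi
  have hxK := mul_Kf_int h.int_x h.cpos h.hq univ
  have hb : ∀ x : ℝ, ‖Real.sin (x * s)‖ ≤ 1 := fun x => Real.abs_sin_le_one _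
  have key := integral_mul_deriv_eq_deriv_mul_of_integrable
    (u := phi univ c q) (u' := fun x => -(x * Kf univ c q x) * phi univ c q x)
    (v := fun x => Real.sin (x * s)) (v' := fun x => Real.cos (x * s) * s)
    (fun x _ => hasDerivAt_phi h.cpos univ x)
    (fun x _ => by
      have := ((hasDerivAt_id x).mul_const s).sin
      simpa using this)
    (by
      have := (integrable_RP hinteg s).mul_const s
      refine this.congr (Eventually.of_forall fun x => ?_)
      simp only [Pi.mul_apply]; ring)
    (by
      have := (hxK.mul_bdd (c := 1) (g := fun x => Real.sin (x * s)) (by fun_prop) (Eventually.of_forall hb)).neg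
      refine this.congr (Eventually.of_forall fun x => ?_)
      simp only [Pi.mul_apply, Pi.neg_apply]; ring)
    (by
      exact hinteg.mul_bdd (c := 1) (by fun_prop) (Eventually.of_forall hb))
  unfold RS RP
  rw [← integral_const_mul]
  rw [← neg_inj, ← integral_neg, ← integral_neg]
  rw [← neg_inj, ← integral_neg] at key
  rw [integral_neg] at key
  rw [← integral_neg] at key
  rw [neg_neg] at key
  refine Eq.trans ?_ (key.symm.trans ?_)
  · congr 1; ext x; ring
  · congr 1; ext x; ring

theorem tendsto_RP {A : ℝ → ℝ} (hA : Integrable A) : Tendsto (RP A) atTop (𝓝 0) := by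
  have h := Real.tendsto_integral_exp_smul_cocompact (fun x => (A x : ℂ))
  have h2 : Tendsto (fun s : ℝ => s * (2 * Real.pi)⁻¹) atTop (cocompact ℝ) :=
    (tendsto_id.atTop_mul_const (by positivity)).mono_right atTop_le_cocompact
  have h3 := (Complex.continuous_re.tendsto 0).comp (h.comp h2)
  refine h3.congr fun s => ?_
  simp only [Function.comp]
  rw [← RP_neg, RP_eq hA]
  unfold Ps
  congr 2; ext x
  rw [Circle.smul_def, Real.fourierChar_apply, smul_eq_mul, mul_comm]
  congr 2
  push_cast
  have : (Real.pi : ℂ) ≠ 0 := by exact_mod_cast Real.pi_ne_zero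
  field_simp

theorem Good.F_der (h : Good c q i1 i2 i3) (s : ℝ) :
    HasDerivAt (Ff c q) (-(s * RP (phi univ c q) s)) s := by
  rw [← h.RS_K]
  refine hasDerivAt_RP (mul_Kf_int h.int_phi h.cpos h.hq univ) ?_ s
  refine (mul_Kf_int h.int_x h.cpos h.hq univ).congr (Eventually.of_forall fun x => ?_)
  ring

theorem Good.F_lim (h : Good c q i1 i2 i3) : Tendsto (Ff c q) atTop (𝓝 0) :=
  tendsto_RP (mul_Kf_int h.int_phi h.cpos h.hq univ)

theorem Good.F_eq (h : Good c q i1 i2 i3) (s : ℝ) : Ff c q s =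
    ∑ i, (2 / c i ^ 2 * RP (fun x => phi univ c q x * Lf (c i) x) s +
      4 * q i / c i ^ 2 * RP (fun x => phi univ c q x * Lf (c i) x * Lf (c i) x) s) := by
  have i1 := fun i => integrable_mul_L h.int_phi (h.cpos i)
  have i2 := fun i => integrable_mul_L (i1 i) (h.cpos i)
  unfold Ff RP
  simp_rw [← integral_const_mul]
  have : ∀ i, (∫ x, 2 / c i ^ 2 * (phi univ c q x * Lf (c i) x * Real.cos (x * s))) +
      ∫ x, 4 * q i / c i ^ 2 * (phi univ c q x * Lf (c i) x * Lf (c i) x * Real.cos (x * s)) =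
      ∫ x, (2 / c i ^ 2 * (phi univ c q x * Lf (c i) x * Real.cos (x * s)) +
       4 * q i / c i ^ 2 * (phi univ c q x * Lf (c i) x * Lf (c i) x * Real.cos (x * s))) := fun i =>
    (integral_add ((integrable_RP (i1 i) s).const_mul _) ((integrable_RP (i2 i) s).const_mul _)).symm
  simp_rw [this]
  refine Eq.trans ?_ (integral_finsetSum univ (f := fun i x =>
    (2 / c i ^ 2 * (phi univ c q x * Lf (c i) x * Real.cos (x * s)) +
       4 * q i / c i ^ 2 * (phi univ c q x * Lf (c i) x * Lf (c i) x * Real.cos (x * s)))) fun i _ =>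
    ((integrable_RP (i1 i) s).const_mul _).add ((integrable_RP (i2 i) s).const_mul _))
  congr 1; ext x
  unfold Kf
  rw [Finset.mul_sum, Finset.sum_mul]
  refine Finset.sum_congr rfl fun i _ => ?_
  ring

def SS1 (c : κ → ℝ) : ℝ := ∑ i, 1 / c i ^ 2
def SSQ (c q : κ → ℝ) : ℝ := ∑ i, q i / c i ^ 2

theorem Good.F_lower_bd (h : Good c q i1 i2 i3) (s : ℝ) :
    SSQ c q * RP (phi univ c q) s ≤ Ff c q s := by
  rw [h.F_eq, SSQ, Finset.sum_mul]
  refine Finset.sum_le_sum fun i _ => ?_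
  have h1 := h.L_lower (h.hc i) s
  have h2 := h.LL_lower (h.hc i) s
  have hp := h.logC.pos s
  have a0 := h.cpos i
  have a1 : 0 ≤ q i / c i ^ 2 := div_nonneg (h.hq i) (by positivity)
  have a2 : 0 ≤ 2 / c i ^ 2 := by positivity
  have e : 4 * q i / c i ^ 2 = 4 * (q i / c i ^ 2) := by ring
  rw [e]
  have := mul_nonneg a2 ((by positivity : 0 ≤ 1 / 2 * RP (phi univ c q) s).trans h1)
  nlinarith

theorem Good.F_nonneg (h : Good c q i1 i2 i3) (s : ℝ) : 0 ≤ Ff c q s :=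
  (mul_nonneg (Finset.sum_nonneg fun i _ => div_nonneg (h.hq i) (by have := h.cpos i; positivity))
    (h.logC.pos s).le).trans (h.F_lower_bd s)

theorem Good.F_upper_bd (h : Good c q i1 i2 i3) (s : ℝ)
    (hD : |RS (phi univ c q) s| ≤ RP (phi univ c q) s) :
    Ff c q s ≤ (4 * SS1 c + 16 * SSQ c q) * RP (phi univ c q) s := by
  have hp := h.logC.pos s
  set e := RS (phi univ c q) s / RP (phi univ c q) s with he
  have hD' : RS (phi univ c q) s = e * RP (phi univ c q) s := by rw [he]; field_simp
  have hea : |e| ≤ 1 := by rw [he, abs_div, abs_of_pos hp, div_le_iff₀ hp]; linarith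
  have he2 : e ^ 2 ≤ 1 := by nlinarith [sq_abs e, abs_nonneg e]
  rw [h.F_eq, SSQ, SS1, Finset.mul_sum, Finset.mul_sum, ← Finset.sum_add_distrib, Finset.sum_mul]
  refine Finset.sum_le_sum fun i _ => ?_
  have hci : 3 < c i := Real.pi_gt_three.trans_le (h.hc i)
  have h1 := h.L_upper (d := c i) (e := e) (by linarith) s hD' 0
  have h2 := h.LL_upper (d := c i) (e := e) (by linarith) s hD'
  simp only [sub_zero, mul_zero, Real.exp_zero, mul_one] at h1
  have hr := ratio_le (d := c i) (γ := e) (B := 2) (by norm_num) (by linarith) (by nlinarith) (by nlinarith)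
  have hr0 : 0 ≤ c i ^ 2 / (c i ^ 2 - e ^ 2) := div_nonneg (by positivity) (by nlinarith)
  have h1' : RP (fun x => phi univ c q x * Lf (c i) x) s ≤ 2 * RP (phi univ c q) s := by
    refine h1.trans ?_; gcongr
  have h2' : RP (fun x => phi univ c q x * Lf (c i) x * Lf (c i) x) s ≤ 4 * RP (phi univ c q) s := by
    refine h2.trans ?_
    have : (c i ^ 2 / (c i ^ 2 - e ^ 2)) ^ 2 ≤ 4 := by nlinarith
    gcongr
  have a0 := h.cpos i
  have a1 : 0 ≤ 4 * q i / c i ^ 2 := div_nonneg (by linarith [h.hq i]) (by positivity)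
  have a2 : 0 ≤ 2 / c i ^ 2 := by positivity
  have b1 := mul_le_mul_of_nonneg_left h1' a2
  have b2 := mul_le_mul_of_nonneg_left h2' a1
  calc _ ≤ _ := add_le_add b1 b2
    _ = _ := by ring

theorem Good.RS_sign (h : Good c q i1 i2 i3) (s : ℝ) : 0 ≤ s * RS (phi univ c q) s := by
  rcases le_total 0 s with hs | hs
  · exact mul_nonneg hs (h.logC.D_nonneg hs)
  · have := h.logC.D_nonneg (s := -s) (by linarith)
    have h2 := h.logC.odd s
    rw [h2] at this
    nlinarith

/-- small drift region -/
theorem Good.P1 (h : Good c q i1 i2 i3) (s : ℝ) (hs : 2 * |s| + 4 < SSQ c q) :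
    |RS (phi univ c q) s| ≤ 1 / 2 * RP (phi univ c q) s := by
  have main : ∀ s, 0 ≤ s → 2 * s + 4 < SSQ c q → |RS (phi univ c q) s| ≤ 1 / 2 * RP (phi univ c q) s := by
    intro s hs0 hs
    have hp := h.logC.pos s
    rw [abs_of_nonneg (h.logC.D_nonneg hs0)]
    by_contra hcon
    have h1 := h.logC.F_upper h.F_der h.F_lim hs0 (by linarith)
    have h2 := h.F_lower_bd s
    nlinarith
  rcases le_total 0 s with h0 | h0
  · rw [abs_of_nonneg h0] at hs; exact main s h0 hs
  · rw [abs_of_nonpos h0] at hs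
    have := main (-s) (by linarith) hs
    rwa [h.logC.odd, h.logC.even, abs_neg] at this

/-- large drift region -/
theorem Good.P2 (h : Good c q i1 i2 i3) {ε : ℝ} (hε : 0 < ε) (hε1 : ε ≤ 1) (s : ℝ) (hs : 2 / ε ≤ |s|)
    (hbig : 4 * SS1 c + 16 * SSQ c q < |s| / 2 * (1 / ε) * Real.exp (-1)) :
    ε * |s| * RP (phi univ c q) s ≤ s * RS (phi univ c q) s := by
  have main : ∀ s, 0 ≤ s → 2 / ε ≤ s → 4 * SS1 c + 16 * SSQ c q < s / 2 * (1 / ε) * Real.exp (-1) →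
      ε * RP (phi univ c q) s ≤ RS (phi univ c q) s := by
    intro s hs0 hs hb
    by_contra hcon
    obtain ⟨h1, h2⟩ := h.logC.F_lower h.F_der h.F_nonneg hε hs (by linarith)
    have hp := h.logC.pos (s / 2)
    have h3 := h.F_upper_bd (s / 2) (by
      rw [abs_of_nonneg (h.logC.D_nonneg (by linarith))]; nlinarith)
    nlinarith
  rcases le_total 0 s with h0 | h0
  · rw [abs_of_nonneg h0] at hs hbig ⊢
    have := main s h0 hs hbig
    nlinarith
  · rw [abs_of_nonpos h0] at hs hbig ⊢
    have := main (-s) (by linarith) hs hbig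
    rw [h.logC.odd, h.logC.even] at this
    nlinarith

end Cheeger

namespace Cheeger

def cM (b : ℝ) (m : ℕ) : ℝ := Real.pi * (m + 1) / b
def shM (n : ℕ) (b x : ℝ) : ℝ := ∏ m ∈ range n, Lf (cM b m) x
def kaM (n : ℕ) (b x : ℝ) : ℝ := 1 + ∑ m ∈ range n, 2 * (1 - Lf (cM b m) x)
def shf (y : ℝ) : ℝ := y / Real.sinh y
def kap (y : ℝ) : ℝ := y * (Real.cosh y / Real.sinh y)

theorem Lf_cM {b : ℝ} (hb : 0 < b) (m : ℕ) (x : ℝ) :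
    Lf (cM b m) x = (1 + (b * x) ^ 2 / (Real.pi ^ 2 * (m + 1) ^ 2))⁻¹ := by
  unfold Lf cM
  have h1 := Real.pi_pos
  have h2 : (0 : ℝ) < (m : ℝ) + 1 := by positivity
  have h3 : Real.pi ^ 2 * (m + 1) ^ 2 + b ^ 2 * x ^ 2 ≠ 0 := by positivity
  field_simp

theorem tendsto_shM {b : ℝ} (hb : 0 < b) {x : ℝ} (hx : x ≠ 0) :
    Tendsto (fun n => shM n b x) atTop (𝓝 (shf (b * x))) := by
  obtain ⟨y, hy⟩ : ∃ y, y = b * x := ⟨_, rfl⟩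
  rw [← hy]
  have hy0 : y ≠ 0 := by rw [hy]; exact mul_ne_zero hb.ne' hx
  have hpi : (Real.pi : ℂ) ≠ 0 := by exact_mod_cast Real.pi_ne_zero
  have h := Complex.tendsto_euler_sin_prod (Complex.I * y / Real.pi)
  have e1 : (Real.pi : ℂ) * (Complex.I * y / Real.pi) = y * Complex.I := by field_simp
  rw [e1, Complex.sin_mul_I] at h
  have h2 := (Complex.continuous_im.tendsto _).comp h
  have h3 : Tendsto (fun n : ℕ => y * ∏ j ∈ range n, (1 + y ^ 2 / (Real.pi ^ 2 * ((j : ℝ) + 1) ^ 2))) atTop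
      (𝓝 (Real.sinh y)) := by
    convert h2 using 1
    · ext n
      simp only [Function.comp]
      have : ∀ j : ℕ, (1 : ℂ) - (Complex.I * y / Real.pi) ^ 2 / ((j : ℂ) + 1) ^ 2 =
          ((1 + y ^ 2 / (Real.pi ^ 2 * ((j : ℝ) + 1) ^ 2) : ℝ) : ℂ) := by
        intro j
        have : (j : ℂ) + 1 ≠ 0 := Nat.cast_add_one_ne_zero j
        push_cast
        rw [div_pow, mul_pow, Complex.I_sq]; field_simp; ring
      simp_rw [this]
      rw [← Complex.ofReal_prod, mul_right_comm, ← Complex.ofReal_mul]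
      simp [-Complex.ofReal_prod, -Complex.ofReal_mul, Complex.re_ofReal_mul, Complex.im_ofReal_mul]
    · congr 1
      rw [← Complex.ofReal_sinh, Complex.im_ofReal_mul]; simp
  have hs : Real.sinh y ≠ 0 := by rwa [Ne, Real.sinh_eq_zero]
  have h4 := (h3.inv₀ hs).const_mul y
  refine h4.congr fun n => ?_
  unfold shM
  rw [mul_inv, ← mul_assoc, mul_inv_cancel₀ hy0, one_mul, ← Finset.prod_inv_distrib]
  refine Finset.prod_congr rfl fun m _ => ?_
  rw [Lf_cM hb, hy]

theorem tendsto_kaM {b : ℝ} (hb : 0 < b) {x : ℝ} (hx : x ≠ 0) :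
    Tendsto (fun n => kaM n b x) atTop (𝓝 (kap (b * x))) := by
  obtain ⟨y, hy⟩ : ∃ y, y = b * x := ⟨_, rfl⟩
  rw [← hy]
  have hy0 : y ≠ 0 := by rw [hy]; exact mul_ne_zero hb.ne' hx
  have hyC : (y : ℂ) ≠ 0 := by exact_mod_cast hy0
  have hpi : (Real.pi : ℂ) ≠ 0 := by exact_mod_cast Real.pi_ne_zero
  have hz : (Complex.I * y / Real.pi) ∈ Complex.integerComplement := by
    rw [Complex.mem_integerComplement_iff]
    rintro ⟨n, hn⟩
    have := congrArg Complex.im hn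
    rw [mul_div_assoc, ← Complex.ofReal_div, mul_comm, Complex.im_ofReal_mul] at this
    simp at this
    exact (div_ne_zero hy0 Real.pi_ne_zero) this.symm
  have h := (tendsto_logDeriv_euler_cot_sub hz).const_mul (Complex.I * y / Real.pi)
  have h2 := (Complex.continuous_re.tendsto _).comp h
  have hs : Real.sinh y ≠ 0 := by rwa [Ne, Real.sinh_eq_zero]
  have hsC : (Real.sinh y : ℂ) ≠ 0 := by exact_mod_cast hs
  have h3 := h2.const_add 1
  have hlim : 1 + (Complex.I * y / Real.pi * (Real.pi * Complex.cot (Real.pi * (Complex.I * y / Real.pi)) -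
      1 / (Complex.I * y / Real.pi))).re = kap y := by
    have e1 : (Real.pi : ℂ) * (Complex.I * y / Real.pi) = y * Complex.I := by field_simp
    rw [e1, Complex.cot, Complex.sin_mul_I, Complex.cos_mul_I, ← Complex.ofReal_sinh, ← Complex.ofReal_cosh]
    have : (Complex.I * y / Real.pi * (Real.pi * ((Real.cosh y : ℂ) / (Real.sinh y * Complex.I)) -
      1 / (Complex.I * y / Real.pi))) = ((kap y - 1 : ℝ) : ℂ) := by
      unfold kap; push_cast
      rw [← Complex.ofReal_sinh]
      field_simp
    rw [this, Complex.ofReal_re]; ring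
  rw [hlim] at h3
  refine h3.congr fun n => ?_
  unfold kaM
  congr 1
  simp only [Function.comp]
  rw [Finset.mul_sum, Complex.re_sum]
  refine Finset.sum_congr rfl fun m _ => ?_
  rw [cotTerm_identity hz, Lf_cM hb, ← hy]
  have hm : (m : ℝ) + 1 ≠ 0 := Nat.cast_add_one_ne_zero m
  have hpos : Real.pi ^ 2 * ((m : ℝ) + 1) ^ 2 + y ^ 2 ≠ 0 := by
    have : 0 < y ^ 2 := by positivity
    positivity
  have : Complex.I * y / Real.pi * (2 * (Complex.I * y / Real.pi) *
      (1 / ((Complex.I * y / Real.pi + (m + 1)) * (Complex.I * y / Real.pi - (m + 1))))) =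
      ((2 * (y ^ 2 / (Real.pi ^ 2 * (m + 1) ^ 2 + y ^ 2)) : ℝ) : ℂ) := by
    have h0 : (Complex.I * y / Real.pi + (m + 1)) * (Complex.I * y / Real.pi - (m + 1)) =
      -(((Real.pi ^ 2 * (m + 1) ^ 2 + y ^ 2 : ℝ) : ℂ) / Real.pi ^ 2) := by
      push_cast
      field_simp
      ring_nf
      rw [Complex.I_sq]; ring
    rw [h0]
    have hC : ((Real.pi ^ 2 * (m + 1) ^ 2 + y ^ 2 : ℝ) : ℂ) ≠ 0 := by exact_mod_cast hpos
    rw [Complex.ofReal_mul, Complex.ofReal_div]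
    field_simp
    rw [Complex.I_sq]; push_cast; ring
  rw [this, Complex.ofReal_re]
  have h5 : (1 + y ^ 2 / (Real.pi ^ 2 * ((m : ℝ) + 1) ^ 2)) ≠ 0 := by positivity
  have hpi' := Real.pi_ne_zero
  field_simp
  ring

theorem sum_inv_sq (n : ℕ) : ∑ m ∈ range n, 1 / ((m : ℝ) + 1) ^ 2 ≤ 2 := by
  have h : ∀ n : ℕ, ∑ m ∈ range n, 1 / ((m : ℝ) + 1) ^ 2 ≤ 2 - 1 / (n : ℝ) := by
    intro n
    induction n with
    | zero => norm_num
    | succ n ih =>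
      rw [Finset.sum_range_succ, Nat.cast_succ]
      rcases Nat.eq_zero_or_pos n with rfl | hn
      · norm_num
      · have hn : (0 : ℝ) < n := Nat.cast_pos.2 hn
        have : 1 / ((n : ℝ) + 1) ^ 2 ≤ 1 / (n : ℝ) - 1 / ((n : ℝ) + 1) := by
          rw [div_sub_div _ _ hn.ne' (by positivity), div_le_div_iff₀ (by positivity) (by positivity)]
          nlinarith
        linarith
  have : 0 ≤ 1 / (n : ℝ) := by positivity
  linarith [h n]

theorem cM_pos {b : ℝ} (hb : 0 < b) (m : ℕ) : 0 < cM b m := by unfold cM; positivity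

theorem cM_ge {b : ℝ} (hb : 0 < b) (hb1 : b ≤ 1) (m : ℕ) : Real.pi * (m + 1) ≤ cM b m := by
  unfold cM
  rw [le_div_iff₀ hb]
  have : 0 ≤ Real.pi * ((m : ℝ) + 1) := by positivity
  nlinarith

theorem kaM_bd {b : ℝ} (hb : 0 < b) (hb1 : b ≤ 1) (n : ℕ) (x : ℝ) :
    1 ≤ kaM n b x ∧ kaM n b x ≤ 1 + x ^ 2 := by
  unfold kaM
  constructor
  · have : 0 ≤ ∑ m ∈ range n, 2 * (1 - Lf (cM b m) x) :=
      Finset.sum_nonneg fun m _ => by have := Lf_le (cM_pos hb m) x; linarith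
    linarith
  · have : ∑ m ∈ range n, 2 * (1 - Lf (cM b m) x) ≤ ∑ m ∈ range n, x ^ 2 / 2 * (1 / ((m : ℝ) + 1) ^ 2) := by
      refine Finset.sum_le_sum fun m _ => ?_
      have h1 := cM_ge hb hb1 m
      have h2 : 3 * ((m : ℝ) + 1) ≤ cM b m := le_trans (by gcongr; exact Real.pi_gt_three.le) h1
      have h3 : 0 < (m : ℝ) + 1 := by positivity
      have h4 : 9 * ((m : ℝ) + 1) ^ 2 ≤ cM b m ^ 2 := by nlinarith
      have h5 : 1 - Lf (cM b m) x = x ^ 2 / (cM b m ^ 2 + x ^ 2) := by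
        unfold Lf
        have : cM b m ^ 2 + x ^ 2 ≠ 0 := by nlinarith [sq_nonneg x]
        field_simp; ring
      rw [h5]
      have h6 : x ^ 2 / (cM b m ^ 2 + x ^ 2) ≤ x ^ 2 / (9 * ((m : ℝ) + 1) ^ 2) := by
        gcongr; nlinarith [sq_nonneg x]
      have h7 : x ^ 2 / (9 * ((m : ℝ) + 1) ^ 2) = x ^ 2 * (1 / ((m : ℝ) + 1) ^ 2) / 9 := by field_simp
      have : 0 ≤ x ^ 2 * (1 / ((m : ℝ) + 1) ^ 2) := by positivity
      linarith
    rw [← Finset.mul_sum _ _ (x ^ 2 / 2)] at this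
    have := mul_le_mul_of_nonneg_left (sum_inv_sq n) (by positivity : 0 ≤ x ^ 2 / 2)
    linarith

end Cheeger

namespace Cheeger

variable {ι : Type*} [Fintype ι] [DecidableEq ι] {b ρ : ι → ℝ} {i0 : ι}

def phM (n : ℕ) (b ρ : ι → ℝ) (x : ℝ) : ℝ := ∏ i, shM n (b i) x * Real.exp (-(ρ i * kaM n (b i) x))
def phs (b ρ : ι → ℝ) (x : ℝ) : ℝ := ∏ i, shf (b i * x) * Real.exp (-(ρ i * kap (b i * x)))

def cP (n : ℕ) (b : ι → ℝ) (p : ι × Fin n) : ℝ := cM (b p.1) p.2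
def qP (n : ℕ) (ρ : ι → ℝ) (p : ι × Fin n) : ℝ := ρ p.1

structure Dat (b ρ : ι → ℝ) (i0 : ι) : Prop where
  b0 : ∀ i, 0 < b i
  b1 : ∀ i, b i ≤ 1
  bi : b i0 = 1
  r0 : ∀ i, 0 ≤ ρ i

theorem Ef_eq' {c : ℝ} (hc : 0 < c) (q x : ℝ) : Ef c q x = Real.exp (-(q * (2 * (1 - Lf c x)))) := by
  rw [Ef_eq hc, ← Real.exp_add]; congr 1; ring

theorem phM_eq (h : Dat b ρ i0) (n : ℕ) (x : ℝ) :
    phM n b ρ x = Real.exp (-∑ i, ρ i) * phi univ (cP n b) (qP n ρ) x := by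
  unfold phM phi
  rw [Fintype.prod_prod_type, ← Finset.sum_neg_distrib, Real.exp_sum, ← Finset.prod_mul_distrib]
  refine Finset.prod_congr rfl fun i _ => ?_
  simp only [cP, qP]
  rw [Fin.prod_univ_eq_prod_range (fun m => Lf (cM (b i) m) x * Ef (cM (b i) m) (ρ i) x),
    Finset.prod_mul_distrib, shM, kaM]
  have : ∏ m ∈ range n, Ef (cM (b i) m) (ρ i) x = Real.exp (-(ρ i * ∑ m ∈ range n, 2 * (1 - Lf (cM (b i) m) x))) := by
    rw [Finset.mul_sum, ← Finset.sum_neg_distrib, Real.exp_sum]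
    exact Finset.prod_congr rfl fun m _ => Ef_eq' (cM_pos (h.b0 i) m) _ _
  rw [this, mul_add, neg_add, Real.exp_add]
  rw [mul_one]; ring

theorem Dat.good (h : Dat b ρ i0) (n : ℕ) :
    Good (cP (n + 4) b) (qP (n + 4) ρ) (i0, 0) (i0, 1) (i0, 2) := by
  refine ⟨fun p => ?_, fun p => h.r0 _, by simp, ?_, ?_, ?_, ?_⟩
  · have := cM_ge (h.b0 p.1) (h.b1 p.1) p.2
    refine le_trans ?_ this
    have := Real.pi_pos
    nlinarith [(Nat.cast_nonneg (α := ℝ) (p.2 : ℕ))]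
  · have : (2 : ℕ) % (n + 4) = 2 := Nat.mod_eq_of_lt (by omega)
    simp [Fin.ext_iff, this]
  · have : (2 : ℕ) % (n + 4) = 2 := Nat.mod_eq_of_lt (by omega)
    simp [Fin.ext_iff, this]
  · simp [cP, cM, h.bi]
  · simp [cP, cM, h.bi]; ring

theorem RP_smul (C : ℝ) (A : ℝ → ℝ) (s : ℝ) : RP (fun x => C * A x) s = C * RP A s := by
  unfold RP; rw [← integral_const_mul]; congr 1; ext x; ring
theorem RS_smul (C : ℝ) (A : ℝ → ℝ) (s : ℝ) : RS (fun x => C * A x) s = C * RS A s := by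
  unfold RS; rw [← integral_const_mul]; congr 1; ext x; ring

theorem N_eq (h : Dat b ρ i0) (n : ℕ) (i : ι) (s : ℝ) :
    RP (fun x => phi univ (cP (n + 4) b) (qP (n + 4) ρ) x * kaM (n + 4) (b i) x) s =
    RP (phi univ (cP (n + 4) b) (qP (n + 4) ρ)) s + ∑ m ∈ range (n + 4),
      2 * (RP (phi univ (cP (n + 4) b) (qP (n + 4) ρ)) s -
        RP (fun x => phi univ (cP (n + 4) b) (qP (n + 4) ρ) x * Lf (cM (b i) m) x) s) := by
  have hg := h.good n
  have i0 := integrable_RP hg.int_phi s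
  have i1 := fun m => integrable_RP (integrable_mul_L hg.int_phi (cM_pos (h.b0 i) m)) s
  unfold RP
  simp_rw [← fun m => integral_sub i0 (i1 m), ← integral_const_mul]
  have i2 : ∀ m ∈ range (n + 4), Integrable (fun x => 2 *
      (phi univ (cP (n + 4) b) (qP (n + 4) ρ) x * Real.cos (x * s) -
        phi univ (cP (n + 4) b) (qP (n + 4) ρ) x * Lf (cM (b i) m) x * Real.cos (x * s))) :=
    fun m _ => (i0.sub (i1 m)).const_mul 2
  rw [← integral_finsetSum _ i2, ← integral_add i0 (integrable_finsetSum _ i2)]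
  congr 1; ext x
  unfold kaM
  rw [mul_add, add_mul, mul_one, Finset.mul_sum, Finset.sum_mul]
  congr 1
  refine Finset.sum_congr rfl fun m _ => ?_
  ring

theorem N_upper (h : Dat b ρ i0) (n : ℕ) (i : ι) (s : ℝ) :
    RP (fun x => phi univ (cP (n + 4) b) (qP (n + 4) ρ) x * kaM (n + 4) (b i) x) s ≤
    35 * RP (phi univ (cP (n + 4) b) (qP (n + 4) ρ)) s := by
  have hg := h.good n
  have hp := hg.logC.pos s
  rw [N_eq h]
  set P := RP (phi univ (cP (n + 4) b) (qP (n + 4) ρ)) s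
  have : ∀ m ∈ range (n + 4), 2 * (P - RP (fun x => phi univ (cP (n + 4) b) (qP (n + 4) ρ) x * Lf (cM (b i) m) x) s)
      ≤ 16 * P * (1 / ((m : ℝ) + 1) ^ 2) := by
    intro m _
    rcases Nat.eq_zero_or_pos m with rfl | hm
    · have := hg.tail_upper1 (cM_pos (h.b0 i) 0) s
      simp only [CharP.cast_eq_zero, zero_add, one_pow, div_one, mul_one]
      linarith
    · have h1 := cM_ge (h.b0 i) (h.b1 i) m
      have hm1 : (1 : ℝ) ≤ m := by exact_mod_cast hm
      have hpi := Real.pi_pos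
      have h2 := hg.tail_upper (d := cM (b i) m) (by nlinarith) s
      have h3 : 8 * Real.pi ^ 2 / cM (b i) m ^ 2 ≤ 8 * (1 / ((m : ℝ) + 1) ^ 2) := by
        have : 8 * (1 / ((m : ℝ) + 1) ^ 2) = 8 * Real.pi ^ 2 / (Real.pi * (m + 1)) ^ 2 := by field_simp
        rw [this]
        gcongr
      have := mul_le_mul_of_nonneg_right h3 hp.le
      linarith
  have h2 := Finset.sum_le_sum this
  rw [← Finset.mul_sum _ _ (16 * P)] at h2
  have h3 := mul_le_mul_of_nonneg_left (sum_inv_sq (n + 4)) (by positivity : 0 ≤ 16 * P)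
  linarith

theorem N_lower (h : Dat b ρ i0) (n : ℕ) (i : ι) (s : ℝ)
    (hD : |RS (phi univ (cP (n + 4) b) (qP (n + 4) ρ)) s| ≤ 1 / 2 * RP (phi univ (cP (n + 4) b) (qP (n + 4) ρ)) s) :
    1 / 2 * RP (phi univ (cP (n + 4) b) (qP (n + 4) ρ)) s ≤
    RP (fun x => phi univ (cP (n + 4) b) (qP (n + 4) ρ) x * kaM (n + 4) (b i) x) s := by
  have hg := h.good n
  have hp := hg.logC.pos s
  rw [N_eq h]
  set P := RP (phi univ (cP (n + 4) b) (qP (n + 4) ρ)) s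
  have : ∀ m ∈ range (n + 4), -(P / 9) * (1 / ((m : ℝ) + 1) ^ 2) ≤
      2 * (P - RP (fun x => phi univ (cP (n + 4) b) (qP (n + 4) ρ) x * Lf (cM (b i) m) x) s) := by
    intro m _
    have h1 := cM_ge (h.b0 i) (h.b1 i) m
    have hm1 : (0 : ℝ) ≤ m := Nat.cast_nonneg m
    have hpi := Real.pi_gt_three
    have h4 : 3 * ((m : ℝ) + 1) ≤ cM (b i) m := by nlinarith
    have h2 := hg.tail_lower (d := cM (b i) m) (by linarith) s hD
    have h3 : 1 / (2 * cM (b i) m ^ 2) ≤ 1 / 18 * (1 / ((m : ℝ) + 1) ^ 2) := by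
      have : 1 / 18 * (1 / ((m : ℝ) + 1) ^ 2) = 1 / (2 * (3 * (m + 1)) ^ 2) := by field_simp; norm_num
      rw [this]
      gcongr
    have := mul_le_mul_of_nonneg_right h3 hp.le
    linarith
  have h2 := Finset.sum_le_sum this
  rw [← Finset.mul_sum _ _ (-(P / 9))] at h2
  have h3 := mul_le_mul_of_nonneg_left (sum_inv_sq (n + 4)) (by positivity : 0 ≤ P / 9)
  linarith

theorem SS1_le (h : Dat b ρ i0) (n : ℕ) : SS1 (cP n b) ≤ Fintype.card ι := by
  unfold SS1
  rw [Fintype.sum_prod_type]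
  have : ∀ i ∈ (univ : Finset ι), ∑ m : Fin n, 1 / cP n b (i, m) ^ 2 ≤ 1 := by
    intro i _
    simp only [cP]
    rw [Fin.sum_univ_eq_sum_range (fun m => 1 / cM (b i) m ^ 2)]
    have : ∀ m ∈ range n, 1 / cM (b i) m ^ 2 ≤ 1 / 9 * (1 / ((m : ℝ) + 1) ^ 2) := by
      intro m _
      have h1 := cM_ge (h.b0 i) (h.b1 i) m
      have hm1 : (0 : ℝ) ≤ m := Nat.cast_nonneg m
      have h4 : 3 * ((m : ℝ) + 1) ≤ cM (b i) m := by nlinarith [Real.pi_gt_three]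
      have : 1 / 9 * (1 / ((m : ℝ) + 1) ^ 2) = 1 / (3 * (m + 1)) ^ 2 := by field_simp; norm_num
      rw [this]; gcongr
    have h2 := Finset.sum_le_sum this
    rw [← Finset.mul_sum] at h2
    linarith [sum_inv_sq n]
  have := Finset.sum_le_sum this
  simpa using this

theorem SSQ_le (h : Dat b ρ i0) (n : ℕ) : SSQ (cP n b) (qP n ρ) ≤ ∑ i, ρ i := by
  unfold SSQ
  rw [Fintype.sum_prod_type]
  refine Finset.sum_le_sum fun i _ => ?_
  simp only [cP, qP]
  rw [Fin.sum_univ_eq_sum_range (fun m => ρ i / cM (b i) m ^ 2)]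
  have : ∀ m ∈ range n, ρ i / cM (b i) m ^ 2 ≤ ρ i / 9 * (1 / ((m : ℝ) + 1) ^ 2) := by
    intro m _
    have h1 := cM_ge (h.b0 i) (h.b1 i) m
    have hm1 : (0 : ℝ) ≤ m := Nat.cast_nonneg m
    have h4 : 3 * ((m : ℝ) + 1) ≤ cM (b i) m := by nlinarith [Real.pi_gt_three]
    have : ρ i / 9 * (1 / ((m : ℝ) + 1) ^ 2) = ρ i / (3 * (m + 1)) ^ 2 := by field_simp; norm_num
    rw [this]
    have := h.r0 i
    gcongr
  have h2 := Finset.sum_le_sum this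
  rw [← Finset.mul_sum] at h2
  have := h.r0 i
  have := mul_le_mul_of_nonneg_left (sum_inv_sq n) (by positivity : 0 ≤ ρ i / 9)
  linarith

theorem SSQ_ge (h : Dat b ρ i0) (n : ℕ) {κ0 : ℝ} (hκ : ∀ i, κ0 ≤ b i ^ 2 / Real.pi ^ 2) :
    κ0 * ∑ i, ρ i ≤ SSQ (cP (n + 4) b) (qP (n + 4) ρ) := by
  unfold SSQ
  rw [Fintype.sum_prod_type, Finset.mul_sum]
  refine Finset.sum_le_sum fun i _ => ?_
  have h1 : qP (n + 4) ρ (i, 0) / cP (n + 4) b (i, 0) ^ 2 ≤ ∑ m : Fin (n + 4), qP (n + 4) ρ (i, m) / cP (n + 4) b (i, m) ^ 2 :=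
    Finset.single_le_sum (f := fun m : Fin (n + 4) => qP (n + 4) ρ (i, m) / cP (n + 4) b (i, m) ^ 2)
      (fun m _ => div_nonneg (h.r0 _) (sq_nonneg _)) (Finset.mem_univ 0)
  refine le_trans ?_ h1
  have := mul_le_mul_of_nonneg_right (hκ i) (h.r0 i)
  refine this.trans (le_of_eq ?_)
  simp only [qP, cP, cM]
  have := (h.b0 i).ne'
  have := Real.pi_ne_zero
  simp
  field_simp

end Cheeger

namespace Cheeger

variable {ι : Type*} [Fintype ι] [DecidableEq ι] {b ρ : ι → ℝ} {i0 : ι}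

theorem shM_pos {b : ℝ} (hb : 0 < b) (n : ℕ) (x : ℝ) : 0 < shM n b x :=
  Finset.prod_pos fun m _ => Lf_pos (cM_pos hb m) x

theorem shM_le_one {b : ℝ} (hb : 0 < b) (n : ℕ) (x : ℝ) : shM n b x ≤ 1 :=
  Finset.prod_le_one (fun m _ => (Lf_pos (cM_pos hb m) x).le) fun m _ => Lf_le (cM_pos hb m) x

theorem shM_le_LL (n : ℕ) (x : ℝ) : shM (n + 4) 1 x ≤ Lf (2 * Real.pi) x * Lf Real.pi x := by
  have e0 : cM 1 0 = Real.pi := by simp [cM]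
  have e1 : cM 1 1 = 2 * Real.pi := by simp [cM]; ring
  have hsub : range 2 ⊆ range (n + 4) := Finset.range_subset_range.2 (by omega)
  have : shM (n + 4) 1 x ≤ ∏ m ∈ range 2, Lf (cM 1 m) x := by
    unfold shM
    rw [← Finset.prod_sdiff hsub]
    refine mul_le_of_le_one_left (Finset.prod_nonneg fun m _ => (Lf_pos (cM_pos one_pos m) x).le) ?_
    exact Finset.prod_le_one (fun m _ => (Lf_pos (cM_pos one_pos m) x).le) fun m _ => Lf_le (cM_pos one_pos m) x
  rw [Finset.prod_range_succ, Finset.prod_range_succ, Finset.prod_range_zero, one_mul, e0, e1] at this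
  linarith

theorem phM_pos (h : Dat b ρ i0) (n : ℕ) (x : ℝ) : 0 < phM n b ρ x :=
  Finset.prod_pos fun i _ => mul_pos (shM_pos (h.b0 i) n x) (Real.exp_pos _)

def Gd (x : ℝ) : ℝ := Real.pi ^ 2 * Lf (2 * Real.pi) x

theorem integrable_Gd : Integrable Gd := (integrable_Lf (by positivity)).const_mul _

theorem phM_bd (h : Dat b ρ i0) (n : ℕ) (x : ℝ) : phM (n + 4) b ρ x * (1 + x ^ 2) ≤ Gd x := by
  have hle : ∀ i, shM (n + 4) (b i) x * Real.exp (-(ρ i * kaM (n + 4) (b i) x)) ≤ shM (n + 4) (b i) x := by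
    intro i
    refine mul_le_of_le_one_right (shM_pos (h.b0 i) _ x).le (Real.exp_le_one_iff.2 ?_)
    have := mul_nonneg (h.r0 i) (zero_le_one.trans (kaM_bd (h.b0 i) (h.b1 i) (n + 4) x).1)
    linarith
  have h1 : phM (n + 4) b ρ x ≤ shM (n + 4) 1 x := by
    unfold phM
    rw [← Finset.mul_prod_erase univ _ (Finset.mem_univ i0)]
    have h2 : ∏ i ∈ univ.erase i0, shM (n + 4) (b i) x * Real.exp (-(ρ i * kaM (n + 4) (b i) x)) ≤ 1 :=
      Finset.prod_le_one (fun i _ => (mul_pos (shM_pos (h.b0 i) _ x) (Real.exp_pos _)).le)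
        fun i _ => (hle i).trans (shM_le_one (h.b0 i) _ x)
    have h3 := hle i0
    rw [h.bi] at h3 ⊢
    exact (mul_le_of_le_one_right (mul_pos (shM_pos one_pos _ x) (Real.exp_pos _)).le h2).trans h3
  have h4 := h1.trans (shM_le_LL n x)
  have h5 : Lf Real.pi x * (1 + x ^ 2) ≤ Real.pi ^ 2 := by
    unfold Lf
    have := Real.pi_gt_three
    rw [div_mul_eq_mul_div, div_le_iff₀ (by positivity)]
    have : 1 ≤ Real.pi ^ 2 := by nlinarith
    gcongr
  unfold Gd
  have h6 := Lf_pos (c := 2 * Real.pi) (by positivity) x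
  calc _ ≤ (Lf (2 * Real.pi) x * Lf Real.pi x) * (1 + x ^ 2) := by gcongr
    _ = Lf (2 * Real.pi) x * (Lf Real.pi x * (1 + x ^ 2)) := by ring
    _ ≤ Lf (2 * Real.pi) x * Real.pi ^ 2 := by gcongr
    _ = _ := by ring

theorem tendsto_phM (h : Dat b ρ i0) {x : ℝ} (hx : x ≠ 0) :
    Tendsto (fun n => phM (n + 4) b ρ x) atTop (𝓝 (phs b ρ x)) := by
  unfold phM phs
  refine tendsto_finsetProd _ fun i _ => ?_
  have h1 := (tendsto_shM (h.b0 i) hx).comp (tendsto_add_atTop_nat 4)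
  have h2 := (tendsto_kaM (h.b0 i) hx).comp (tendsto_add_atTop_nat 4)
  exact h1.mul ((h2.const_mul (ρ i)).neg.rexp)

theorem phs_bd (h : Dat b ρ i0) {x : ℝ} (hx : x ≠ 0) : phs b ρ x * (1 + x ^ 2) ≤ Gd x :=
  le_of_tendsto ((tendsto_phM h hx).mul_const _) (Eventually.of_forall fun n => phM_bd h n x)

theorem shf_pos {y : ℝ} (hy : y ≠ 0) : 0 < shf y := by
  unfold shf
  rcases lt_or_gt_of_ne hy with h | h
  · exact div_pos_of_neg_of_neg h (Real.sinh_neg_iff.2 h)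
  · exact div_pos h (Real.sinh_pos_iff.2 h)

theorem phs_pos (h : Dat b ρ i0) {x : ℝ} (hx : x ≠ 0) : 0 < phs b ρ x :=
  Finset.prod_pos fun i _ => mul_pos (shf_pos (mul_ne_zero (h.b0 i).ne' hx)) (Real.exp_pos _)

theorem kap_bd {b : ℝ} (hb : 0 < b) (hb1 : b ≤ 1) {x : ℝ} (hx : x ≠ 0) :
    1 ≤ kap (b * x) ∧ kap (b * x) ≤ 1 + x ^ 2 :=
  ⟨ge_of_tendsto (tendsto_kaM hb hx) (Eventually.of_forall fun n => (kaM_bd hb hb1 n x).1),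
    le_of_tendsto (tendsto_kaM hb hx) (Eventually.of_forall fun n => (kaM_bd hb hb1 n x).2)⟩

theorem measurable_shf : Measurable shf := by
  unfold shf; exact measurable_id.div Real.measurable_sinh

theorem measurable_kap : Measurable kap := by
  unfold kap; exact measurable_id.mul (Real.measurable_cosh.div Real.measurable_sinh)

theorem measurable_phs : Measurable (phs b ρ) := by
  unfold phs
  have := measurable_shf; have := measurable_kap
  fun_prop

theorem ae_ne : ∀ᵐ x : ℝ, x ≠ 0 := by
  simp [ae_iff, measure_singleton]

/-- integrability of weighted kernels -/
theorem int_phs (h : Dat b ρ i0) {w : ℝ → ℝ} (hw : AEStronglyMeasurable w)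
    (hb : ∀ x, x ≠ 0 → |w x| ≤ 1 + x ^ 2) : Integrable (fun x => phs b ρ x * w x) := by
  refine integrable_Gd.mono' (measurable_phs.aestronglyMeasurable.mul hw) ?_
  filter_upwards [ae_ne] with x hx
  have h1 := phs_pos h hx
  rw [norm_mul, Real.norm_of_nonneg h1.le, Real.norm_eq_abs]
  exact (mul_le_mul_of_nonneg_left (hb x hx) h1.le).trans (phs_bd h hx)

theorem continuous_shM {b : ℝ} (hb : 0 < b) (n : ℕ) : Continuous (shM n b) := by
  unfold shM; exact continuous_finsetProd _ fun m _ => continuous_Lf (cM_pos hb m)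

theorem continuous_kaM {b : ℝ} (hb : 0 < b) (n : ℕ) : Continuous (kaM n b) := by
  unfold kaM
  refine continuous_const.add (continuous_finsetSum _ fun m _ => ?_)
  have := continuous_Lf (cM_pos hb m)
  fun_prop

theorem continuous_phM (h : Dat b ρ i0) (n : ℕ) : Continuous (phM n b ρ) := by
  unfold phM
  refine continuous_finsetProd _ fun i _ => ?_
  have := continuous_shM (h.b0 i) n
  have := continuous_kaM (h.b0 i) n
  fun_prop

theorem tendsto_int (h : Dat b ρ i0) {w : ℕ → ℝ → ℝ} {w' : ℝ → ℝ} (hw : ∀ n, Continuous (w n))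
    (hb : ∀ n x, |w n x| ≤ 1 + x ^ 2) (hl : ∀ x, x ≠ 0 → Tendsto (fun n => w n x) atTop (𝓝 (w' x))) :
    Tendsto (fun n => ∫ x, phM (n + 4) b ρ x * w n x) atTop (𝓝 (∫ x, phs b ρ x * w' x)) := by
  refine tendsto_integral_of_dominated_convergence Gd ?_ integrable_Gd ?_ ?_
  · exact fun n => ((continuous_phM h _).mul (hw n)).aestronglyMeasurable
  · refine fun n => Eventually.of_forall fun x => ?_
    have h1 := phM_pos h (n + 4) x
    rw [norm_mul, Real.norm_of_nonneg h1.le, Real.norm_eq_abs]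
    exact (mul_le_mul_of_nonneg_left (hb n x) h1.le).trans (phM_bd h n x)
  · filter_upwards [ae_ne] with x hx
    exact (tendsto_phM h hx).mul (hl x hx)

theorem abs_cos_bd (x s : ℝ) : |Real.cos (x * s)| ≤ 1 + x ^ 2 := by
  have := Real.abs_cos_le_one (x * s); nlinarith [sq_nonneg x]

theorem abs_sin_bd (x s : ℝ) : |x * Real.sin (x * s)| ≤ 1 + x ^ 2 := by
  rw [abs_mul]
  have := Real.abs_sin_le_one (x * s)
  have : |x| * |Real.sin (x * s)| ≤ |x| * 1 := by gcongr
  nlinarith [sq_nonneg (|x| - 1), sq_abs x, abs_nonneg x]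

theorem abs_kaM_bd {b : ℝ} (hb : 0 < b) (hb1 : b ≤ 1) (n : ℕ) (x s : ℝ) :
    |kaM n b x * Real.cos (x * s)| ≤ 1 + x ^ 2 := by
  have h := kaM_bd hb hb1 n x
  rw [abs_mul, abs_of_nonneg (by linarith)]
  have := Real.abs_cos_le_one (x * s)
  have : kaM n b x * |Real.cos (x * s)| ≤ kaM n b x * 1 := by gcongr; linarith
  linarith

theorem abs_kap_bd {b : ℝ} (hb : 0 < b) (hb1 : b ≤ 1) {x : ℝ} (hx : x ≠ 0) (s : ℝ) :
    |kap (b * x) * Real.cos (x * s)| ≤ 1 + x ^ 2 := by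
  have h := kap_bd hb hb1 hx
  rw [abs_mul, abs_of_nonneg (by linarith)]
  have := Real.abs_cos_le_one (x * s)
  have : kap (b * x) * |Real.cos (x * s)| ≤ kap (b * x) * 1 := by gcongr; linarith
  linarith

theorem exp_cancel (r : ℝ) : Real.exp r * Real.exp (-r) = 1 := by rw [← Real.exp_add]; simp

/-- the three basic integrals -/
def Pl (b ρ : ι → ℝ) (s : ℝ) : ℝ := ∫ x, phs b ρ x * Real.cos (x * s)
def Dl (b ρ : ι → ℝ) (s : ℝ) : ℝ := ∫ x, phs b ρ x * (x * Real.sin (x * s))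
def Nl (b ρ : ι → ℝ) (i : ι) (s : ℝ) : ℝ := ∫ x, phs b ρ x * (kap (b i * x) * Real.cos (x * s))

theorem tendsto_P (h : Dat b ρ i0) (s : ℝ) :
    Tendsto (fun n => RP (phi univ (cP (n + 4) b) (qP (n + 4) ρ)) s) atTop (𝓝 (Real.exp (∑ i, ρ i) * Pl b ρ s)) := by
  have := (tendsto_int h (w := fun _ x => Real.cos (x * s)) (w' := fun x => Real.cos (x * s))
    (fun n => by fun_prop) (fun n x => abs_cos_bd x s) (fun x _ => tendsto_const_nhds)).const_mul
    (Real.exp (∑ i, ρ i))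
  refine this.congr fun n => ?_
  rw [← integral_const_mul, RP]
  congr 1; ext x
  rw [phM_eq h, ← mul_assoc, ← mul_assoc, ← Real.exp_add]; simp

theorem tendsto_D (h : Dat b ρ i0) (s : ℝ) :
    Tendsto (fun n => RS (phi univ (cP (n + 4) b) (qP (n + 4) ρ)) s) atTop (𝓝 (Real.exp (∑ i, ρ i) * Dl b ρ s)) := by
  have := (tendsto_int h (w := fun _ x => x * Real.sin (x * s)) (w' := fun x => x * Real.sin (x * s))
    (fun n => by fun_prop) (fun n x => abs_sin_bd x s) (fun x _ => tendsto_const_nhds)).const_mul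
    (Real.exp (∑ i, ρ i))
  refine this.congr fun n => ?_
  rw [← integral_const_mul, RS]
  congr 1; ext x
  rw [phM_eq h]
  linear_combination (phi univ (cP (n + 4) b) (qP (n + 4) ρ) x * (x * Real.sin (x * s))) *
    exp_cancel (∑ i, ρ i)

theorem tendsto_N (h : Dat b ρ i0) (i : ι) (s : ℝ) :
    Tendsto (fun n => RP (fun x => phi univ (cP (n + 4) b) (qP (n + 4) ρ) x * kaM (n + 4) (b i) x) s) atTop
      (𝓝 (Real.exp (∑ i, ρ i) * Nl b ρ i s)) := by
  have := (tendsto_int h (w := fun n x => kaM (n + 4) (b i) x * Real.cos (x * s))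
    (w' := fun x => kap (b i * x) * Real.cos (x * s))
    (fun n => (continuous_kaM (h.b0 i) _).mul (by fun_prop)) (fun n x => abs_kaM_bd (h.b0 i) (h.b1 i) _ x s)
    (fun x hx => ((tendsto_kaM (h.b0 i) hx).comp (tendsto_add_atTop_nat 4)).mul_const _)).const_mul
    (Real.exp (∑ i, ρ i))
  refine this.congr fun n => ?_
  rw [← integral_const_mul, RP]
  congr 1; ext x
  rw [phM_eq h]
  linear_combination (phi univ (cP (n + 4) b) (qP (n + 4) ρ) x * kaM (n + 4) (b i) x * Real.cos (x * s)) *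
    exp_cancel (∑ i, ρ i)

theorem Pl_zero_pos (h : Dat b ρ i0) : 0 < Pl b ρ 0 := by
  unfold Pl
  have hinteg := int_phs h (w := fun x => Real.cos (x * 0)) (by fun_prop) (fun x _ => abs_cos_bd x 0)
  have hae : 0 ≤ᵐ[volume] fun x => phs b ρ x * Real.cos (x * 0) := by
    filter_upwards [ae_ne] with x hx
    simp only [mul_zero, Real.cos_zero, mul_one]; exact (phs_pos h hx).le
  rw [integral_pos_iff_support_of_nonneg_ae hae hinteg]
  have : (Function.support fun x => phs b ρ x * Real.cos (x * 0)) ⊇ Set.Ioi 0 := by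
    intro x hx
    simp only [mul_zero, Real.cos_zero, mul_one, Function.mem_support]
    exact (phs_pos h (ne_of_gt hx)).ne'
  exact lt_of_lt_of_le (by simp) (measure_mono this)

theorem Pl_lower (h : Dat b ρ i0) (s : ℝ) : Real.exp (-Real.pi * |s|) * Pl b ρ 0 ≤ Pl b ρ s := by
  have := le_of_tendsto_of_tendsto' ((tendsto_P h 0).const_mul _) (tendsto_P h s) fun n => (h.good n).P_lower s
  rw [mul_left_comm] at this
  exact le_of_mul_le_mul_left this (Real.exp_pos _)

theorem Pl_pos (h : Dat b ρ i0) (s : ℝ) : 0 < Pl b ρ s :=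
  lt_of_lt_of_le (mul_pos (Real.exp_pos _) (Pl_zero_pos h)) (Pl_lower h s)

theorem Dl_sign (h : Dat b ρ i0) (s : ℝ) : 0 ≤ s * Dl b ρ s := by
  have := ge_of_tendsto ((tendsto_D h s).const_mul s) (Eventually.of_forall fun n => (h.good n).RS_sign s)
  rw [mul_left_comm] at this
  exact nonneg_of_mul_nonneg_right this (Real.exp_pos _)

theorem Nl_upper (h : Dat b ρ i0) (i : ι) (s : ℝ) : Nl b ρ i s ≤ 35 * Pl b ρ s := by
  have := le_of_tendsto_of_tendsto' (tendsto_N h i s) ((tendsto_P h s).const_mul 35) fun n => N_upper h n i s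
  rw [mul_left_comm] at this
  exact le_of_mul_le_mul_left this (Real.exp_pos _)

theorem Nl_lower (h : Dat b ρ i0) {κ0 : ℝ} (hκ : ∀ i, κ0 ≤ b i ^ 2 / Real.pi ^ 2) (i : ι) (s : ℝ)
    (hs : 2 * |s| + 4 < κ0 * ∑ i, ρ i) : 1 / 2 * Pl b ρ s ≤ Nl b ρ i s := by
  have := le_of_tendsto_of_tendsto' ((tendsto_P h s).const_mul (1 / 2)) (tendsto_N h i s) fun n =>
    N_lower h n i s ((h.good n).P1 s (hs.trans_le (SSQ_ge h n hκ)))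
  rw [mul_left_comm] at this
  exact le_of_mul_le_mul_left this (Real.exp_pos _)

theorem Dl_lower (h : Dat b ρ i0) {ε : ℝ} (hε : 0 < ε) (hε1 : ε ≤ 1) (s : ℝ) (hs : 2 / ε ≤ |s|)
    (hbig : 4 * Fintype.card ι + 16 * ∑ i, ρ i < |s| / 2 * (1 / ε) * Real.exp (-1)) :
    ε * |s| * Pl b ρ s ≤ s * Dl b ρ s := by
  have := le_of_tendsto_of_tendsto' ((tendsto_P h s).const_mul (ε * |s|)) ((tendsto_D h s).const_mul s) fun n =>
    (h.good n).P2 hε hε1 s hs (lt_of_le_of_lt (by linarith [SS1_le h (n + 4), SSQ_le h (n + 4)]) hbig)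
  rw [mul_left_comm, mul_left_comm s] at this
  exact le_of_mul_le_mul_left this (Real.exp_pos _)

end Cheeger

namespace Cheeger

variable {l k}

abbrev Ix (k : Fin (l + 1) → ℕ) : Type := (j : Fin (l + 1)) × Fin (k j)

def reL (p : Ix k) : Heis l k →L[ℝ] ℝ :=
  Complex.reCLM.comp ((ContinuousLinearMap.proj (R := ℝ) (φ := fun _ : Fin (k p.1) => ℂ) p.2).comp
    ((ContinuousLinearMap.proj (R := ℝ) (φ := fun j => Fin (k j) → ℂ) p.1).comp (ContinuousLinearMap.fst ℝ _ ℝ)))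
def imL (p : Ix k) : Heis l k →L[ℝ] ℝ :=
  Complex.imCLM.comp ((ContinuousLinearMap.proj (R := ℝ) (φ := fun _ : Fin (k p.1) => ℂ) p.2).comp
    ((ContinuousLinearMap.proj (R := ℝ) (φ := fun j => Fin (k j) → ℂ) p.1).comp (ContinuousLinearMap.fst ℝ _ ℝ)))
def tL : Heis l k →L[ℝ] ℝ := ContinuousLinearMap.snd ℝ _ ℝ

@[simp] theorem reL_apply (p : Ix k) (g : Heis l k) : reL p g = (g.1 p.1 p.2).re := rfl
@[simp] theorem imL_apply (p : Ix k) (g : Heis l k) : imL p g = (g.1 p.1 p.2).im := rfl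
@[simp] theorem tL_apply (g : Heis l k) : tL g = g.2 := rfl

/-- squared modulus of a coordinate -/
def nq (p : Ix k) (g : Heis l k) : ℝ := reL p g ^ 2 + imL p g ^ 2
def dnq (p : Ix k) (g : Heis l k) : Heis l k →L[ℝ] ℝ := (2 * reL p g) • reL p + (2 * imL p g) • imL p

theorem nq_nonneg (p : Ix k) (g : Heis l k) : 0 ≤ nq p g := by unfold nq; positivity

theorem hasFDerivAt_nq (p : Ix k) (g : Heis l k) : HasFDerivAt (nq p) (dnq p g) g := by
  unfold nq dnq
  have h1 := ((reL p).hasFDerivAt (x := g)).pow 2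
  have h2 := ((imL p).hasFDerivAt (x := g)).pow 2
  refine (h1.fun_add h2).congr_fderiv (ContinuousLinearMap.ext fun w => ?_)
  simp

theorem continuous_nq (p : Ix k) : Continuous (nq p) := by unfold nq; fun_prop
theorem continuous_dnq (p : Ix k) : Continuous (dnq p) := by unfold dnq; fun_prop

def bI (a : Fin (l + 1) → ℝ) (p : Ix k) : ℝ := a p.1
def rho (g : Heis l k) (p : Ix k) : ℝ := nq p g / 4
def rr (g : Heis l k) : ℝ := ∑ p : Ix k, nq p g

structure Hy (k : Fin (l + 1) → ℕ) (a : Fin (l + 1) → ℝ) : Prop where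
  hk : ∀ i, 0 < k i
  a0 : ∀ i, 0 < a i
  a1 : ∀ i, a i ≤ 1
  al : a (Fin.last l) = 1

def Hy.i0 {k : Fin (l + 1) → ℕ} {a : Fin (l + 1) → ℝ} (h : Hy k a) : Ix k := ⟨Fin.last l, ⟨0, h.hk _⟩⟩

variable {a}

theorem Hy.dat (h : Hy k a) (g : Heis l k) : Dat (bI a) (rho g) h.i0 :=
  ⟨fun p => h.a0 _, fun p => h.a1 _, h.al, fun p => div_nonneg (nq_nonneg p g) (by norm_num)⟩

variable (a)

def Phi (g : Heis l k) : ℝ := Pl (bI a) (rho g) (g.2 / 4)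
def Dg (g : Heis l k) : ℝ := Dl (bI a) (rho g) (g.2 / 4)
def Ng (p : Ix k) (g : Heis l k) : ℝ := Nl (bI a) (rho g) p (g.2 / 4)

/-- derivative of the kernel -/
def dPhi (g : Heis l k) : Heis l k →L[ℝ] ℝ :=
  (∑ p : Ix k, (-(Ng a p g / 4)) • dnq p g) - (Dg a g / 4) • tL

variable {a}

theorem continuous_phs (x : ℝ) : Continuous (fun g : Heis l k => phs (bI a) (rho g) x) := by
  unfold phs rho
  refine continuous_finsetProd _ fun p _ => ?_
  have := continuous_nq p
  fun_prop

theorem cont_aux (h : Hy k a) {w : Heis l k → ℝ → ℝ} (hw : ∀ g, AEStronglyMeasurable (w g))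
    (hb : ∀ g x, x ≠ 0 → |w g x| ≤ 1 + x ^ 2) (hc : ∀ x, Continuous (fun g => w g x)) :
    Continuous (fun g : Heis l k => ∫ x, phs (bI a) (rho g) x * w g x) := by
  refine continuous_of_dominated (bound := Gd) ?_ ?_ integrable_Gd ?_
  · exact fun g => measurable_phs.aestronglyMeasurable.mul (hw g)
  · intro g
    filter_upwards [ae_ne] with x hx
    have h1 := phs_pos (h.dat g) hx
    rw [norm_mul, Real.norm_of_nonneg h1.le, Real.norm_eq_abs]
    exact (mul_le_mul_of_nonneg_left (hb g x hx) h1.le).trans (phs_bd (h.dat g) hx)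
  · exact Eventually.of_forall fun x => (continuous_phs x).mul (hc x)

theorem continuous_Phi (h : Hy k a) : Continuous (Phi (k := k) a) := by
  unfold Phi Pl
  exact cont_aux h (w := fun g x => Real.cos (x * (g.2 / 4)))
    (fun g => Continuous.aestronglyMeasurable (by fun_prop)) (fun g x _ => abs_cos_bd _ _) (fun x => by fun_prop)

theorem continuous_Dg (h : Hy k a) : Continuous (Dg (k := k) a) := by
  unfold Dg Dl
  exact cont_aux h (w := fun g x => x * Real.sin (x * (g.2 / 4)))
    (fun g => Continuous.aestronglyMeasurable (by fun_prop)) (fun g x _ => abs_sin_bd _ _) (fun x => by fun_prop)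

theorem continuous_Ng (h : Hy k a) (p : Ix k) : Continuous (Ng (k := k) a p) := by
  unfold Ng Nl
  refine cont_aux h (w := fun g x => kap (bI a p * x) * Real.cos (x * (g.2 / 4)))
    (fun g => Measurable.aestronglyMeasurable (by have := measurable_kap; fun_prop))
    (fun g x hx => abs_kap_bd (h.a0 _) (h.a1 _) hx _) (fun x => by fun_prop)

theorem continuous_dPhi (h : Hy k a) : Continuous (dPhi (k := k) a) := by
  unfold dPhi
  refine Continuous.sub (continuous_finsetSum _ fun p _ => ?_) ?_
  · exact ((continuous_Ng h p).div_const 4).neg.smul (continuous_dnq p)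
  · exact ((continuous_Dg h).div_const 4).smul continuous_const

theorem hasFDerivAt_phs (x : ℝ) (g : Heis l k) (q : Ix k) :
    HasFDerivAt (fun g : Heis l k => phs (bI a) (rho g) x)
      (∑ p : Ix k, (-(phs (bI a) (rho g) x * kap (bI a p * x) / 4)) • dnq p g) g := by
  have e : ∀ g : Heis l k, phs (bI a) (rho g) x = (∏ p : Ix k, shf (bI a p * x)) *
      Real.exp (-∑ p : Ix k, kap (bI a p * x) / 4 * nq p g) := by
    intro g
    unfold phs rho
    rw [Finset.prod_mul_distrib, ← Finset.sum_neg_distrib, Real.exp_sum]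
    congr 1
    refine Finset.prod_congr rfl fun p _ => ?_
    congr 1; ring
  have e' : (fun g : Heis l k => phs (bI a) (rho g) x) = fun g => (∏ p : Ix k, shf (bI a p * x)) *
      Real.exp (-∑ p : Ix k, kap (bI a p * x) / 4 * nq p g) := funext e
  have h1 : HasFDerivAt (fun g : Heis l k => ∑ p : Ix k, kap (bI a p * x) / 4 * nq p g)
      (∑ p : Ix k, (kap (bI a p * x) / 4) • dnq p g) g :=
    HasFDerivAt.fun_sum fun p _ => (hasFDerivAt_nq p g).const_mul _
  have h2 := (h1.fun_neg.exp).const_mul (∏ p : Ix k, shf (bI a p * x))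
  simp_rw [e g]
  rw [e']
  refine h2.congr_fderiv (ContinuousLinearMap.ext fun w => ?_)
  simp only [ContinuousLinearMap.sum_apply, ContinuousLinearMap.smul_apply, ContinuousLinearMap.neg_apply,
    smul_eq_mul, mul_neg, Finset.mul_sum, ← Finset.sum_neg_distrib]
  refine Finset.sum_congr rfl fun p _ => ?_
  ring

theorem hasFDerivAt_Phi (h : Hy k a) (g : Heis l k) : HasFDerivAt (Phi (k := k) a) (dPhi a g) g := by
  set F' : Heis l k → ℝ → (Heis l k →L[ℝ] ℝ) := fun g x =>
    (∑ p : Ix k, (-(phs (bI a) (rho g) x * (kap (bI a p * x) * Real.cos (x * (g.2 / 4))) / 4)) • dnq p g) -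
      (phs (bI a) (rho g) x * (x * Real.sin (x * (g.2 / 4))) / 4) • tL with hF'
  have hinteg : ∀ (g : Heis l k) (p : Ix k), Integrable (fun x => phs (bI a) (rho g) x * (kap (bI a p * x) * Real.cos (x * (g.2 / 4)))) :=
    fun g p => int_phs (h.dat g) (Measurable.aestronglyMeasurable (by have := measurable_kap; fun_prop))
      (fun x hx => abs_kap_bd (h.a0 _) (h.a1 _) hx _)
  have hint2 : ∀ g : Heis l k, Integrable (fun x => phs (bI a) (rho g) x * (x * Real.sin (x * (g.2 / 4)))) :=
    fun g => int_phs (h.dat g) (by fun_prop) (fun x _ => abs_sin_bd _ _)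
  have i1 : ∀ g : Heis l k, ∀ p ∈ (univ : Finset (Ix k)), Integrable (fun x =>
      (-(phs (bI a) (rho g) x * (kap (bI a p * x) * Real.cos (x * (g.2 / 4))) / 4)) • dnq p g) :=
    fun g p _ => (((hinteg g p).div_const 4).neg).smul_const _
  have i2 : ∀ g : Heis l k, Integrable (fun x =>
      (phs (bI a) (rho g) x * (x * Real.sin (x * (g.2 / 4))) / 4) • (tL : Heis l k →L[ℝ] ℝ)) :=
    fun g => ((hint2 g).div_const 4).smul_const _
  have hFint : ∀ g, Integrable (F' g) := fun g => (integrable_finsetSum _ (i1 g)).sub (i2 g)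
  have hval : ∫ x, F' g x = dPhi a g := by
    simp only [hF']
    rw [integral_sub (integrable_finsetSum _ (i1 g)) (i2 g), integral_finsetSum _ (i1 g)]
    unfold dPhi
    congr 1
    · refine Finset.sum_congr rfl fun p _ => ?_
      rw [integral_smul_const, integral_neg, integral_div]; rfl
    · rw [integral_smul_const, integral_div]; rfl
  rw [← hval]
  -- a uniform bound of the derivatives of the coordinates
  obtain ⟨M, hM⟩ : ∃ M : ℝ, ∀ g' ∈ Metric.closedBall g 1, ∑ p : Ix k, ‖dnq p g'‖ ≤ M := by
    have hc : Continuous fun g' : Heis l k => ∑ p : Ix k, ‖dnq p g'‖ :=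
      continuous_finsetSum _ fun p _ => (continuous_dnq p).norm
    obtain ⟨M, hM⟩ := (isCompact_closedBall g 1).bddAbove_image hc.continuousOn
    exact ⟨M, fun g' hg' => hM (Set.mem_image_of_mem _ hg')⟩
  refine hasFDerivAt_integral_of_dominated_of_fderiv_le (s := Metric.closedBall g 1)
    (bound := fun x => (M + ‖(tL : Heis l k →L[ℝ] ℝ)‖) * Gd x)
    (F := fun g x => phs (bI a) (rho g) x * Real.cos (x * (g.2 / 4)))
    (Metric.closedBall_mem_nhds g one_pos) ?_ ?_ (hFint g).aestronglyMeasurable ?_ (integrable_Gd.const_mul _) ?_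
  · exact Eventually.of_forall fun g' => measurable_phs.aestronglyMeasurable.mul
      (Continuous.aestronglyMeasurable (by fun_prop))
  · exact int_phs (h.dat g) (by fun_prop) (fun x _ => abs_cos_bd _ _)
  · filter_upwards [ae_ne] with x hx g' hg'
    have hb := phs_bd (h.dat g') hx
    have hp := phs_pos (h.dat g') hx
    have key : ∀ w : ℝ, |w| ≤ 1 + x ^ 2 → |phs (bI a) (rho g') x * w / 4| ≤ Gd x := by
      intro w hw
      rw [abs_div, abs_mul, abs_of_pos hp, abs_of_pos (by norm_num : (0 : ℝ) < 4)]
      have := mul_le_mul_of_nonneg_left hw hp.le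
      have : 0 ≤ phs (bI a) (rho g') x * |w| := by positivity
      linarith
    have hG : 0 ≤ Gd x := (abs_nonneg _).trans (key 0 (by simp; positivity))
    calc ‖F' g' x‖ ≤ ∑ p : Ix k, Gd x * ‖dnq p g'‖ + Gd x * ‖(tL : Heis l k →L[ℝ] ℝ)‖ := by
          refine (norm_sub_le _ _).trans (add_le_add ((norm_sum_le _ _).trans (Finset.sum_le_sum fun p _ => ?_)) ?_)
          · rw [norm_smul, norm_neg, Real.norm_eq_abs]
            gcongr
            exact key _ (abs_kap_bd (h.a0 _) (h.a1 _) hx _)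
          · rw [norm_smul, Real.norm_eq_abs]
            gcongr
            exact key _ (abs_sin_bd _ _)
      _ ≤ _ := by
        rw [← Finset.mul_sum]
        have := mul_le_mul_of_nonneg_left (hM g' hg') hG
        linarith
  · refine Eventually.of_forall fun x g' _ => ?_
    have h1 := hasFDerivAt_phs (a := a) x g' h.i0
    have h2 : HasFDerivAt (fun g : Heis l k => Real.cos (x * (g.2 / 4)))
        (-(Real.sin (x * (g'.2 / 4)) * (x / 4)) • (tL : Heis l k →L[ℝ] ℝ)) g' := by
      have h3 : HasFDerivAt (fun g : Heis l k => x * (g.2 / 4)) ((x / 4) • (tL : Heis l k →L[ℝ] ℝ)) g' := by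
        have := ((tL : Heis l k →L[ℝ] ℝ).hasFDerivAt (x := g')).const_mul (x / 4)
        convert! this using 1
        ext g; simp; ring
      convert! h3.cos using 1
      rw [smul_smul]; congr 1; ring
    refine (h1.fun_mul h2).congr_fderiv (ContinuousLinearMap.ext fun w => ?_)
    simp only [hF', ContinuousLinearMap.sum_apply, ContinuousLinearMap.smul_apply, ContinuousLinearMap.sub_apply,
      ContinuousLinearMap.add_apply, smul_eq_mul, Finset.mul_sum]
    have : ∀ A B A' B' : ℝ, A = A' → B = -B' → B + A' = A - B' := by intros; linarith
    refine this _ _ _ _ (Finset.sum_congr rfl fun p _ => ?_) ?_ <;> ring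

theorem Phi_pos (h : Hy k a) (g : Heis l k) : 0 < Phi a g := Pl_pos (h.dat g) _

end Cheeger

namespace Cheeger

variable {l k}

theorem sum_Ix (F : Ix k → ℝ) : ∑ p : Ix k, F p = ∑ j, ∑ m : Fin (k j), F ⟨j, m⟩ := by
  rw [← Finset.univ_sigma_univ, Finset.sum_sigma]

theorem prod_Ix (F : Ix k → ℝ) : ∏ p : Ix k, F p = ∏ j, ∏ m : Fin (k j), F ⟨j, m⟩ := by
  rw [← Finset.univ_sigma_univ, Finset.prod_sigma]

theorem nq_normSq (g : Heis l k) (j : Fin (l + 1)) (m : Fin (k j)) :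
    nq ⟨j, m⟩ g = Complex.normSq (g.1 j m) := by
  unfold nq; simp [Complex.normSq_apply]; ring

theorem phs_heis (a : Fin (l + 1) → ℝ) (g : Heis l k) (x : ℝ) :
    phs (bI a) (rho g) x = (∏ j, ((a j * x) / Real.sinh (a j * x)) ^ (k j)) *
      Real.exp (-((4:ℝ)⁻¹ * ∑ j, zNormSq l k g.1 j * (a j * x * (Real.cosh (a j * x) / Real.sinh (a j * x))))) := by
  unfold phs
  rw [prod_Ix, Finset.mul_sum, ← Finset.sum_neg_distrib, Real.exp_sum, ← Finset.prod_mul_distrib]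
  refine Finset.prod_congr rfl fun j _ => ?_
  rw [Finset.prod_mul_distrib, ← Real.exp_sum]
  congr 1
  · simp [bI, shf, div_pow]
  · congr 1
    unfold zNormSq
    rw [Finset.sum_mul, Finset.mul_sum, ← Finset.sum_neg_distrib]
    refine Finset.sum_congr rfl fun m _ => ?_
    unfold rho bI kap
    rw [nq_normSq]; ring

variable (k) in
def C0 : ℝ := (2 * (4 * Real.pi) ^ ((∑ i, k i) + 1))⁻¹

variable (k) in
theorem C0_pos : 0 < C0 k := by unfold C0; have := Real.pi_pos; positivity

theorem integrable_phs {a : Fin (l + 1) → ℝ} (h : Hy k a) (g : Heis l k) : Integrable (phs (bI a) (rho g)) := by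
  have := int_phs (h.dat g) (w := fun _ => 1) (by fun_prop) (fun x _ => by simp; positivity)
  simpa using this

theorem heatKernel_eq {a : Fin (l + 1) → ℝ} (h : Hy k a) (g : Heis l k) :
    heatKernel l k a 1 g = C0 k * Phi a g := by
  have e1 : Phi a g = RP (phs (bI a) (rho g)) (g.2 / 4) := rfl
  rw [e1, RP_eq (integrable_phs h g)]
  unfold heatKernel heatKernelC Ps
  have e2 : (2 * (4 * Real.pi * (1:ℝ)) ^ ((∑ i, k i) + 1) : ℂ)⁻¹ = ((C0 k : ℝ) : ℂ) := by
    unfold C0; push_cast; simp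
  rw [e2, Complex.re_ofReal_mul]
  congr 3
  ext x
  beta_reduce
  rw [phs_heis]
  have : (4 * ((1:ℝ) : ℂ))⁻¹ * (Complex.I * (x : ℂ) * (g.2 : ℂ) -
            ∑ j, ((zNormSq l k g.1 j : ℝ) : ℂ) *
              ((a j * x * (Real.cosh (a j * x) / Real.sinh (a j * x)) : ℝ) : ℂ)) =
      ((-((4:ℝ)⁻¹ * ∑ j, zNormSq l k g.1 j * (a j * x * (Real.cosh (a j * x) / Real.sinh (a j * x)))) : ℝ) : ℂ) +
        Complex.I * x * ((g.2 / 4 : ℝ) : ℂ) := by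
    push_cast; ring
  rw [this, Complex.exp_add, ← Complex.ofReal_exp, ← mul_assoc, ← Complex.ofReal_mul]

end Cheeger

namespace Cheeger

variable {l k}

/-! ### the dilation-type and rotation-type vector fields -/

def eX (p : Ix k) : Heis l k := (Pi.single p.1 (Pi.single p.2 (1 : ℂ)), 0)
def eY (p : Ix k) : Heis l k := (Pi.single p.1 (Pi.single p.2 Complex.I), 0)
def eT : Heis l k := (0, 1)

theorem single_coord (p q : Ix k) (c : ℂ) :
    (Pi.single (M := fun j => Fin (k j) → ℂ) p.1 (Pi.single p.2 c)) q.1 q.2 = if p = q then c else 0 := by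
  obtain ⟨i, m⟩ := p
  obtain ⟨j, m'⟩ := q
  by_cases hij : i = j
  · subst hij
    by_cases hm : m = m'
    · subst hm; simp
    · simp [hm, Ne.symm hm]
  · have : ¬ ((⟨i, m⟩ : Ix k) = ⟨j, m'⟩) := fun h => hij (congrArg Sigma.fst h)
    rw [if_neg this, Pi.single_eq_of_ne (Ne.symm hij)]; rfl

@[simp] theorem reL_eX (p q : Ix k) : reL q (eX p) = if p = q then 1 else 0 := by
  rw [reL_apply, show (eX p : Heis l k).1 q.1 q.2 = _ from single_coord p q _]; split <;> simp
@[simp] theorem imL_eX (p q : Ix k) : imL q (eX p) = 0 := by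
  rw [imL_apply, show (eX p : Heis l k).1 q.1 q.2 = _ from single_coord p q _]; split <;> simp
@[simp] theorem reL_eY (p q : Ix k) : reL q (eY p) = 0 := by
  rw [reL_apply, show (eY p : Heis l k).1 q.1 q.2 = _ from single_coord p q _]; split <;> simp
@[simp] theorem imL_eY (p q : Ix k) : imL q (eY p) = if p = q then 1 else 0 := by
  rw [imL_apply, show (eY p : Heis l k).1 q.1 q.2 = _ from single_coord p q _]; split <;> simp
@[simp] theorem tL_eX (p : Ix k) : tL (eX p) = 0 := rfl
@[simp] theorem tL_eY (p : Ix k) : tL (eY p) = 0 := rfl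
@[simp] theorem reL_eT (q : Ix k) : reL q (eT : Heis l k) = 0 := by simp [eT, reL_apply]
@[simp] theorem imL_eT (q : Ix k) : imL q (eT : Heis l k) = 0 := by simp [eT, imL_apply]
@[simp] theorem tL_eT : tL (eT : Heis l k) = 1 := rfl

theorem heis_ext {g g' : Heis l k} (h1 : ∀ p, reL p g = reL p g') (h2 : ∀ p, imL p g = imL p g')
    (h3 : tL g = tL g') : g = g' := by
  refine Prod.ext (funext fun i => funext fun j => Complex.ext ?_ ?_) h3
  · exact h1 ⟨i, j⟩
  · exact h2 ⟨i, j⟩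

/-- weighted square sum -/
def ar (a : Fin (l + 1) → ℝ) (g : Heis l k) : ℝ := ∑ p : Ix k, bI a p * nq p g

def Z1 (g : Heis l k) : Heis l k := ∑ p : Ix k, (reL p g • eX p + imL p g • eY p)
def Z2 (a : Fin (l + 1) → ℝ) (g : Heis l k) : Heis l k :=
  ∑ p : Ix k, (imL p g • eX p - reL p g • eY p) + (2 * ar a g) • eT

@[simp] theorem reL_Z1 (q : Ix k) (g : Heis l k) : reL q (Z1 g) = reL q g := by
  unfold Z1; rw [map_sum]; simp only [map_add, map_smul, reL_eX, reL_eY]; simp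
@[simp] theorem imL_Z1 (q : Ix k) (g : Heis l k) : imL q (Z1 g) = imL q g := by
  unfold Z1; rw [map_sum]; simp only [map_add, map_smul, imL_eX, imL_eY]; simp
@[simp] theorem tL_Z1 (g : Heis l k) : tL (Z1 g) = 0 := by
  unfold Z1; rw [map_sum]; simp only [map_add, map_smul, tL_eX, tL_eY]; simp
@[simp] theorem reL_Z2 (a) (q : Ix k) (g : Heis l k) : reL q (Z2 a g) = imL q g := by
  unfold Z2; rw [map_add, map_sum]; simp only [map_sub, map_smul, reL_eX, reL_eY, reL_eT]; simp
@[simp] theorem imL_Z2 (a) (q : Ix k) (g : Heis l k) : imL q (Z2 a g) = - reL q g := by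
  unfold Z2; rw [map_add, map_sum]; simp only [map_sub, map_smul, imL_eX, imL_eY, imL_eT]; simp
@[simp] theorem tL_Z2 (a) (g : Heis l k) : tL (Z2 a g) = 2 * ar a g := by
  unfold Z2; rw [map_add, map_sum]; simp only [map_sub, map_smul, tL_eX, tL_eY, tL_eT]; simp

theorem dnq_Z1 (p : Ix k) (g : Heis l k) : dnq p g (Z1 g) = 2 * nq p g := by
  unfold dnq nq
  simp only [ContinuousLinearMap.add_apply, ContinuousLinearMap.smul_apply, reL_Z1, imL_Z1, smul_eq_mul]; ring
theorem dnq_Z2 (a) (p : Ix k) (g : Heis l k) : dnq p g (Z2 a g) = 0 := by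
  unfold dnq
  simp only [ContinuousLinearMap.add_apply, ContinuousLinearMap.smul_apply, reL_Z2, imL_Z2, smul_eq_mul]; ring

theorem dPhi_Z1 (a : Fin (l + 1) → ℝ) (g : Heis l k) :
    dPhi a g (Z1 g) = -(1 / 2) * ∑ p : Ix k, Ng a p g * nq p g := by
  unfold dPhi
  simp only [ContinuousLinearMap.sub_apply, ContinuousLinearMap.sum_apply, ContinuousLinearMap.smul_apply,
    dnq_Z1, tL_Z1, smul_eq_mul, mul_zero, sub_zero, Finset.mul_sum]
  exact Finset.sum_congr rfl fun p _ => by ring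
theorem dPhi_Z2 (a : Fin (l + 1) → ℝ) (g : Heis l k) :
    dPhi a g (Z2 a g) = -(1 / 2) * (Dg a g * ar a g) := by
  unfold dPhi
  simp only [ContinuousLinearMap.sub_apply, ContinuousLinearMap.sum_apply, ContinuousLinearMap.smul_apply,
    dnq_Z2, tL_Z2, smul_eq_mul, mul_zero, Finset.sum_const_zero]
  ring

theorem continuous_rr : Continuous (rr : Heis l k → ℝ) := continuous_finsetSum _ fun p _ => continuous_nq p
theorem continuous_ar (a : Fin (l + 1) → ℝ) : Continuous (ar a : Heis l k → ℝ) :=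
  continuous_finsetSum _ fun p _ => (continuous_nq p).const_mul _
theorem continuous_Z1 : Continuous (Z1 : Heis l k → Heis l k) := by unfold Z1; fun_prop
theorem continuous_Z2 (a : Fin (l + 1) → ℝ) : Continuous (Z2 a : Heis l k → Heis l k) := by
  unfold Z2; have := continuous_ar (k := k) a; fun_prop

theorem rr_nonneg (g : Heis l k) : 0 ≤ rr g := Finset.sum_nonneg fun p _ => nq_nonneg p g
theorem nq_le_rr (p : Ix k) (g : Heis l k) : nq p g ≤ rr g :=
  Finset.single_le_sum (f := fun p => nq p g) (fun p _ => nq_nonneg p g) (Finset.mem_univ p)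

/-! ### a smooth cutoff -/

def bmp : ContDiffBump (0 : ℝ) := ⟨1 / 2, 1, by norm_num, by norm_num⟩
def chi (u : ℝ) : ℝ := bmp u

theorem contDiff_chi : ContDiff ℝ 1 chi := bmp.contDiff
theorem chi_nonneg (u : ℝ) : 0 ≤ chi u := bmp.nonneg
theorem chi_le_one (u : ℝ) : chi u ≤ 1 := bmp.le_one
theorem chi_one {u : ℝ} (h : |u| ≤ 1 / 2) : chi u = 1 :=
  bmp.one_of_mem_closedBall (by simpa [bmp] using h)
theorem chi_zero {u : ℝ} (h : 1 ≤ |u|) : chi u = 0 :=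
  bmp.zero_of_le_dist (by simpa [bmp] using h)
theorem hasDerivAt_chi (u : ℝ) : HasDerivAt chi (deriv chi u) u :=
  (contDiff_chi.differentiable (by norm_num) u).hasDerivAt
theorem dchi_zero {u : ℝ} (h : 1 ≤ |u|) : deriv chi u = 0 :=
  IsLocalMin.deriv_eq_zero (Eventually.of_forall fun v => by rw [chi_zero h]; exact chi_nonneg v)
theorem dchi_zero' {u : ℝ} (h : |u| ≤ 1 / 2) : deriv chi u = 0 :=
  IsLocalMax.deriv_eq_zero (Eventually.of_forall fun v => by rw [chi_one h]; exact chi_le_one v)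
theorem continuous_dchi : Continuous (deriv chi) := contDiff_chi.continuous_deriv (by norm_num)

theorem exists_dchi_bd : ∃ C : ℝ, 0 ≤ C ∧ ∀ u, |deriv chi u| ≤ C := by
  obtain ⟨C, hC⟩ := (isCompact_Icc (a := (-1 : ℝ)) (b := 1)).bddAbove_image continuous_dchi.abs.continuousOn
  refine ⟨max C 0, le_max_right _ _, fun u => ?_⟩
  by_cases h : |u| ≤ 1
  · exact (hC (Set.mem_image_of_mem _ (abs_le.mp h))).trans (le_max_left _ _)
  · rw [dchi_zero (not_le.mp h).le]; simp

def C1 : ℝ := exists_dchi_bd.choose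
theorem C1_nonneg : 0 ≤ C1 := exists_dchi_bd.choose_spec.1
theorem dchi_bd (u : ℝ) : |deriv chi u| ≤ C1 := exists_dchi_bd.choose_spec.2 u
theorem dchi_mul_bd (u : ℝ) : |deriv chi u * u| ≤ C1 := by
  by_cases h : |u| ≤ 1
  · rw [abs_mul]
    have := dchi_bd u
    have := abs_nonneg (deriv chi u)
    nlinarith
  · rw [dchi_zero (not_le.mp h).le]; simpa using C1_nonneg

/-! ### the coefficients -/

def qq (g : Heis l k) : ℝ := 1 + rr g
theorem qq_ge (g : Heis l k) : 1 ≤ qq g := by unfold qq; linarith [rr_nonneg g]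
theorem qq_pos (g : Heis l k) : 0 < qq g := lt_of_lt_of_le one_pos (qq_ge g)
def dqq (g : Heis l k) : Heis l k →L[ℝ] ℝ := ∑ p : Ix k, dnq p g
theorem hasFDerivAt_qq (g : Heis l k) : HasFDerivAt qq (dqq g) g := by
  unfold qq rr dqq
  exact (HasFDerivAt.fun_sum fun p _ => hasFDerivAt_nq p g).const_add 1
theorem continuous_qq : Continuous (qq : Heis l k → ℝ) := continuous_rr.const_add 1
theorem continuous_dqq : Continuous (dqq : Heis l k → _) := continuous_finsetSum _ fun p _ => continuous_dnq p
theorem contDiff_qq : ContDiff ℝ 1 (qq : Heis l k → ℝ) :=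
  contDiff_one_iff_hasFDerivAt.mpr ⟨dqq, continuous_dqq, hasFDerivAt_qq⟩
theorem dqq_Z1 (g : Heis l k) : dqq g (Z1 g) = 2 * rr g := by
  unfold dqq rr; rw [ContinuousLinearMap.sum_apply, Finset.mul_sum]
  exact Finset.sum_congr rfl fun p _ => dnq_Z1 p g
theorem dqq_Z2 (a) (g : Heis l k) : dqq g (Z2 a g) = 0 := by
  unfold dqq; rw [ContinuousLinearMap.sum_apply]
  exact Finset.sum_eq_zero fun p _ => dnq_Z2 a p g

def iq (g : Heis l k) : ℝ := (Real.sqrt (qq g))⁻¹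
theorem contDiff_iq : ContDiff ℝ 1 (iq : Heis l k → ℝ) :=
  (contDiff_qq.sqrt fun g => (qq_pos g).ne').inv fun g => (Real.sqrt_pos.mpr (qq_pos g)).ne'
theorem contDiff_tau : ContDiff ℝ 1 (fun g : Heis l k => tL g / qq g) :=
  (tL.contDiff).div contDiff_qq fun g => (qq_pos g).ne'

def al (δ : ℝ) (g : Heis l k) : ℝ := chi (tL g / qq g / δ) * iq g - (qq g ^ 2)⁻¹
def be (M : ℝ) (g : Heis l k) : ℝ := M * (tL g / Real.sqrt (qq g ^ 2 + tL g ^ 2)) * iq g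

theorem contDiff_al (δ : ℝ) : ContDiff ℝ 1 (al δ : Heis l k → ℝ) := by
  unfold al
  refine ((contDiff_chi.comp (contDiff_tau.div_const δ)).mul contDiff_iq).sub ?_
  exact (contDiff_qq.pow 2).inv fun g => (pow_pos (qq_pos g) 2).ne'
theorem den_pos (g : Heis l k) : 0 < qq g ^ 2 + tL g ^ 2 := by have := qq_pos g; positivity
theorem contDiff_be (M : ℝ) : ContDiff ℝ 1 (be M : Heis l k → ℝ) := by
  unfold be
  refine (contDiff_const.mul (tL.contDiff.div ?_ fun g => (Real.sqrt_pos.mpr (den_pos g)).ne')).mul contDiff_iq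
  exact ((contDiff_qq.pow 2).add (tL.contDiff.pow 2)).sqrt fun g => (den_pos g).ne'

theorem fderiv_al_Z1 (δ : ℝ) (g : Heis l k) : fderiv ℝ (al δ) g (Z1 g) =
    -(deriv chi (tL g / qq g / δ) * (tL g / qq g / δ)) * (2 * rr g / qq g) * iq g
      - chi (tL g / qq g / δ) * (rr g / qq g * iq g) + 4 * rr g / qq g ^ 3 := by
  have hq := qq_pos g
  have h0 := hasFDerivAt_qq g
  have h1 : HasFDerivAt (fun g : Heis l k => tL g / qq g / δ)
      ((1 / qq g / δ) • tL - (tL g / qq g ^ 2 / δ) • dqq g) g := by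
    have h2 := (((hasDerivAt_inv hq.ne').comp_hasFDerivAt g h0).const_mul δ⁻¹)
    have h3 := (tL.hasFDerivAt (x := g)).fun_mul h2
    have e : (fun g : Heis l k => tL g / qq g / δ) = fun g => tL g * (δ⁻¹ * (Inv.inv ∘ qq) g) := by
      ext g; simp only [Function.comp]; ring
    rw [e]
    refine h3.congr_fderiv (ContinuousLinearMap.ext fun w => ?_)
    simp only [ContinuousLinearMap.sub_apply, ContinuousLinearMap.add_apply, ContinuousLinearMap.smul_apply, smul_eq_mul,
      Function.comp]
    ring
  have h4 := (hasDerivAt_chi (tL g / qq g / δ)).comp_hasFDerivAt g h1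
  have h5 : HasFDerivAt (iq : Heis l k → ℝ) ((-(iq g / (2 * qq g))) • dqq g) g := by
    have hs : Real.sqrt (qq g) ≠ 0 := (Real.sqrt_pos.mpr hq).ne'
    have h6 := (hasDerivAt_inv hs).comp_hasFDerivAt g (h0.sqrt hq.ne')
    refine h6.congr_fderiv (ContinuousLinearMap.ext fun w => ?_)
    simp only [ContinuousLinearMap.smul_apply, smul_eq_mul, iq]
    rw [Real.sq_sqrt hq.le]
    field_simp
  have h7 : HasFDerivAt (fun g : Heis l k => (qq g ^ 2)⁻¹) ((-2 / qq g ^ 3) • dqq g) g := by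
    have h8 := (hasDerivAt_inv (pow_pos hq 2).ne').comp_hasFDerivAt g (h0.pow 2)
    refine h8.congr_fderiv (ContinuousLinearMap.ext fun w => ?_)
    simp only [ContinuousLinearMap.smul_apply, smul_eq_mul, nsmul_eq_mul]
    field_simp; norm_num; ring
  have h9 := ((h4.fun_mul h5).fun_sub h7).fderiv
  have e2 : (fun y : Heis l k => (chi ∘ fun g => tL g / qq g / δ) y * iq y - (qq y ^ 2)⁻¹) = al δ := rfl
  rw [e2] at h9
  rw [h9]
  simp only [ContinuousLinearMap.sub_apply, ContinuousLinearMap.add_apply, ContinuousLinearMap.smul_apply, smul_eq_mul,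
      Function.comp, dqq_Z1, tL_Z1]
  field_simp; ring

theorem fderiv_be_Z2 (M : ℝ) (a) (g : Heis l k) : fderiv ℝ (be M) g (Z2 a g) =
    M * (qq g ^ 2 / ((qq g ^ 2 + tL g ^ 2) * Real.sqrt (qq g ^ 2 + tL g ^ 2))) * iq g * (2 * ar a g) := by
  have hq := qq_pos g
  have hd := den_pos g
  have hs : 0 < Real.sqrt (qq g ^ 2 + tL g ^ 2) := Real.sqrt_pos.mpr hd
  have h0 := hasFDerivAt_qq g
  have hiq : HasFDerivAt (iq : Heis l k → ℝ) ((-(iq g / (2 * qq g))) • dqq g) g := by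
    have hs : Real.sqrt (qq g) ≠ 0 := (Real.sqrt_pos.mpr hq).ne'
    have h6 := (hasDerivAt_inv hs).comp_hasFDerivAt g (h0.sqrt hq.ne')
    refine h6.congr_fderiv (ContinuousLinearMap.ext fun w => ?_)
    simp only [ContinuousLinearMap.smul_apply, smul_eq_mul, iq]
    rw [Real.sq_sqrt hq.le]
    field_simp
  have h1 := ((h0.pow 2).fun_add ((tL.hasFDerivAt (x := g)).pow 2)).sqrt hd.ne'
  have h2 := (hasDerivAt_inv hs.ne').comp_hasFDerivAt g h1
  have h3 := (((tL.hasFDerivAt (x := g)).fun_mul h2).const_mul M).fun_mul hiq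
  have e2 : (fun y : Heis l k => M * (tL y * (Inv.inv ∘ fun y => √(qq y ^ 2 + tL y ^ 2)) y) * iq y) = be M := by
    ext y; simp only [Function.comp, be]; rw [div_eq_mul_inv]
  rw [e2] at h3
  rw [h3.fderiv]
  simp only [ContinuousLinearMap.sub_apply, ContinuousLinearMap.add_apply, ContinuousLinearMap.smul_apply, smul_eq_mul,
      Function.comp, dqq_Z2, tL_Z2, nsmul_eq_mul]
  have hss := Real.sq_sqrt hd.le
  obtain ⟨S, hS⟩ : ∃ S, S = √(qq g ^ 2 + tL g ^ 2) := ⟨_, rfl⟩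
  rw [← hS] at hss hs ⊢
  rw [← hss]
  have : qq g ^ 2 = S ^ 2 - tL g ^ 2 := by rw [hss]; ring
  rw [this]
  field_simp; ring

end Cheeger

namespace Cheeger

variable {l k}

theorem iq_pos (g : Heis l k) : 0 < iq g := inv_pos.mpr (Real.sqrt_pos.mpr (qq_pos g))
theorem iq_sq (g : Heis l k) : qq g * iq g ^ 2 = 1 := by
  unfold iq; rw [inv_pow, Real.sq_sqrt (qq_pos g).le, mul_inv_cancel₀ (qq_pos g).ne']
theorem iq_le (g : Heis l k) : iq g ≤ 1 := by
  have := iq_sq g; have := iq_pos g; have := qq_ge g; nlinarith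

/-- the Lyapunov function -/
def Ly (a : Fin (l + 1) → ℝ) (δ M : ℝ) (g : Heis l k) : ℝ :=
  -Phi a g * (2 * (Fintype.card (Ix k) : ℝ) * al δ g + fderiv ℝ (al δ) g (Z1 g) + fderiv ℝ (be M) g (Z2 a g))
    - al δ g * dPhi a g (Z1 g) - be M g * dPhi a g (Z2 a g)

theorem continuous_Ly {a : Fin (l + 1) → ℝ} (h : Hy k a) (δ M : ℝ) : Continuous (Ly (k := k) a δ M) := by
  unfold Ly
  have h1 := continuous_Phi h
  have h2 := (contDiff_al (k := k) δ).continuous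
  have h3 := ((contDiff_al (k := k) δ).continuous_fderiv (by norm_num)).clm_apply continuous_Z1
  have h4 := ((contDiff_be (k := k) M).continuous_fderiv (by norm_num)).clm_apply (continuous_Z2 a)
  have h5 := (contDiff_be (k := k) M).continuous
  have h6 := (continuous_dPhi h).clm_apply continuous_Z1
  have h7 := (continuous_dPhi h).clm_apply (continuous_Z2 a)
  exact ((h1.neg.mul (((continuous_const.mul h2).add h3).add h4)).sub (h2.mul h6)).sub (h5.mul h7)

theorem caseI {n r i x dd B S W M c1 : ℝ} (hn : 0 ≤ n) (hr : 0 ≤ r) (hi : 0 < i) (hi1 : i ≤ 1)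
    (hq : (1 + r) * i ^ 2 = 1) (hx : x = 1) (hdd : |dd| ≤ c1) (hM : 0 ≤ M) (hB : B ≤ 2 * M)
    (hS : r / 2 ≤ S) (hS2 : S ≤ 35 * r) (hW : 0 ≤ W)
    (hbig : 64 * (2 * n + 2 * c1 + 2 * M + 23) ^ 2 ≤ r) :
    1 / 2 ≤ -(2 * n * (x * i - i ^ 4)) + dd * (2 * r * i ^ 3) + x * (r * i ^ 3) - 4 * (r * i ^ 6) - B
      + 1 / 2 * (x * i - i ^ 4) * S + 1 / 2 * W := by
  subst hx
  have hri : r * i ^ 2 ≤ 1 := by nlinarith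
  have hc1 : 0 ≤ c1 := (abs_nonneg _).trans hdd
  have h0 : 0 ≤ r * i ^ 2 := by positivity
  have h3 : r * i ^ 3 ≤ 1 := by nlinarith
  have h30 : 0 ≤ r * i ^ 3 := by positivity
  have h4 : r * i ^ 4 ≤ 1 := by nlinarith
  have h6 : r * i ^ 6 ≤ 1 := by
    have : i ^ 4 ≤ 1 := pow_le_one₀ hi.le hi1
    nlinarith
  have hni : n * i ≤ n := by nlinarith
  have hni4 : 0 ≤ n * i ^ 4 := by positivity
  have hd : -c1 ≤ dd * (r * i ^ 3) := by
    have := (abs_le.mp hdd).1; nlinarith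
  have hS3 : i ^ 4 * S ≤ 35 := by
    have : i ^ 4 * S ≤ i ^ 4 * (35 * r) := mul_le_mul_of_nonneg_left hS2 (by positivity)
    nlinarith
  have hS4 : r * i / 2 ≤ i * S := by nlinarith
  have hmain : 4 * (2 * n + 2 * c1 + 2 * M + 23) ≤ r * i := by
    set K := 2 * n + 2 * c1 + 2 * M + 23 with hK
    have hK0 : 23 ≤ K := by rw [hK]; linarith
    have hr1 : 1 ≤ r := by nlinarith
    have h5 : (8 * K) ^ 2 ≤ ((1 + r) * i) ^ 2 := by
      have : ((1 + r) * i) ^ 2 = 1 + r := by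
        calc ((1 + r) * i) ^ 2 = (1 + r) * ((1 + r) * i ^ 2) := by ring
          _ = 1 + r := by rw [hq]; ring
      rw [this]; nlinarith
    have h6 : 8 * K ≤ (1 + r) * i := by
      refine le_of_sq_le_sq ?_ (by positivity)
      exact h5
    nlinarith
  nlinarith

theorem caseII {n r i x dd B S W M c1 E T : ℝ} (hn : 1 ≤ n) (hr : 0 ≤ r) (hi : 0 < i) (hi1 : i ≤ 1)
    (hq : (1 + r) * i ^ 2 = 1) (hx0 : 0 ≤ x) (hx1 : x ≤ 1) (hx : x = 0 ∨ 1 ≤ r) (hdd : |dd| ≤ c1)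
    (hB : B ≤ M * (r * i) / T)
    (hS : 0 ≤ x * S) (hS2 : S ≤ 35 * r) (hW : 2 * E * M * (r * i) ≤ W)
    (hbig : M / T + 2 * n + 2 * c1 + 23 ≤ E * M) :
    1 / 2 ≤ -(2 * n * (x * i - i ^ 4)) + dd * (2 * r * i ^ 3) + x * (r * i ^ 3) - 4 * (r * i ^ 6) - B
      + 1 / 2 * (x * i - i ^ 4) * S + 1 / 2 * W := by
  have hri : 0 ≤ r * i := by positivity
  have hc1 : 0 ≤ c1 := (abs_nonneg _).trans hdd
  have hp : ∀ m : ℕ, i ^ m ≤ 1 := fun m => pow_le_one₀ hi.le hi1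
  have h3 : r * i ^ 3 ≤ r * i := by
    have := hp 2
    calc r * i ^ 3 = r * i * i ^ 2 := by ring
      _ ≤ r * i := by nlinarith
  have h30 : 0 ≤ r * i ^ 3 := by positivity
  have h4 : r * i ^ 4 ≤ r * i := by
    have := hp 3
    calc r * i ^ 4 = r * i * i ^ 3 := by ring
      _ ≤ r * i := by nlinarith
  have h6 : r * i ^ 6 ≤ r * i := by
    have := hp 5
    calc r * i ^ 6 = r * i * i ^ 5 := by ring
      _ ≤ r * i := by nlinarith
  have hxi : n * (x * i) ≤ n * (r * i) := by
    rcases hx with hx | hx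
    · rw [hx]; simp; positivity
    · have : x * i ≤ r * i := by nlinarith
      nlinarith
  have hd : -c1 * (r * i) ≤ dd * (r * i ^ 3) := by
    have := (abs_le.mp hdd).1
    have h7 : -c1 * (r * i) ≤ -c1 * (r * i ^ 3) := by nlinarith
    nlinarith
  have hS3 : i ^ 4 * S ≤ 35 * (r * i) := by
    have : i ^ 4 * S ≤ i ^ 4 * (35 * r) := mul_le_mul_of_nonneg_left hS2 (by positivity)
    nlinarith
  have hS4 : 0 ≤ x * i * S := by nlinarith
  have hx3 : 0 ≤ x * (r * i ^ 3) := by positivity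
  have hfin : 1 / 2 ≤ 2 * n * i ^ 4 + r * i := by
    by_cases h1 : r ≤ 1
    · have : 1 / 2 ≤ i ^ 2 := by nlinarith [sq_nonneg i]
      have : 1 / 4 ≤ i ^ 4 := by nlinarith
      nlinarith
    · have h2 : 1 ≤ (1 + r) * i := by nlinarith
      have h5 : i ≤ r * i := by nlinarith
      have h7 : 0 ≤ 2 * n * i ^ 4 := by positivity
      nlinarith
  have hB2 : B ≤ (M / T) * (r * i) := by
    refine hB.trans (le_of_eq ?_); ring
  have hkey := mul_le_mul_of_nonneg_right hbig hri
  nlinarith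

theorem exists_amin {a : Fin (l + 1) → ℝ} (h : Hy k a) : ∃ m : ℝ, 0 < m ∧ m ≤ 1 ∧ ∀ i, m ≤ a i := by
  obtain ⟨i, _, hi⟩ := Finset.exists_min_image (univ : Finset (Fin (l + 1))) a ⟨0, Finset.mem_univ _⟩
  exact ⟨a i, h.a0 i, h.a1 i, fun j => hi j (Finset.mem_univ j)⟩

theorem sum_rho (g : Heis l k) : ∑ p : Ix k, rho g p = rr g / 4 := by
  unfold rho rr; rw [Finset.sum_div]

theorem ar_le {a : Fin (l + 1) → ℝ} (h : Hy k a) (g : Heis l k) : ar a g ≤ rr g :=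
  Finset.sum_le_sum fun p _ => by
    have := nq_nonneg p g; have := h.a1 p.1; unfold bI; nlinarith

theorem ar_ge {a : Fin (l + 1) → ℝ} {m : ℝ} (hm : ∀ i, m ≤ a i) (g : Heis l k) : m * rr g ≤ ar a g := by
  unfold ar rr; rw [Finset.mul_sum]
  exact Finset.sum_le_sum fun p _ => by
    have := nq_nonneg p g; have := hm p.1; unfold bI; nlinarith

/-- rewriting of the Lyapunov function -/
theorem Ly_eq {a : Fin (l + 1) → ℝ} (h : Hy k a) (δ M : ℝ) (g : Heis l k) :
    Ly a δ M g = Phi a g * (-(2 * (Fintype.card (Ix k) : ℝ) * (chi (tL g / qq g / δ) * iq g - iq g ^ 4))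
      + (deriv chi (tL g / qq g / δ) * (tL g / qq g / δ)) * (2 * rr g * iq g ^ 3)
      + chi (tL g / qq g / δ) * (rr g * iq g ^ 3) - 4 * (rr g * iq g ^ 6) - fderiv ℝ (be M) g (Z2 a g)
      + 1 / 2 * (chi (tL g / qq g / δ) * iq g - iq g ^ 4) * ((∑ p : Ix k, Ng a p g * nq p g) / Phi a g)
      + 1 / 2 * (be M g * (Dg a g * ar a g) / Phi a g)) := by
  have hΦ := (Phi_pos h g).ne'
  have e : (qq g)⁻¹ = iq g ^ 2 := by
    have := iq_sq g
    rw [inv_eq_iff_eq_inv, eq_comm, inv_eq_iff_eq_inv]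
    have hq := (qq_pos g).ne'
    field_simp; linarith
  have e2 : al δ g = chi (tL g / qq g / δ) * iq g - iq g ^ 4 := by
    unfold al; rw [← inv_pow, e]; ring
  unfold Ly
  rw [dPhi_Z1, dPhi_Z2, fderiv_al_Z1, e2]
  have e3 : 4 * rr g / qq g ^ 3 = 4 * (rr g * iq g ^ 6) := by
    rw [div_eq_mul_inv, ← inv_pow, e]; ring
  have e4 : 2 * rr g / qq g = 2 * rr g * iq g ^ 2 := by rw [div_eq_mul_inv, e]
  have e5 : rr g / qq g = rr g * iq g ^ 2 := by rw [div_eq_mul_inv, e]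
  rw [e3, e4, e5]
  field_simp
  ring

theorem be_bound1 {a : Fin (l + 1) → ℝ} (h : Hy k a) {M : ℝ} (hM : 0 ≤ M) (g : Heis l k) :
    fderiv ℝ (be M) g (Z2 a g) ≤ M * (rr g * iq g) * (2 / qq g) ∧
    ∀ T > 0, T ≤ |tL g| → fderiv ℝ (be M) g (Z2 a g) ≤ M * (rr g * iq g) / T := by
  rw [fderiv_be_Z2]
  have hq := qq_pos g
  have hi := iq_pos g
  have hr := rr_nonneg g
  have hd := den_pos g
  have hs : qq g ≤ √(qq g ^ 2 + tL g ^ 2) := Real.le_sqrt_of_sq_le (by nlinarith [sq_nonneg (tL g)])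
  have hs0 := hq.trans_le hs
  have har := ar_le h g
  have b0 : qq g ^ 2 / ((qq g ^ 2 + tL g ^ 2) * √(qq g ^ 2 + tL g ^ 2)) ≤ qq g / (qq g ^ 2 + tL g ^ 2) := by
    rw [div_le_div_iff₀ (by positivity) hd]
    have : qq g ^ 2 * (qq g ^ 2 + tL g ^ 2) ≤ qq g * √(qq g ^ 2 + tL g ^ 2) * (qq g ^ 2 + tL g ^ 2) := by
      have h1 : qq g ^ 2 ≤ qq g * √(qq g ^ 2 + tL g ^ 2) := by nlinarith
      exact mul_le_mul_of_nonneg_right h1 hd.le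
    linarith
  have hMain : ∀ c, qq g / (qq g ^ 2 + tL g ^ 2) ≤ c →
      M * (qq g ^ 2 / ((qq g ^ 2 + tL g ^ 2) * √(qq g ^ 2 + tL g ^ 2))) * iq g * (2 * ar a g) ≤
        M * (rr g * iq g) * (2 * c) := by
    intro c hc
    have hc0 : 0 ≤ c := le_trans (by positivity) hc
    calc _ ≤ M * c * iq g * (2 * rr g) := by
          have har0 : 0 ≤ ar a g := Finset.sum_nonneg fun p _ => mul_nonneg (h.a0 _).le (nq_nonneg p g)
          have := b0.trans hc
          gcongr
      _ = _ := by ring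
  constructor
  · refine (hMain (1 / qq g) ?_).trans (le_of_eq (by ring))
    rw [div_le_div_iff₀ hd hq]; nlinarith [sq_nonneg (tL g)]
  · intro T hT ht
    refine (hMain (1 / (2 * T)) ?_).trans (le_of_eq (by field_simp))
    rw [div_le_div_iff₀ hd (by positivity)]
    have : 2 * qq g * |tL g| ≤ qq g ^ 2 + |tL g| ^ 2 := by nlinarith [sq_nonneg (qq g - |tL g|)]
    rw [sq_abs] at this
    nlinarith

end Cheeger

namespace Cheeger

variable {l k}

theorem card_pos (h : Hy k a) : 1 ≤ (Fintype.card (Ix k) : ℝ) := by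
  have : 0 < Fintype.card (Ix k) := Fintype.card_pos_iff.mpr ⟨h.i0⟩
  exact_mod_cast this

theorem norm_le_of {g : Heis l k} {R T : ℝ} (h1 : rr g ≤ R) (h2 : |tL g| ≤ T) : ‖g‖ ≤ 1 + R + T := by
  have hR : 0 ≤ R := (rr_nonneg g).trans h1
  have hT : 0 ≤ T := (abs_nonneg _).trans h2
  rw [Prod.norm_def]
  refine max_le ((pi_norm_le_iff_of_nonneg (by linarith)).mpr fun i =>
    (pi_norm_le_iff_of_nonneg (by linarith)).mpr fun j => ?_) ?_
  · have h3 := (nq_le_rr ⟨i, j⟩ g).trans h1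
    rw [nq_normSq, Complex.normSq_eq_norm_sq] at h3
    nlinarith [sq_nonneg (‖g.1 i j‖ - 1)]
  · have : ‖g.2‖ ≤ T := h2
    linarith

set_option maxHeartbeats 2000000 in
theorem lyap {a : Fin (l + 1) → ℝ} (h : Hy k a) : ∃ δ M R C : ℝ, 0 < δ ∧ 0 < M ∧ 0 < R ∧ 0 < C ∧
    ∀ g : Heis l k, 1 / 2 * Phi a g ≤ Ly a δ M g + C * (Metric.closedBall (0 : Heis l k) R).indicator 1 g := by
  classical
  obtain ⟨m, hm0, hm1, hm⟩ := exists_amin h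
  have hn := card_pos a h
  obtain ⟨n, hnn⟩ : ∃ n : ℝ, n = (Fintype.card (Ix k) : ℝ) := ⟨_, rfl⟩
  rw [← hnn] at hn
  have hc1 := C1_nonneg
  obtain ⟨κ, hκ⟩ : ∃ κ : ℝ, κ = m ^ 2 / Real.pi ^ 2 := ⟨_, rfl⟩
  have hπ := Real.pi_gt_three
  have hκ0 : 0 < κ := by rw [hκ]; positivity
  have hκ1 : κ ≤ 1 := by
    rw [hκ, div_le_one (by positivity)]; nlinarith
  have hκb : ∀ p : Ix k, κ ≤ bI a p ^ 2 / Real.pi ^ 2 := by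
    intro p; rw [hκ]
    have := hm p.1
    unfold bI; gcongr
  obtain ⟨δ, hδ⟩ : ∃ δ : ℝ, δ = κ / 4 := ⟨_, rfl⟩
  have hδ0 : 0 < δ := by rw [hδ]; positivity
  have hδ1 : δ ≤ 1 := by rw [hδ]; linarith
  obtain ⟨ε, hε⟩ : ∃ ε : ℝ, ε = δ / (200 * n) := ⟨_, rfl⟩
  have hε0 : 0 < ε := by rw [hε]; positivity
  have hε1 : ε ≤ 1 := by
    rw [hε, div_le_one (by positivity)]; linarith
  -- the constants
  obtain ⟨E, hE⟩ : ∃ E : ℝ, E = δ * ε * m / 8 := ⟨_, rfl⟩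
  have hE0 : 0 < E := by rw [hE]; positivity
  obtain ⟨M, hM⟩ : ∃ M : ℝ, M = 2 * (2 * n + 2 * C1 + 23) / E := ⟨_, rfl⟩
  have hM0 : 0 < M := by rw [hM]; positivity
  obtain ⟨T, hT⟩ : ∃ T : ℝ, T = 2 / E + 8 / ε + (2 + 33 / κ) := ⟨_, rfl⟩
  have hT0 : 0 < T := by rw [hT]; positivity
  have hTE : M / T + 2 * n + 2 * C1 + 23 ≤ E * M := by
    have h1 : M / T ≤ E * M / 2 := by
      rw [div_le_iff₀ hT0]
      have : 2 / E ≤ T := by rw [hT]; have : 0 < 8 / ε := by positivity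
                             have : 0 < 33 / κ := by positivity
                             linarith
      have h2 : 2 ≤ T * E := by rwa [div_le_iff₀ hE0] at this
      nlinarith
    have h3 : E * M = 2 * (2 * n + 2 * C1 + 23) := by rw [hM]; field_simp
    linarith
  have hTε : 8 / ε ≤ T := by
    rw [hT]
    have : 0 < 2 / E := by positivity
    have : 0 < 33 / κ := by positivity
    linarith
  have hTκ : 2 + 33 / κ ≤ T := by
    rw [hT]
    have : 0 < 2 / E := by positivity
    have : 0 < 8 / ε := by positivity
    linarith
  obtain ⟨R1, hR1⟩ : ∃ R1 : ℝ, R1 = 64 * (2 * n + 2 * C1 + 2 * M + 23) ^ 2 + (1 + 33 / κ) := ⟨_, rfl⟩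
  have hR10 : 0 < R1 := by rw [hR1]; positivity
  have hNlow : ∀ g : Heis l k, 1 + 33 / κ ≤ rr g → |tL g| ≤ δ * qq g →
      1 / 2 * rr g * Phi a g ≤ ∑ p : Ix k, Ng a p g * nq p g := by
    intro g h1 h2
    have h3 : ∀ p, 1 / 2 * Phi a g ≤ Ng a p g := by
      intro p
      refine Nl_lower (h.dat g) hκb p (g.2 / 4) ?_
      rw [sum_rho]
      have h4 : |g.2 / 4| = |tL g| / 4 := by rw [abs_div]; norm_num
      rw [h4]
      have h5 : κ + 33 ≤ κ * rr g := by
        have := mul_le_mul_of_nonneg_left h1 hκ0.le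
        have e : κ * (1 + 33 / κ) = κ + 33 := by field_simp
        linarith
      have h6 : qq g = 1 + rr g := rfl
      rw [hδ, h6] at h2
      nlinarith
    calc 1 / 2 * rr g * Phi a g = ∑ p : Ix k, 1 / 2 * Phi a g * nq p g := by
          rw [← Finset.mul_sum]; unfold rr; ring
      _ ≤ _ := Finset.sum_le_sum fun p _ => mul_le_mul_of_nonneg_right (h3 p) (nq_nonneg p g)
  have hNup : ∀ g : Heis l k, (∑ p : Ix k, Ng a p g * nq p g) / Phi a g ≤ 35 * rr g := by
    intro g
    rw [div_le_iff₀ (Phi_pos h g)]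
    calc _ ≤ ∑ p : Ix k, 35 * Phi a g * nq p g :=
          Finset.sum_le_sum fun p _ => mul_le_mul_of_nonneg_right (Nl_upper (h.dat g) p _) (nq_nonneg p g)
      _ = _ := by rw [← Finset.mul_sum]; unfold rr; ring
  have hsgn : ∀ g : Heis l k, 0 ≤ tL g * Dg a g := by
    intro g
    have := Dl_sign (h.dat g) (g.2 / 4)
    have e : g.2 / 4 * Dl (bI a) (rho g) (g.2 / 4) = tL g * Dg a g / 4 := by unfold Dg; rw [tL_apply]; ring
    rw [e] at this; linarith
  have hWeq : ∀ g : Heis l k, be M g * (Dg a g * ar a g) / Phi a g =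
      M * iq g * ar a g / √(qq g ^ 2 + tL g ^ 2) * (tL g * Dg a g) / Phi a g := by
    intro g; unfold be; ring
  have har0 : ∀ g : Heis l k, 0 ≤ ar a g := fun g =>
    Finset.sum_nonneg fun p _ => mul_nonneg (h.a0 _).le (nq_nonneg p g)
  -- first region
  have case1 : ∀ g : Heis l k, |tL g| ≤ δ / 2 * qq g → R1 ≤ rr g → 1 / 2 * Phi a g ≤ Ly a δ M g := by
    intro g ht hr
    have hΦ := Phi_pos h g
    have hq := qq_pos g
    rw [Ly_eq h, ← hnn, mul_comm]
    refine mul_le_mul_of_nonneg_left ?_ hΦ.le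
    have h64 : 64 * (2 * n + 2 * C1 + 2 * M + 23) ^ 2 ≤ rr g := by
      have : 0 < 33 / κ := by positivity
      linarith
    have hrk : 1 + 33 / κ ≤ rr g := by
      have : 0 ≤ 64 * (2 * n + 2 * C1 + 2 * M + 23) ^ 2 := by positivity
      linarith
    refine caseI (by linarith) (rr_nonneg g) (iq_pos g) (iq_le g) (iq_sq g) (chi_one ?_) (dchi_mul_bd _) hM0.le ?_
      ?_ (hNup g) ?_ h64
    · rw [abs_div, abs_div, abs_of_pos hδ0, abs_of_pos hq, div_le_iff₀ hδ0, div_le_iff₀ hq]; linarith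
    · refine (be_bound1 h hM0.le g).1.trans ?_
      have h1 : rr g / qq g ≤ 1 := by rw [div_le_one hq]; unfold qq; linarith
      have h2 := iq_le g
      have h3 := iq_pos g
      have h4 : 0 ≤ rr g / qq g := div_nonneg (rr_nonneg g) hq.le
      have e : M * (rr g * iq g) * (2 / qq g) = 2 * M * (rr g / qq g * iq g) := by ring
      rw [e]
      have : rr g / qq g * iq g ≤ 1 := mul_le_one₀ h1 h3.le h2
      exact mul_le_of_le_one_right (by positivity) this
    · rw [le_div_iff₀ hΦ]
      have hdq : 0 < δ / 2 * qq g := by positivity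
      have := hNlow g hrk (by linarith)
      linarith
    · rw [hWeq]
      have := hsgn g; have := har0 g; have := iq_pos g
      positivity
  -- second region
  have case2 : ∀ g : Heis l k, δ / 2 * qq g ≤ |tL g| → T ≤ |tL g| → 1 / 2 * Phi a g ≤ Ly a δ M g := by
    intro g ht hTt
    have hΦ := Phi_pos h g
    have hq := qq_pos g
    have hrr := rr_nonneg g
    have hqe : qq g = 1 + rr g := rfl
    have habs : |tL g / qq g / δ| = |tL g| / qq g / δ := by
      rw [abs_div, abs_div, abs_of_pos hδ0, abs_of_pos hq]
    have hlarge : |tL g| ≤ δ * qq g → 1 + 33 / κ ≤ rr g := by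
      intro h1
      have : δ * qq g ≤ qq g := by nlinarith
      linarith
    have h33 : 0 < 33 / κ := by positivity
    rw [Ly_eq h, ← hnn, mul_comm]
    refine mul_le_mul_of_nonneg_left ?_ hΦ.le
    have hdich : chi (tL g / qq g / δ) = 0 ∨ |tL g| ≤ δ * qq g := by
      by_cases h1 : |tL g| ≤ δ * qq g
      · exact Or.inr h1
      · left; apply chi_zero; rw [habs, le_div_iff₀ hδ0, le_div_iff₀ hq]; linarith
    refine caseII (E := E) (T := T) hn hrr (iq_pos g) (iq_le g) (iq_sq g) (chi_nonneg _) (chi_le_one _)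
      ?_ (dchi_mul_bd _) ((be_bound1 h hM0.le g).2 T hT0 hTt) ?_ (hNup g) ?_ hTE
    · rcases hdich with h1 | h1
      · exact Or.inl h1
      · right; linarith [hlarge h1]
    · rcases hdich with h1 | h1
      · rw [h1]; simp
      · refine mul_nonneg (chi_nonneg _) (div_nonneg ?_ hΦ.le)
        have := hNlow g (hlarge h1) h1
        have h0 : 0 ≤ 1 / 2 * rr g * Phi a g := by positivity
        linarith
    · -- the derivative in the vertical direction
      have hD : ε * |tL g| * Phi a g ≤ tL g * Dg a g := by
        have h4 : |g.2 / 4| = |tL g| / 4 := by rw [abs_div]; norm_num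
        have := Dl_lower (h.dat g) hε0 hε1 (g.2 / 4) ?_ ?_
        · have e : g.2 / 4 * Dl (bI a) (rho g) (g.2 / 4) = tL g * Dg a g / 4 := by
            unfold Dg; rw [tL_apply]; ring
          rw [e, h4] at this
          have e2 : Pl (bI a) (rho g) (g.2 / 4) = Phi a g := rfl
          rw [e2] at this
          linarith
        · rw [h4]
          have : 2 / ε = 8 / ε / 4 := by ring
          linarith
        · rw [h4, sum_rho, ← hnn]
          have he : (1:ℝ) / 3 < Real.exp (-1) := by
            rw [Real.exp_neg, one_div]
            exact inv_strictAnti₀ (Real.exp_pos 1) (by linarith [Real.exp_one_lt_d9])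
          have h5 : 1 / ε = 200 * n / δ := by rw [hε]; field_simp
          have h6 : 12.5 * (n * qq g) ≤ |tL g| / 4 / 2 * (1 / ε) := by
            rw [h5]
            have : δ / 2 * qq g / 4 / 2 * (200 * n / δ) ≤ |tL g| / 4 / 2 * (200 * n / δ) := by gcongr
            have e : δ / 2 * qq g / 4 / 2 * (200 * n / δ) = 12.5 * (n * qq g) := by field_simp; norm_num
            linarith
          have hnq : 0 < n * qq g := by positivity
          have hnr : rr g ≤ n * rr g := by nlinarith
          have : 4 * n + 16 * (rr g / 4) ≤ 4 * (n * qq g) := by rw [hqe]; nlinarith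
          nlinarith
      have hS : √(qq g ^ 2 + tL g ^ 2) ≤ 4 / δ * |tL g| := by
        rw [Real.sqrt_le_left (by positivity)]
        have h5 : qq g ≤ 2 / δ * |tL g| := by
          rw [div_mul_eq_mul_div, le_div_iff₀ hδ0]; linarith
        have h6 : |tL g| ≤ 1 / δ * |tL g| := by
          have : 1 ≤ 1 / δ := by rw [le_div_iff₀ hδ0]; linarith
          nlinarith [abs_nonneg (tL g)]
        have h7 : qq g ^ 2 ≤ (2 / δ * |tL g|) ^ 2 := by gcongr
        have h8 : |tL g| ^ 2 ≤ (1 / δ * |tL g|) ^ 2 := by gcongr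
        rw [sq_abs] at h8
        have : 0 ≤ (1 / δ * |tL g|) ^ 2 := by positivity
        have e1 : (2 / δ * |tL g|) ^ 2 = 4 * (1 / δ * |tL g|) ^ 2 := by ring
        have e2 : (4 / δ * |tL g|) ^ 2 = 16 * (1 / δ * |tL g|) ^ 2 := by ring
        rw [e2]; linarith
      have hS0 : 0 < √(qq g ^ 2 + tL g ^ 2) := Real.sqrt_pos.mpr (den_pos g)
      have hi := iq_pos g
      have hag := ar_ge hm g
      rw [hWeq, le_div_iff₀ hΦ, div_mul_eq_mul_div, le_div_iff₀ hS0]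
      calc 2 * E * M * (rr g * iq g) * Phi a g * √(qq g ^ 2 + tL g ^ 2)
          ≤ 2 * E * M * (rr g * iq g) * Phi a g * (4 / δ * |tL g|) := by gcongr
        _ = M * iq g * (m * rr g) * (ε * |tL g| * Phi a g) := by rw [hE]; field_simp; ring
        _ ≤ M * iq g * ar a g * (tL g * Dg a g) := by
            have := har0 g
            gcongr
  -- the compact region
  set R : ℝ := 1 + (R1 + 2 * T / δ) + (δ * (1 + R1) + T) with hR
  have hR0 : 0 < R := by rw [hR]; positivity
  obtain ⟨C, hC⟩ := (isCompact_closedBall (0 : Heis l k) R).bddAbove_image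
    ((((continuous_Phi h).const_mul (1 / 2)).sub (continuous_Ly h δ M)).continuousOn)
  refine ⟨δ, M, R, max C 1, hδ0, hM0, hR0, lt_max_of_lt_right one_pos, fun g => ?_⟩
  by_cases hg : g ∈ Metric.closedBall (0 : Heis l k) R
  · rw [Set.indicator_of_mem hg]
    have : 1 / 2 * Phi a g - Ly a δ M g ≤ C := hC (Set.mem_image_of_mem _ hg)
    have h2 := le_max_left C 1
    simp only [Pi.one_apply, mul_one]
    linarith
  · rw [Set.indicator_of_notMem hg, mul_zero, add_zero]
    by_contra hcon
    apply hg
    rw [mem_closedBall_zero_iff]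
    have hTd : 0 < 2 * T / δ := by positivity
    have hdR : 0 < δ * (1 + R1) := by positivity
    by_cases h1 : |tL g| ≤ δ / 2 * qq g
    · have h2 : rr g < R1 := by by_contra h2; exact hcon (case1 g h1 (not_lt.mp h2))
      refine norm_le_of (R := R1 + 2 * T / δ) (T := δ * (1 + R1) + T) (by linarith) ?_
      have : qq g = 1 + rr g := rfl
      have := rr_nonneg g
      nlinarith
    · have h2 : |tL g| < T := by by_contra h2; exact hcon (case2 g (not_le.mp h1).le (not_lt.mp h2))
      refine norm_le_of (R := R1 + 2 * T / δ) (T := δ * (1 + R1) + T) ?_ (by linarith)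
      have h3 : qq g = 1 + rr g := rfl
      have : rr g ≤ 2 * T / δ := by
        rw [le_div_iff₀ hδ0]; nlinarith
      linarith

end Cheeger

namespace Cheeger

variable {l k}

instance haarZ (l : ℕ) (k : Fin (l + 1) → ℕ) :
    (volume : Measure ((i : Fin (l + 1)) → (Fin (k i) → ℂ))).IsAddHaarMeasure := by
  rw [volume_pi]; infer_instance
instance haarH (l : ℕ) (k : Fin (l + 1) → ℕ) : (volume : Measure (Heis l k)).IsAddHaarMeasure := by
  have := haarZ l k
  rw [Measure.volume_eq_prod]; infer_instance

theorem ibp {c ξ : Heis l k → ℝ} (hc : ContDiff ℝ 1 c) (hξ : ContDiff ℝ 1 ξ) (hs : HasCompactSupport ξ)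
    (v : Heis l k) : ∫ g, c g * fderiv ℝ ξ g v = - ∫ g, fderiv ℝ c g v * ξ g := by
  have c1 : Continuous (fun g => fderiv ℝ c g v) := (hc.continuous_fderiv (by norm_num)).clm_apply continuous_const
  have c2 : Continuous (fun g => fderiv ℝ ξ g v) := (hξ.continuous_fderiv (by norm_num)).clm_apply continuous_const
  refine integral_mul_fderiv_eq_neg_fderiv_mul_of_integrable ?_ ?_ ?_
    (fun x _ => hc.differentiable (by norm_num) x) (fun x _ => hξ.differentiable (by norm_num) x)
  · exact (c1.mul hξ.continuous).integrable_of_hasCompactSupport hs.mul_left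
  · exact (hc.continuous.mul c2).integrable_of_hasCompactSupport (hs.fderiv_apply (𝕜 := ℝ) v).mul_left
  · exact (hc.continuous.mul hξ.continuous).integrable_of_hasCompactSupport hs.mul_left

theorem contDiff_nq (p : Ix k) : ContDiff ℝ 1 (nq (k := k) p) :=
  contDiff_one_iff_hasFDerivAt.mpr ⟨dnq p, continuous_dnq p, hasFDerivAt_nq p⟩
theorem contDiff_Phi {a : Fin (l + 1) → ℝ} (h : Hy k a) : ContDiff ℝ 1 (Phi (k := k) a) :=
  contDiff_one_iff_hasFDerivAt.mpr ⟨dPhi a, continuous_dPhi h, hasFDerivAt_Phi h⟩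

theorem int_c_dxi {c ξ : Heis l k → ℝ} (hc : Continuous c) (hξ : ContDiff ℝ 1 ξ) (hs : HasCompactSupport ξ)
    (v : Heis l k) : Integrable (fun g => c g * fderiv ℝ ξ g v) := by
  have c2 : Continuous (fun g => fderiv ℝ ξ g v) := (hξ.continuous_fderiv (by norm_num)).clm_apply continuous_const
  exact (hc.mul c2).integrable_of_hasCompactSupport (hs.fderiv_apply (𝕜 := ℝ) v).mul_left

theorem div_Z1 {ξ : Heis l k → ℝ} (hξ : ContDiff ℝ 1 ξ) (hs : HasCompactSupport ξ) :
    ∫ g, fderiv ℝ ξ g (Z1 g) = -(2 * (Fintype.card (Ix k) : ℝ)) * ∫ g, ξ g := by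
  have e : ∀ g, fderiv ℝ ξ g (Z1 g) =
      ∑ p : Ix k, (reL p g * fderiv ℝ ξ g (eX p) + imL p g * fderiv ℝ ξ g (eY p)) := by
    intro g; unfold Z1; rw [map_sum]
    simp only [map_add, map_smul, smul_eq_mul]
  simp_rw [e]
  have i1 : ∀ p : Ix k, Integrable (fun g : Heis l k => reL p g * fderiv ℝ ξ g (eX p)) :=
    fun p => int_c_dxi (reL p).continuous hξ hs _
  have i2 : ∀ p : Ix k, Integrable (fun g : Heis l k => imL p g * fderiv ℝ ξ g (eY p)) :=
    fun p => int_c_dxi (imL p).continuous hξ hs _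
  have i3 : ∀ p ∈ (univ : Finset (Ix k)), Integrable
      (fun g : Heis l k => reL p g * fderiv ℝ ξ g (eX p) + imL p g * fderiv ℝ ξ g (eY p)) :=
    fun p _ => (i1 p).add (i2 p)
  rw [integral_finsetSum _ i3]
  have : ∀ p ∈ (univ : Finset (Ix k)), ∫ g, (reL p g * fderiv ℝ ξ g (eX p) + imL p g * fderiv ℝ ξ g (eY p)) =
      -2 * ∫ g, ξ g := by
    intro p _
    rw [integral_add (i1 p) (i2 p), ibp (reL p).contDiff hξ hs, ibp (imL p).contDiff hξ hs]
    simp only [ContinuousLinearMap.fderiv, reL_eX, imL_eY, if_true, one_mul]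
    ring
  rw [Finset.sum_congr rfl this, Finset.sum_const, Finset.card_univ, nsmul_eq_mul]; ring

theorem contDiff_ar (a : Fin (l + 1) → ℝ) : ContDiff ℝ 1 (ar a : Heis l k → ℝ) := by
  unfold ar
  exact ContDiff.sum fun p _ => contDiff_const.mul (contDiff_nq p)

theorem div_Z2 (a : Fin (l + 1) → ℝ) {ξ : Heis l k → ℝ} (hξ : ContDiff ℝ 1 ξ) (hs : HasCompactSupport ξ) :
    ∫ g, fderiv ℝ ξ g (Z2 a g) = 0 := by
  have e : ∀ g, fderiv ℝ ξ g (Z2 a g) =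
      ∑ p : Ix k, (imL p g * fderiv ℝ ξ g (eX p) - reL p g * fderiv ℝ ξ g (eY p)) +
        2 * (ar a g * fderiv ℝ ξ g eT) := by
    intro g; unfold Z2; rw [map_add, map_sum]
    simp only [map_sub, map_smul, smul_eq_mul]; ring
  simp_rw [e]
  have i1 : ∀ p : Ix k, Integrable (fun g : Heis l k => imL p g * fderiv ℝ ξ g (eX p)) :=
    fun p => int_c_dxi (imL p).continuous hξ hs _
  have i2 : ∀ p : Ix k, Integrable (fun g : Heis l k => reL p g * fderiv ℝ ξ g (eY p)) :=
    fun p => int_c_dxi (reL p).continuous hξ hs _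
  have i3 : ∀ p ∈ (univ : Finset (Ix k)), Integrable
      (fun g : Heis l k => imL p g * fderiv ℝ ξ g (eX p) - reL p g * fderiv ℝ ξ g (eY p)) :=
    fun p _ => (i1 p).sub (i2 p)
  have i4 : Integrable (fun g : Heis l k => 2 * (ar a g * fderiv ℝ ξ g eT)) :=
    (int_c_dxi (continuous_ar a) hξ hs _).const_mul 2
  rw [integral_add (integrable_finsetSum _ i3) i4, integral_finsetSum _ i3]
  have h1 : ∀ p ∈ (univ : Finset (Ix k)), ∫ g, (imL p g * fderiv ℝ ξ g (eX p) - reL p g * fderiv ℝ ξ g (eY p)) = 0 := by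
    intro p _
    rw [integral_sub (i1 p) (i2 p), ibp (reL p).contDiff hξ hs, ibp (imL p).contDiff hξ hs]
    simp only [ContinuousLinearMap.fderiv, reL_eY, imL_eX, zero_mul]
    simp
  rw [Finset.sum_eq_zero h1, integral_const_mul, ibp (contDiff_ar a) hξ hs]
  have h2 : ∀ g : Heis l k, fderiv ℝ (ar a) g eT = 0 := by
    intro g
    have h3 : HasFDerivAt (ar a : Heis l k → ℝ) (∑ p : Ix k, bI a p • dnq p g) g :=
      HasFDerivAt.fun_sum fun p _ => (hasFDerivAt_nq p g).const_mul _
    rw [h3.fderiv, ContinuousLinearMap.sum_apply]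
    refine Finset.sum_eq_zero fun p _ => ?_
    simp [dnq, -reL_apply, -imL_apply]
  simp_rw [h2]; simp

/-- the vector field -/
def VV (a : Fin (l + 1) → ℝ) (δ M : ℝ) (g : Heis l k) : Heis l k := al δ g • Z1 g + be M g • Z2 a g

theorem continuous_VV (a : Fin (l + 1) → ℝ) (δ M : ℝ) : Continuous (VV (k := k) a δ M) := by
  unfold VV
  exact ((contDiff_al δ).continuous.smul continuous_Z1).add ((contDiff_be M).continuous.smul (continuous_Z2 a))

theorem main_identity {a : Fin (l + 1) → ℝ} (h : Hy k a) (δ M : ℝ) {w : Heis l k → ℝ} (hw : ContDiff ℝ 1 w)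
    (hs : HasCompactSupport w) :
    ∫ g, w g * Ly a δ M g = ∫ g, fderiv ℝ w g (VV a δ M g) * Phi a g := by
  have hΦ := contDiff_Phi h
  have ha := contDiff_al (k := k) δ
  have hb := contDiff_be (k := k) M
  have hdw : ∀ W : Heis l k → Heis l k, Continuous W → Continuous (fun g => fderiv ℝ w g (W g)) :=
    fun W hW => (hw.continuous_fderiv (by norm_num)).clm_apply hW
  have s1 : HasCompactSupport (fun g => w g * (Phi a g * al δ g)) := hs.mul_right
  have s2 : HasCompactSupport (fun g => w g * (Phi a g * be M g)) := hs.mul_right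
  have D1 := div_Z1 (hw.mul (hΦ.mul ha)) s1
  have D2 := div_Z2 a (hw.mul (hΦ.mul hb)) s2
  have e : ∀ (c : Heis l k → ℝ) (hc : ContDiff ℝ 1 c) (g v : Heis l k),
      fderiv ℝ (fun g => w g * (Phi a g * c g)) g v =
        fderiv ℝ w g v * (Phi a g * c g) + w g * (dPhi a g v * c g + Phi a g * fderiv ℝ c g v) := by
    intro c hc g v
    have h1 := (hw.differentiable (by norm_num) g).hasFDerivAt
    have h2 := (hc.differentiable (by norm_num) g).hasFDerivAt
    have h3 := (h1.fun_mul ((hasFDerivAt_Phi h g).fun_mul h2)).fderiv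
    rw [h3]
    simp only [ContinuousLinearMap.add_apply, ContinuousLinearMap.smul_apply, smul_eq_mul]; ring
  simp_rw [e _ ha] at D1
  simp_rw [e _ hb] at D2
  have sdw : ∀ W : Heis l k → Heis l k, HasCompactSupport (fun g => fderiv ℝ w g (W g)) := by
    intro W
    refine hs.mono' (fun g hg => support_fderiv_subset ℝ (f := w) ?_)
    rw [Function.mem_support] at hg ⊢
    intro h0; rw [h0] at hg; simp at hg
  have i1 : ∀ (c : Heis l k → ℝ) (W : Heis l k → Heis l k), Continuous c → Continuous W →
      Integrable (fun g => fderiv ℝ w g (W g) * (Phi a g * c g)) := fun c W hc hW =>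
    ((hdw W hW).mul (hΦ.continuous.mul hc)).integrable_of_hasCompactSupport (sdw W).mul_right
  have i2 : ∀ (c : Heis l k → ℝ) (W : Heis l k → Heis l k), ContDiff ℝ 1 c → Continuous W →
      Integrable (fun g => w g * (dPhi a g (W g) * c g + Phi a g * fderiv ℝ c g (W g))) := fun c W hc hW =>
    (hw.continuous.mul ((((continuous_dPhi h).clm_apply hW).mul hc.continuous).add
      (hΦ.continuous.mul ((hc.continuous_fderiv (by norm_num)).clm_apply hW)))).integrable_of_hasCompactSupport
        hs.mul_right
  have i3 : Integrable (fun g => w g * (Phi a g * al δ g)) :=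
    (hw.mul (hΦ.mul ha)).continuous.integrable_of_hasCompactSupport s1
  rw [integral_add (i1 _ _ ha.continuous continuous_Z1) (i2 _ _ ha continuous_Z1)] at D1
  rw [integral_add (i1 _ _ hb.continuous (continuous_Z2 a)) (i2 _ _ hb (continuous_Z2 a))] at D2
  have eL : ∀ g, w g * Ly a δ M g = -(2 * (Fintype.card (Ix k) : ℝ)) * (w g * (Phi a g * al δ g))
      - w g * (dPhi a g (Z1 g) * al δ g + Phi a g * fderiv ℝ (al δ) g (Z1 g))
      - w g * (dPhi a g (Z2 a g) * be M g + Phi a g * fderiv ℝ (be M) g (Z2 a g)) := by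
    intro g; unfold Ly; ring
  have eR : ∀ g, fderiv ℝ w g (VV a δ M g) * Phi a g = fderiv ℝ w g (Z1 g) * (Phi a g * al δ g)
      + fderiv ℝ w g (Z2 a g) * (Phi a g * be M g) := by
    intro g; unfold VV; rw [map_add, map_smul, map_smul]; simp only [smul_eq_mul]; ring
  simp_rw [eL, eR]
  have i4 : Integrable (fun g => -(2 * (Fintype.card (Ix k) : ℝ)) * (w g * (Phi a g * al δ g))
      - w g * (dPhi a g (Z1 g) * al δ g + Phi a g * fderiv ℝ (al δ) g (Z1 g))) :=
    (i3.const_mul _).sub (i2 _ _ ha continuous_Z1)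
  rw [integral_sub i4 (i2 _ _ hb (continuous_Z2 a)),
    integral_sub (i3.const_mul _) (i2 _ _ ha continuous_Z1), integral_const_mul,
    integral_add (i1 _ _ ha.continuous continuous_Z1) (i1 _ _ hb.continuous (continuous_Z2 a))]
  linarith

end Cheeger

namespace Cheeger

variable {l k}

/-! ### horizontal gradient -/

def vX (a : Fin (l + 1) → ℝ) (p : Ix k) (g : Heis l k) : Heis l k := eX p + (2 * bI a p * imL p g) • eT
def vY (a : Fin (l + 1) → ℝ) (p : Ix k) (g : Heis l k) : Heis l k := eY p - (2 * bI a p * reL p g) • eT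

theorem Xvf_eq (a : Fin (l + 1) → ℝ) {f : Heis l k → ℝ} {g : Heis l k} (hf : DifferentiableAt ℝ f g) (p : Ix k) :
    Xvf l k a p.1 p.2 f g = fderiv ℝ f g (vX a p g) := by
  unfold Xvf
  rw [hf.lineDeriv_eq_fderiv]
  congr 1
  refine Prod.ext ?_ ?_ <;> simp [vX, eX, eT, bI]

theorem Yvf_eq (a : Fin (l + 1) → ℝ) {f : Heis l k → ℝ} {g : Heis l k} (hf : DifferentiableAt ℝ f g) (p : Ix k) :
    Yvf l k a p.1 p.2 f g = fderiv ℝ f g (vY a p g) := by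
  unfold Yvf
  rw [hf.lineDeriv_eq_fderiv]
  congr 1
  refine Prod.ext ?_ ?_ <;> simp [vY, eY, eT, bI]

theorem gradNorm_eq (a : Fin (l + 1) → ℝ) {f : Heis l k → ℝ} {g : Heis l k} (hf : DifferentiableAt ℝ f g) :
    gradNorm l k a f g = √(∑ p : Ix k, ((fderiv ℝ f g (vX a p g)) ^ 2 + (fderiv ℝ f g (vY a p g)) ^ 2)) := by
  unfold gradNorm
  rw [sum_Ix]
  congr 1
  refine Finset.sum_congr rfl fun i _ => Finset.sum_congr rfl fun j _ => ?_
  rw [← Xvf_eq a hf ⟨i, j⟩, ← Yvf_eq a hf ⟨i, j⟩]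

theorem gradNorm_nonneg (a : Fin (l + 1) → ℝ) (f : Heis l k → ℝ) (g : Heis l k) : 0 ≤ gradNorm l k a f g :=
  Real.sqrt_nonneg _

theorem abs_X_le (a : Fin (l + 1) → ℝ) {f : Heis l k → ℝ} {g : Heis l k} (hf : DifferentiableAt ℝ f g) (p : Ix k) :
    |fderiv ℝ f g (vX a p g)| ≤ gradNorm l k a f g ∧ |fderiv ℝ f g (vY a p g)| ≤ gradNorm l k a f g := by
  rw [gradNorm_eq a hf]
  have := Finset.single_le_sum (f := fun p : Ix k => (fderiv ℝ f g (vX a p g)) ^ 2 + (fderiv ℝ f g (vY a p g)) ^ 2)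
    (fun p _ => by positivity) (Finset.mem_univ p)
  constructor
  · refine Real.abs_le_sqrt (le_trans ?_ this); nlinarith [sq_nonneg (fderiv ℝ f g (vY a p g))]
  · refine Real.abs_le_sqrt (le_trans ?_ this); nlinarith [sq_nonneg (fderiv ℝ f g (vX a p g))]

theorem continuous_gradNorm (a : Fin (l + 1) → ℝ) {f : Heis l k → ℝ} (hf : ContDiff ℝ 1 f) :
    Continuous (gradNorm l k a f) := by
  have e : gradNorm l k a f = fun g =>
      √(∑ p : Ix k, ((fderiv ℝ f g (vX a p g)) ^ 2 + (fderiv ℝ f g (vY a p g)) ^ 2)) :=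
    funext fun g => gradNorm_eq a (hf.differentiable (by norm_num) g)
  rw [e]
  have h1 := hf.continuous_fderiv (by norm_num)
  refine Real.continuous_sqrt.comp (continuous_finsetSum _ fun p _ => ?_)
  have h2 : Continuous (vX (k := k) a p) := by unfold vX; fun_prop
  have h3 : Continuous (vY (k := k) a p) := by unfold vY; fun_prop
  exact ((h1.clm_apply h2).pow 2).add ((h1.clm_apply h3).pow 2)

theorem gradNorm_compact (a : Fin (l + 1) → ℝ) {f : Heis l k → ℝ} (hf : ContDiff ℝ 1 f)
    (hs : HasCompactSupport f) : HasCompactSupport (gradNorm l k a f) := by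
  refine hs.mono' (fun g hg => support_fderiv_subset ℝ (f := f) ?_)
  rw [Function.mem_support] at hg ⊢
  intro h0
  rw [gradNorm_eq a (hf.differentiable (by norm_num) g), h0] at hg
  simp at hg

/-! ### the vector field is bounded horizontally -/

theorem abs_al (δ : ℝ) (g : Heis l k) : |al δ g| ≤ 2 * iq g := by
  have h1 := iq_pos g
  have h2 := iq_le g
  have h3 := chi_nonneg (tL g / qq g / δ)
  have h4 := chi_le_one (tL g / qq g / δ)
  have hq := qq_ge g
  have h5 : (qq g ^ 2)⁻¹ ≤ iq g := by
    have e : (qq g ^ 2)⁻¹ = iq g ^ 4 := by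
      have := iq_sq g
      have hq := (qq_pos g).ne'
      refine inv_eq_of_mul_eq_one_right ?_
      calc qq g ^ 2 * iq g ^ 4 = (qq g * iq g ^ 2) ^ 2 := by ring
        _ = 1 := by rw [this]; norm_num
    rw [e]
    exact pow_le_of_le_one h1.le h2 (by norm_num)
  have h6 : 0 ≤ (qq g ^ 2)⁻¹ := by positivity
  unfold al
  rw [abs_le]; constructor <;> nlinarith

theorem abs_be {M : ℝ} (hM : 0 ≤ M) (g : Heis l k) : |be M g| ≤ M * iq g := by
  unfold be
  have h1 := iq_pos g
  have hS : 0 < √(qq g ^ 2 + tL g ^ 2) := Real.sqrt_pos.mpr (den_pos g)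
  rw [abs_mul, abs_mul, abs_of_pos h1, abs_of_nonneg hM, abs_div, abs_of_pos hS]
  have : |tL g| / √(qq g ^ 2 + tL g ^ 2) ≤ 1 := by
    rw [div_le_one hS]
    exact Real.abs_le_sqrt (by nlinarith [sq_nonneg (qq g)])
  have : M * (|tL g| / √(qq g ^ 2 + tL g ^ 2)) ≤ M * 1 := by gcongr
  nlinarith

theorem abs_coord (p : Ix k) (g : Heis l k) : |reL p g| * iq g ≤ 1 ∧ |imL p g| * iq g ≤ 1 := by
  have h1 := iq_pos g
  have h2 := iq_sq g
  have h3 : nq p g ≤ qq g := by have := nq_le_rr p g; unfold qq; linarith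
  unfold nq at h3
  have key : ∀ x : ℝ, x ^ 2 ≤ qq g → |x| * iq g ≤ 1 := by
    intro x hx
    have h4 : (|x| * iq g) ^ 2 ≤ 1 ^ 2 := by
      rw [mul_pow, sq_abs]; nlinarith [sq_nonneg (iq g)]
    exact le_of_sq_le_sq h4 (by norm_num)
  exact ⟨key _ (by nlinarith [sq_nonneg (imL p g)]), key _ (by nlinarith [sq_nonneg (reL p g)])⟩

theorem VV_eq (a : Fin (l + 1) → ℝ) (δ M : ℝ) (g : Heis l k) : VV a δ M g =
    ∑ p : Ix k, ((al δ g * reL p g + be M g * imL p g) • vX a p g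
      + (al δ g * imL p g - be M g * reL p g) • vY a p g) := by
  unfold VV Z1 Z2 ar
  rw [smul_add, Finset.smul_sum, Finset.smul_sum, Finset.mul_sum, Finset.sum_smul, Finset.smul_sum, ← add_assoc,
    ← Finset.sum_add_distrib, ← Finset.sum_add_distrib]
  refine Finset.sum_congr rfl fun p _ => ?_
  unfold vX vY nq
  module

theorem abs_dV (a : Fin (l + 1) → ℝ) (δ : ℝ) {M : ℝ} (hM : 0 ≤ M) {f : Heis l k → ℝ} {g : Heis l k}
    (hf : DifferentiableAt ℝ f g) :
    |fderiv ℝ f g (VV a δ M g)| ≤ ((Fintype.card (Ix k) : ℝ) * (2 * (2 + M))) * gradNorm l k a f g := by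
  rw [VV_eq, map_sum]
  refine (Finset.abs_sum_le_sum_abs _ _).trans ?_
  have hG := gradNorm_nonneg a f g
  have hb : ∀ p ∈ (univ : Finset (Ix k)), |fderiv ℝ f g ((al δ g * reL p g + be M g * imL p g) • vX a p g
      + (al δ g * imL p g - be M g * reL p g) • vY a p g)| ≤ 2 * (2 + M) * gradNorm l k a f g := by
    intro p _
    obtain ⟨hx, hy⟩ := abs_X_le a hf p
    obtain ⟨cx, cy⟩ := abs_coord p g
    have h1 := abs_al δ g
    have h2 := abs_be hM g
    have key : ∀ x y : ℝ, |x| * iq g ≤ 1 → |y| * iq g ≤ 1 → |al δ g * x + be M g * y| ≤ 2 + M := by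
      intro x y hx hy
      refine (abs_add_le _ _).trans ?_
      rw [abs_mul, abs_mul]
      have h3 : |al δ g| * |x| ≤ 2 * iq g * |x| := by gcongr
      have h4 : |be M g| * |y| ≤ M * iq g * |y| := by gcongr
      have h5 : M * (|y| * iq g) ≤ M * 1 := by gcongr
      nlinarith
    have k1 := key _ _ cx cy
    have k2 := key (imL p g) (-reL p g) cy (by rwa [abs_neg])
    rw [map_add, map_smul, map_smul, smul_eq_mul, smul_eq_mul]
    refine (abs_add_le _ _).trans ?_
    rw [abs_mul, abs_mul]
    have k3 : |al δ g * imL p g - be M g * reL p g| ≤ 2 + M := by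
      have e : al δ g * imL p g - be M g * reL p g = al δ g * imL p g + be M g * -reL p g := by ring
      rw [e]; exact k2
    have m1 := mul_le_mul k1 hx (abs_nonneg _) (by linarith)
    have m2 := mul_le_mul k3 hy (abs_nonneg _) (by linarith)
    linarith
  refine (Finset.sum_le_sum hb).trans (le_of_eq ?_)
  rw [Finset.sum_const, Finset.card_univ, nsmul_eq_mul]; ring

/-! ### cutoff functions -/

def cut (N : ℝ) (g : Heis l k) : ℝ := chi (qq g / N) * chi (tL g / N)

theorem contDiff_cut (N : ℝ) : ContDiff ℝ 1 (cut N : Heis l k → ℝ) :=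
  (contDiff_chi.comp (contDiff_qq.div_const N)).mul (contDiff_chi.comp (tL.contDiff.div_const N))
theorem cut_nonneg (N : ℝ) (g : Heis l k) : 0 ≤ cut N g := mul_nonneg (chi_nonneg _) (chi_nonneg _)
theorem cut_le_one (N : ℝ) (g : Heis l k) : cut N g ≤ 1 := mul_le_one₀ (chi_le_one _) (chi_nonneg _) (chi_le_one _)

theorem cut_compact {N : ℝ} (hN : 0 < N) : HasCompactSupport (cut N : Heis l k → ℝ) := by
  refine HasCompactSupport.intro (isCompact_closedBall (0 : Heis l k) (1 + N + N)) fun g hg => ?_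
  by_contra h0
  apply hg
  rw [mem_closedBall_zero_iff]
  have hq := qq_pos g
  refine norm_le_of ?_ ?_
  · have : |qq g / N| < 1 := by
      by_contra h1
      exact h0 (by unfold cut; rw [chi_zero (not_lt.mp h1), zero_mul])
    rw [abs_div, abs_of_pos hN, div_lt_one hN, abs_of_pos hq] at this
    have : qq g = 1 + rr g := rfl
    linarith
  · have : |tL g / N| < 1 := by
      by_contra h1
      exact h0 (by unfold cut; rw [chi_zero (not_lt.mp h1), mul_zero])
    rw [abs_div, abs_of_pos hN, div_lt_one hN] at this
    linarith

theorem dcut_VV (a : Fin (l + 1) → ℝ) (δ M N : ℝ) (g : Heis l k) : fderiv ℝ (cut N) g (VV a δ M g) =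
    al δ g * (deriv chi (qq g / N) * (2 * rr g / N) * chi (tL g / N))
      + be M g * (chi (qq g / N) * (deriv chi (tL g / N) * (2 * ar a g / N))) := by
  have h1 : HasFDerivAt (fun g : Heis l k => qq g / N) (N⁻¹ • dqq g) g := by
    have := (hasFDerivAt_qq g).const_mul N⁻¹
    have e : (fun g : Heis l k => qq g / N) = fun g => N⁻¹ * qq g := by ext; ring
    rw [e]; exact this
  have h2 : HasFDerivAt (fun g : Heis l k => tL g / N) (N⁻¹ • tL) g := by
    have := (tL.hasFDerivAt (x := g)).const_mul N⁻¹
    have e : (fun g : Heis l k => tL g / N) = fun g => N⁻¹ * tL g := by ext; ring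
    rw [e]; exact this
  have h3 := ((hasDerivAt_chi _).comp_hasFDerivAt g h1).fun_mul ((hasDerivAt_chi _).comp_hasFDerivAt g h2)
  have e : (fun y : Heis l k => (chi ∘ fun g => qq g / N) y * (chi ∘ fun g => tL g / N) y) = cut N := rfl
  rw [e] at h3
  rw [h3.fderiv]
  unfold VV
  simp only [map_add, map_smul, ContinuousLinearMap.add_apply, ContinuousLinearMap.smul_apply, smul_eq_mul,
      Function.comp, dqq_Z1, dqq_Z2, tL_Z1, tL_Z2]
  ring

theorem dcut_bd {a : Fin (l + 1) → ℝ} (h : Hy k a) (δ : ℝ) {M N : ℝ} (hM : 0 ≤ M) (hN : 0 < N) (g : Heis l k) :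
    |fderiv ℝ (cut N) g (VV a δ M g)| ≤ 4 * C1 + 2 * M * C1 := by
  rw [dcut_VV]
  have hc := C1_nonneg
  have hq := qq_pos g
  have hr := rr_nonneg g
  have hqe : qq g = 1 + rr g := rfl
  have hi := iq_le g
  have h1 : |al δ g| ≤ 2 := (abs_al δ g).trans (by linarith)
  have h2 : |be M g| ≤ M := (abs_be hM g).trans (by nlinarith)
  have har0 : 0 ≤ ar a g := Finset.sum_nonneg fun p _ => mul_nonneg (h.a0 _).le (nq_nonneg p g)
  have har := ar_le h g
  have b1 : |deriv chi (qq g / N) * (2 * rr g / N) * chi (tL g / N)| ≤ 2 * C1 := by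
    rw [abs_mul, abs_mul, abs_of_nonneg (chi_nonneg _), abs_of_nonneg (by positivity : 0 ≤ 2 * rr g / N)]
    have h3 := dchi_mul_bd (qq g / N)
    rw [abs_mul, abs_of_pos (by positivity : 0 < qq g / N)] at h3
    have h4 : 2 * rr g / N ≤ 2 * (qq g / N) := by
      rw [mul_div_assoc]; gcongr; linarith
    have h5 : |deriv chi (qq g / N)| * (2 * rr g / N) ≤ 2 * C1 := by
      have := mul_le_mul_of_nonneg_left h4 (abs_nonneg (deriv chi (qq g / N)))
      linarith
    have h6 : 0 ≤ |deriv chi (qq g / N)| * (2 * rr g / N) := by positivity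
    exact (mul_le_of_le_one_right h6 (chi_le_one _)).trans h5
  have b2 : |chi (qq g / N) * (deriv chi (tL g / N) * (2 * ar a g / N))| ≤ 2 * C1 := by
    by_cases hqN : 1 ≤ |qq g / N|
    · rw [chi_zero hqN]; simp; exact hc
    · rw [abs_div, abs_of_pos hN, abs_of_pos hq, not_le, div_lt_one hN] at hqN
      rw [abs_mul, abs_mul, abs_of_nonneg (chi_nonneg _), abs_of_nonneg (by positivity : 0 ≤ 2 * ar a g / N)]
      have h4 : 2 * ar a g / N ≤ 2 := by rw [div_le_iff₀ hN]; linarith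
      have h5 : |deriv chi (tL g / N)| * (2 * ar a g / N) ≤ C1 * 2 := by
        gcongr
        exact dchi_bd _
      have h6 : 0 ≤ |deriv chi (tL g / N)| * (2 * ar a g / N) := by positivity
      have := mul_le_of_le_one_left h6 (chi_le_one (qq g / N))
      linarith
  refine (abs_add_le _ _).trans ?_
  rw [abs_mul (al δ g), abs_mul (be M g)]
  have m1 := mul_le_mul h1 b1 (abs_nonneg _) (by norm_num)
  have m2 := mul_le_mul h2 b2 (abs_nonneg _) hM
  linarith

theorem cut_eventually (a : Fin (l + 1) → ℝ) (δ M : ℝ) (g : Heis l k) :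
    ∀ᶠ N : ℕ in atTop, cut ((N : ℝ) + 1) g = 1 ∧ fderiv ℝ (cut ((N : ℝ) + 1)) g (VV a δ M g) = 0 := by
  have h1 : Tendsto (fun N : ℕ => (N : ℝ) + 1) atTop atTop :=
    tendsto_atTop_add_const_right _ _ tendsto_natCast_atTop_atTop
  filter_upwards [h1.eventually_ge_atTop (2 * qq g), h1.eventually_ge_atTop (2 * |tL g|)] with N hN1 hN2
  have hN : (0 : ℝ) < (N : ℝ) + 1 := by positivity
  have e1 : |qq g / ((N : ℝ) + 1)| ≤ 1 / 2 := by
    rw [abs_div, abs_of_pos hN, abs_of_pos (qq_pos g), div_le_iff₀ hN]; linarith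
  have e2 : |tL g / ((N : ℝ) + 1)| ≤ 1 / 2 := by
    rw [abs_div, abs_of_pos hN, div_le_iff₀ hN]; linarith
  constructor
  · unfold cut; rw [chi_one e1, chi_one e2, one_mul]
  · rw [dcut_VV, dchi_zero' e1, dchi_zero' e2]; simp

end Cheeger

namespace Cheeger

variable {l k}

/-! ### global estimate -/

def smAbs (η s : ℝ) : ℝ := √(s ^ 2 + η ^ 2) - η

theorem smAbs_nonneg {η : ℝ} (hη : 0 < η) (s : ℝ) : 0 ≤ smAbs η s := by
  unfold smAbs
  have : η ≤ √(s ^ 2 + η ^ 2) := Real.le_sqrt_of_sq_le (by nlinarith [sq_nonneg s])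
  linarith

theorem smAbs_le {η : ℝ} (hη : 0 < η) (s : ℝ) : smAbs η s ≤ |s| := by
  unfold smAbs
  have : √(s ^ 2 + η ^ 2) ≤ |s| + η := by
    rw [Real.sqrt_le_left (by positivity)]
    nlinarith [sq_abs s, abs_nonneg s, mul_nonneg (abs_nonneg s) hη.le]
  linarith

theorem hasDerivAt_smAbs {η : ℝ} (hη : 0 < η) (s : ℝ) :
    HasDerivAt (smAbs η) (s / √(s ^ 2 + η ^ 2)) s := by
  have h1 : HasDerivAt (fun s : ℝ => s ^ 2 + η ^ 2) (2 * s) s := by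
    simpa using (hasDerivAt_pow 2 s).add_const (η ^ 2)
  have h2 := (h1.sqrt (by positivity)).sub_const η
  refine h2.congr_deriv ?_
  rw [mul_div_mul_left _ _ (by norm_num : (2 : ℝ) ≠ 0)]

theorem contDiff_smAbs {η : ℝ} (hη : 0 < η) : ContDiff ℝ 1 (smAbs η) := by
  unfold smAbs
  refine ContDiff.sub (ContDiff.sqrt (by fun_prop) fun s => by positivity) contDiff_const

theorem abs_dsm {η : ℝ} (hη : 0 < η) (s : ℝ) : |s / √(s ^ 2 + η ^ 2)| ≤ 1 := by
  have hp : 0 < √(s ^ 2 + η ^ 2) := Real.sqrt_pos.mpr (by positivity)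
  rw [abs_div, abs_of_pos hp, div_le_one hp]
  exact Real.abs_le_sqrt (by nlinarith [sq_nonneg η])

theorem smAbs_tendsto (s : ℝ) :
    Tendsto (fun N : ℕ => smAbs (1 / ((N : ℝ) + 1)) s) atTop (𝓝 |s|) := by
  have h1 : Tendsto (fun N : ℕ => 1 / ((N : ℝ) + 1)) atTop (𝓝 0) := tendsto_one_div_add_atTop_nhds_zero_nat
  have h2 : Continuous fun η : ℝ => smAbs η s := by unfold smAbs; fun_prop
  have h3 := (h2.tendsto 0).comp h1
  have e : smAbs 0 s = |s| := by unfold smAbs; simp [Real.sqrt_sq_eq_abs]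
  rw [e] at h3
  exact h3

theorem global_aux {a : Fin (l + 1) → ℝ} (h : Hy k a) {δ M R C : ℝ} (hM : 0 < M) (hC : 0 < C)
    (hL : ∀ g : Heis l k, 1 / 2 * Phi a g ≤ Ly a δ M g + C * (Metric.closedBall (0 : Heis l k) R).indicator 1 g)
    {K : ℝ} (hK0 : 0 ≤ K) {f : Heis l k → ℝ} (hf : ContDiff ℝ 1 f) (hs : HasCompactSupport f)
    (hK : ∀ g, |fderiv ℝ f g (VV a δ M g)| ≤ K * gradNorm l k a f g) (m : ℝ) 
    (hi : Integrable fun g => |f g - m| * Phi a g) (N : ℕ) :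
    1 / 2 * ∫ g, (smAbs (1 / ((N : ℝ) + 1)) (f g - m) * cut ((N : ℝ) + 1) g) * Phi a g ≤ 
      K * (∫ g, gradNorm l k a f g * Phi a g) + 
      (∫ g, (|f g - m| * Phi a g) * |fderiv ℝ (cut ((N : ℝ) + 1)) g (VV a δ M g)|) + 
      C * ∫ g in Metric.closedBall (0 : Heis l k) R, |f g - m| := by
  have hN : (0 : ℝ) < (N : ℝ) + 1 := by positivity
  obtain ⟨η, hη⟩ : ∃ η : ℝ, η = 1 / ((N : ℝ) + 1) := ⟨_, rfl⟩
  have hη0 : 0 < η := by rw [hη]; positivity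
  rw [← hη]
  obtain ⟨N', hN'⟩ : ∃ N' : ℝ, N' = (N : ℝ) + 1 := ⟨_, rfl⟩
  rw [← hN'] at hN ⊢
  clear hη hN'
  obtain ⟨w, hw⟩ : ∃ w : Heis l k → ℝ, w = fun g => smAbs η (f g - m) * cut N' g := ⟨_, rfl⟩
  have hwg : ∀ g, smAbs η (f g - m) * cut N' g = w g := fun g => by rw [hw]
  have hψ : ContDiff ℝ 1 fun g => smAbs η (f g - m) :=
    (contDiff_smAbs hη0).comp (hf.sub contDiff_const)
  have hcut1 : ContDiff ℝ 1 (cut (l := l) (k := k) N') := (contDiff_cut N').of_le (by norm_num)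
  have hw1 : ContDiff ℝ 1 w := by rw [hw]; exact hψ.mul hcut1
  have hws : HasCompactSupport w := by rw [hw]; exact (cut_compact hN).mul_left
  have hw0 : ∀ g, 0 ≤ w g := fun g => by rw [hw]; exact mul_nonneg (smAbs_nonneg hη0 _) (cut_nonneg _ _)
  have hwu : ∀ g, w g ≤ |f g - m| := fun g => by
    rw [hw]
    exact (mul_le_of_le_one_right (smAbs_nonneg hη0 _) (cut_le_one _ _)).trans (smAbs_le hη0 _)
  have hΦ := continuous_Phi h
  have i1 : Integrable fun g => w g * Phi a g := (hw1.continuous.mul hΦ).integrable_of_hasCompactSupport hws.mul_right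
  have i2 : Integrable fun g => w g * Ly a δ M g :=
    (hw1.continuous.mul (continuous_Ly h δ M)).integrable_of_hasCompactSupport hws.mul_right
  have i0 : Integrable w := hw1.continuous.integrable_of_hasCompactSupport hws
  have i3 : Integrable fun g => C * (Metric.closedBall (0 : Heis l k) R).indicator w g :=
    (i0.indicator measurableSet_closedBall).const_mul C
  have s1 : 1 / 2 * ∫ g, w g * Phi a g ≤ (∫ g, w g * Ly a δ M g) + C * ∫ g in Metric.closedBall (0 : Heis l k) R, w g := by
    rw [← integral_indicator measurableSet_closedBall, ← integral_const_mul, ← integral_const_mul, ← integral_add i2 i3]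
    refine integral_mono (i1.const_mul _) (i2.add i3) fun g => ?_
    have := mul_le_mul_of_nonneg_left (hL g) (hw0 g)
    have e : (Metric.closedBall (0 : Heis l k) R).indicator w g = w g * (Metric.closedBall (0 : Heis l k) R).indicator 1 g := by
      by_cases hg : g ∈ Metric.closedBall (0 : Heis l k) R <;> simp [hg]
    simp only [e]
    linarith
  have hgc := continuous_gradNorm a hf
  have i4 : Integrable fun g => gradNorm l k a f g * Phi a g :=
    (hgc.mul hΦ).integrable_of_hasCompactSupport (gradNorm_compact a hf hs).mul_right
  have hdc : Continuous fun g => fderiv ℝ (cut N') g (VV a δ M g) :=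
    (hcut1.continuous_fderiv (by norm_num)).clm_apply (continuous_VV a δ M)
  have i5 : Integrable fun g => (|f g - m| * Phi a g) * |fderiv ℝ (cut N') g (VV a δ M g)| := by
    refine hi.mul_bdd (c := 4 * C1 + 2 * M * C1) hdc.abs.aestronglyMeasurable (Eventually.of_forall fun g => ?_)
    rw [Real.norm_eq_abs, abs_abs]
    exact dcut_bd h δ hM.le hN g
  have s2 : (∫ g, w g * Ly a δ M g) ≤ K * (∫ g, gradNorm l k a f g * Phi a g) + 
      (∫ g, (|f g - m| * Phi a g) * |fderiv ℝ (cut N') g (VV a δ M g)|) := by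
    rw [main_identity h δ M hw1 hws, ← integral_const_mul, ← integral_add (i4.const_mul K) i5]
    refine integral_mono ?_ ((i4.const_mul K).add i5) fun g => ?_
    · refine Continuous.integrable_of_hasCompactSupport ?_ ?_
      · exact ((hw1.continuous_fderiv (by norm_num)).clm_apply (continuous_VV a δ M)).mul hΦ
      · refine HasCompactSupport.mul_right (HasCompactSupport.intro (hws.fderiv (𝕜 := ℝ)) fun g hg => ?_)
        exact (congrArg (fun L : Heis l k →L[ℝ] ℝ => L (VV a δ M g)) (image_eq_zero_of_notMem_tsupport hg)).trans rfl
    · have hd : fderiv ℝ w g (VV a δ M g) = smAbs η (f g - m) * fderiv ℝ (cut N') g (VV a δ M g) +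
          cut N' g * ((f g - m) / √((f g - m) ^ 2 + η ^ 2) * fderiv ℝ f g (VV a δ M g)) := by
        have d1 := ((hf.differentiable (by norm_num) g).hasFDerivAt).sub_const m
        have d2 := (hasDerivAt_smAbs hη0 (f g - m)).comp_hasFDerivAt g d1
        have d3 := d2.mul ((hcut1.differentiable (by norm_num) g).hasFDerivAt)
        have d4 := d3; change HasFDerivAt (fun g => smAbs η (f g - m) * cut N' g) _ g at d4; rw [← hw] at d4
        rw [d4.fderiv]
        simp only [ContinuousLinearMap.add_apply, ContinuousLinearMap.smul_apply, smul_eq_mul, Function.comp]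
      have hp := Phi_pos h g
      have b1 : fderiv ℝ w g (VV a δ M g) ≤ |f g - m| * |fderiv ℝ (cut N') g (VV a δ M g)| + K * gradNorm l k a f g := by
        rw [hd]
        refine add_le_add ?_ ?_
        · refine (le_abs_self _).trans ?_
          rw [abs_mul, abs_of_nonneg (smAbs_nonneg hη0 _)]
          exact mul_le_mul_of_nonneg_right (smAbs_le hη0 _) (abs_nonneg _)
        · refine (le_abs_self _).trans ?_
          rw [abs_mul, abs_mul, abs_of_nonneg (cut_nonneg _ _)]
          refine (mul_le_of_le_one_left (by positivity) (cut_le_one _ _)).trans ?_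
          exact (mul_le_of_le_one_left (abs_nonneg _) (abs_dsm hη0 _)).trans (hK g)
      have := mul_le_mul_of_nonneg_right b1 hp.le
      simp only
      linarith
  have s3 : ∫ g in Metric.closedBall (0 : Heis l k) R, w g ≤ ∫ g in Metric.closedBall (0 : Heis l k) R, |f g - m| := by
    refine setIntegral_mono_on i0.integrableOn ?_ measurableSet_closedBall fun g _ => hwu g
    exact ((hf.continuous.sub continuous_const).abs).continuousOn.integrableOn_compact (isCompact_closedBall _ _)
  simp only [hwg]
  have := mul_le_mul_of_nonneg_left s3 hC.le
  linarith

theorem global {a : Fin (l + 1) → ℝ} (h : Hy k a) : ∃ R C : ℝ, 0 < R ∧ 0 < C ∧ 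
    ∀ f : Heis l k → ℝ, ContDiff ℝ 1 f → HasCompactSupport f → ∀ m : ℝ,
      ∫ g, |f g - m| * Phi a g ≤ C * (∫ g, gradNorm l k a f g * Phi a g) +
        C * ∫ g in Metric.closedBall (0 : Heis l k) R, |f g - m| := by
  obtain ⟨δ, M, R, C, hδ, hM, hR, hC, hL⟩ := lyap h
  obtain ⟨K, hK⟩ : ∃ K : ℝ, K = (Fintype.card (Ix k) * (2 * (2 + M))) := ⟨_, rfl⟩
  have hK0 : 0 ≤ K := by rw [hK]; positivity
  refine ⟨R, 2 * (K + C), hR, by positivity, fun f hf hs m => ?_⟩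
  have hg0 : 0 ≤ ∫ g, gradNorm l k a f g * Phi a g :=
    integral_nonneg fun g => mul_nonneg (gradNorm_nonneg a f g) (Phi_pos h g).le
  have hb0 : 0 ≤ ∫ g in Metric.closedBall (0 : Heis l k) R, |f g - m| := integral_nonneg fun g => abs_nonneg _
  by_cases hi : Integrable fun g => |f g - m| * Phi a g
  swap
  · rw [integral_undef hi]; positivity
  have hΦ := continuous_Phi h
  have hcc : ∀ N : ℝ, Continuous (cut (l := l) (k := k) N) := fun N => (contDiff_cut N).continuous
  have hdc : ∀ N : ℝ, Continuous fun g : Heis l k => fderiv ℝ (cut N) g (VV a δ M g) := fun N =>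
    (((contDiff_cut N).of_le (by norm_num) : ContDiff ℝ 1 _).continuous_fderiv (by norm_num)).clm_apply (continuous_VV a δ M)
  have hN0 : ∀ N : ℕ, (0 : ℝ) < 1 / ((N : ℝ) + 1) := fun N => by positivity
  have t1 : Tendsto (fun N : ℕ => ∫ g, (smAbs (1 / ((N : ℝ) + 1)) (f g - m) * cut ((N : ℝ) + 1) g) * Phi a g) atTop
      (𝓝 (∫ g, |f g - m| * Phi a g)) := by
    refine tendsto_integral_of_dominated_convergence _ (fun N => ?_) hi (fun N => ?_) ?_
    · have h1 : Continuous fun g => smAbs (1 / ((N : ℝ) + 1)) (f g - m) :=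
        (contDiff_smAbs (hN0 N)).continuous.comp (hf.continuous.sub continuous_const)
      exact ((h1.mul (hcc _)).mul hΦ).aestronglyMeasurable
    · refine Eventually.of_forall fun g => ?_
      have hp := Phi_pos h g
      have h1 := smAbs_nonneg (hN0 N) (f g - m)
      rw [Real.norm_eq_abs, abs_of_nonneg (mul_nonneg (mul_nonneg h1 (cut_nonneg _ _)) hp.le)]
      refine mul_le_mul_of_nonneg_right ?_ hp.le
      exact (mul_le_of_le_one_right h1 (cut_le_one _ _)).trans (smAbs_le (hN0 N) _)
    · refine Eventually.of_forall fun g => ?_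
      refine Tendsto.mul_const _ ?_
      refine (smAbs_tendsto (f g - m)).congr' ?_
      filter_upwards [cut_eventually a δ M g] with N hN
      rw [hN.1, mul_one]
  have t2 : Tendsto (fun N : ℕ => ∫ g, (|f g - m| * Phi a g) * |fderiv ℝ (cut ((N : ℝ) + 1)) g (VV a δ M g)|) atTop
      (𝓝 0) := by
    have e0 : (0 : ℝ) = ∫ g : Heis l k, (0 : ℝ) := by simp
    rw [e0]
    refine tendsto_integral_of_dominated_convergence _ (fun N => ?_) (hi.mul_const (4 * C1 + 2 * M * C1)) (fun N => ?_) ?_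
    · exact hi.aestronglyMeasurable.mul (hdc _).abs.aestronglyMeasurable
    · refine Eventually.of_forall fun g => ?_
      have hp := Phi_pos h g
      rw [norm_mul, Real.norm_eq_abs, Real.norm_eq_abs, abs_abs, abs_of_nonneg (mul_nonneg (abs_nonneg _) hp.le)]
      exact mul_le_mul_of_nonneg_left (dcut_bd h δ hM.le (by positivity) g) (by positivity)
    · refine Eventually.of_forall fun g => ?_
      refine tendsto_const_nhds.congr' ?_
      filter_upwards [cut_eventually a δ M g] with N hN
      rw [hN.2]; simp
  have hfin := le_of_tendsto_of_tendsto' (t1.const_mul (1 / 2))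
    ((t2.const_add (K * (∫ g, gradNorm l k a f g * Phi a g))).add_const (C * ∫ g in Metric.closedBall (0 : Heis l k) R, |f g - m|))
    (fun N => global_aux h hM hC hL hK0 hf hs (fun g => by
      rw [hK]; exact abs_dV a δ hM.le (hf.differentiable (by norm_num) g)) m hi N)
  nlinarith [mul_nonneg hC.le hg0, mul_nonneg hK0 hb0]

end Cheeger

namespace Cheeger

variable {l k}

open scoped ENNReal

/-! ### local Poincare inequality -/

abbrev CB (r : ℝ) : Set (Heis l k) := Metric.closedBall (0 : Heis l k) r

theorem mp_shift (w : (i : Fin (l + 1)) → (Fin (k i) → ℂ)) {c : ((i : Fin (l + 1)) → (Fin (k i) → ℂ)) → ℝ}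
    (hc : Continuous c) :
    MeasurePreserving (fun g : Heis l k => ((g.1 + w, g.2 + c g.1) : Heis l k)) volume volume := by
  have h1 : MeasurePreserving (fun z : ((i : Fin (l + 1)) → (Fin (k i) → ℂ)) => z + w) volume volume :=
    measurePreserving_add_right _ _
  have := h1.skew_product (μc := (volume : Measure ℝ)) (μd := (volume : Measure ℝ)) (g := fun z t => t + c z)
    (by
      refine Continuous.measurable ?_
      change Continuous fun q : ((i : Fin (l + 1)) → (Fin (k i) → ℂ)) × ℝ => q.2 + c q.1
      fun_prop)
    (Eventually.of_forall fun z => (measurePreserving_add_right (volume : Measure ℝ) (c z)).map_eq)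
  rw [Measure.volume_eq_prod]
  exact this

def omg (a : Fin (l + 1) → ℝ) (w : Heis l k) : Heis l k →L[ℝ] ℝ :=
  ∑ p : Ix k, ((2 * bI a p * reL p w) • imL p - (2 * bI a p * imL p w) • reL p)

theorem omg_apply (a : Fin (l + 1) → ℝ) (w g : Heis l k) : omg a w g =
    ∑ p : Ix k, (2 * bI a p * reL p w * imL p g - 2 * bI a p * imL p w * reL p g) := by
  unfold omg
  simp only [ContinuousLinearMap.sum_apply, ContinuousLinearMap.sub_apply, ContinuousLinearMap.smul_apply, smul_eq_mul]

theorem omg_self (a : Fin (l + 1) → ℝ) (w : Heis l k) : omg a w w = 0 := by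
  rw [omg_apply]; exact Finset.sum_eq_zero fun p _ => by ring

theorem omg_swap (a : Fin (l + 1) → ℝ) (w g : Heis l k) : omg a w g = - omg a g w := by
  rw [omg_apply, omg_apply, ← Finset.sum_neg_distrib]; exact Finset.sum_congr rfl fun p _ => by ring

theorem omg_congr (a : Fin (l + 1) → ℝ) (w : Heis l k) {g g' : Heis l k} (h : g.1 = g'.1) : omg a w g = omg a w g' := by
  rw [omg_apply, omg_apply]
  refine Finset.sum_congr rfl fun p _ => ?_
  simp only [reL_apply, imL_apply, h]

theorem abs_reL (p : Ix k) (g : Heis l k) : |reL p g| ≤ ‖g‖ :=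
  (Complex.abs_re_le_norm _).trans (((norm_le_pi_norm (g.1 p.1) p.2).trans (norm_le_pi_norm g.1 p.1)).trans (norm_fst_le g))
theorem abs_imL (p : Ix k) (g : Heis l k) : |imL p g| ≤ ‖g‖ :=
  (Complex.abs_im_le_norm _).trans (((norm_le_pi_norm (g.1 p.1) p.2).trans (norm_le_pi_norm g.1 p.1)).trans (norm_fst_le g))

theorem omg_bd {a : Fin (l + 1) → ℝ} (h : Hy k a) (w g : Heis l k) :
    |omg a w g| ≤ 4 * (Fintype.card (Ix k) : ℝ) * (‖w‖ * ‖g‖) := by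
  rw [omg_apply]
  refine (Finset.abs_sum_le_sum_abs _ _).trans ?_
  have hb : ∀ p ∈ (univ : Finset (Ix k)), |2 * bI a p * reL p w * imL p g - 2 * bI a p * imL p w * reL p g|
      ≤ 4 * (‖w‖ * ‖g‖) := by
    intro p _
    have b0 : 0 ≤ bI a p := (h.a0 _).le
    have b1 : bI a p ≤ 1 := h.a1 _
    have m1 := mul_le_mul (abs_reL p w) (abs_imL p g) (abs_nonneg _) (norm_nonneg _)
    have m2 := mul_le_mul (abs_imL p w) (abs_reL p g) (abs_nonneg _) (norm_nonneg _)
    have e : 2 * bI a p * reL p w * imL p g - 2 * bI a p * imL p w * reL p g =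
      2 * bI a p * (reL p w * imL p g - imL p w * reL p g) := by ring
    rw [e, abs_mul, abs_of_nonneg (by positivity)]
    have m3 : |reL p w * imL p g - imL p w * reL p g| ≤ 2 * (‖w‖ * ‖g‖) := by
      refine (abs_sub _ _).trans ?_
      rw [abs_mul, abs_mul]; linarith
    have m4 : 2 * bI a p ≤ 2 := by linarith
    have := mul_le_mul m4 m3 (abs_nonneg _) (by norm_num)
    linarith
  refine (Finset.sum_le_sum hb).trans (le_of_eq ?_)
  rw [Finset.sum_const, Finset.card_univ, nsmul_eq_mul]; ring

/-- horizontal direction -/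
def Hv (a : Fin (l + 1) → ℝ) (w g : Heis l k) : Heis l k := (w.1, omg a w g)

theorem Hv_eq (a : Fin (l + 1) → ℝ) (w g : Heis l k) : Hv a w g =
    ∑ p : Ix k, (reL p w • vX a p g + imL p w • vY a p g) := by
  refine heis_ext (fun q => ?_) (fun q => ?_) ?_
  · rw [map_sum]; simp only [vX, vY, map_add, map_sub, map_smul, reL_eX, reL_eY, reL_eT]; simp [Hv]
  · rw [map_sum]; simp only [vX, vY, map_add, map_sub, map_smul, imL_eX, imL_eY, imL_eT]; simp [Hv]
  · rw [map_sum]; simp only [vX, vY, map_add, map_sub, map_smul, tL_eX, tL_eY, tL_eT]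
    change omg a w g = _
    rw [omg_apply]
    refine Finset.sum_congr rfl fun p _ => ?_
    simp only [smul_eq_mul]; ring

theorem abs_dHv (a : Fin (l + 1) → ℝ) {f : Heis l k → ℝ} {g : Heis l k} (hf : DifferentiableAt ℝ f g) (w : Heis l k) :
    |fderiv ℝ f g (Hv a w g)| ≤ 2 * (Fintype.card (Ix k) : ℝ) * ‖w‖ * gradNorm l k a f g := by
  rw [Hv_eq, map_sum]
  refine (Finset.abs_sum_le_sum_abs _ _).trans ?_
  have hb : ∀ p ∈ (univ : Finset (Ix k)), |fderiv ℝ f g (reL p w • vX a p g + imL p w • vY a p g)|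
      ≤ 2 * ‖w‖ * gradNorm l k a f g := by
    intro p _
    obtain ⟨hx, hy⟩ := abs_X_le a hf p
    rw [map_add, map_smul, map_smul, smul_eq_mul, smul_eq_mul]
    refine (abs_add_le _ _).trans ?_
    rw [abs_mul, abs_mul]
    have m1 := mul_le_mul (abs_reL p w) hx (abs_nonneg _) (norm_nonneg _)
    have m2 := mul_le_mul (abs_imL p w) hy (abs_nonneg _) (norm_nonneg _)
    linarith
  refine (Finset.sum_le_sum hb).trans (le_of_eq ?_)
  rw [Finset.sum_const, Finset.card_univ, nsmul_eq_mul]; ring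

def tau (a : Fin (l + 1) → ℝ) (w g : Heis l k) : Heis l k := (g.1 + w.1, g.2 + omg a w g)

theorem tau_eq (a : Fin (l + 1) → ℝ) (w g : Heis l k) (s : ℝ) : g + s • Hv a w g = tau a (s • w) g := by
  refine Prod.ext ?_ ?_
  · simp [tau, Hv]
  · have : omg a (s • w) g = s * omg a w g := by rw [omg_swap, map_smul, omg_swap a g w]; simp
    simp [tau, Hv, this]

theorem Hv_tau (a : Fin (l + 1) → ℝ) (w g : Heis l k) (s : ℝ) : Hv a w (tau a (s • w) g) = Hv a w g := by
  refine Prod.ext rfl ?_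
  change omg a w (tau a (s • w) g) = omg a w g
  have : omg a w (tau a (s • w) g) = omg a w (g + s • w) := omg_congr a w rfl
  rw [this, map_add, map_smul, omg_self]; simp

theorem mp_tau (a : Fin (l + 1) → ℝ) (w : Heis l k) : MeasurePreserving (tau a w) volume volume := by
  have hc : Continuous fun z : ((i : Fin (l + 1)) → (Fin (k i) → ℂ)) => omg a w (z, 0) := by fun_prop
  have := mp_shift (l := l) (k := k) w.1 hc
  have e : tau a w = fun g : Heis l k => ((g.1 + w.1, g.2 + omg a w (g.1, 0)) : Heis l k) := by
    funext g
    unfold tau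
    rw [omg_congr a w (g := g) (g' := (g.1, 0)) rfl]
  rw [e]; exact this

theorem continuous_tau (a : Fin (l + 1) → ℝ) (w : Heis l k) : Continuous (tau a w) := by
  unfold tau; fun_prop

theorem tau_norm {a : Fin (l + 1) → ℝ} (h : Hy k a) {r W : ℝ} {w g : Heis l k} (hw : ‖w‖ ≤ W) (hg : ‖g‖ ≤ r) :
    ‖tau a w g‖ ≤ r + W + 4 * (Fintype.card (Ix k) : ℝ) * (W * r) := by
  have hW : 0 ≤ W := (norm_nonneg _).trans hw
  have h1 := omg_bd h w g
  have h2 : ‖w‖ * ‖g‖ ≤ W * r := mul_le_mul hw hg (norm_nonneg _) hW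
  have h3 : 0 ≤ W * r := mul_nonneg hW ((norm_nonneg _).trans hg)
  have h4 : 4 * (Fintype.card (Ix k) : ℝ) * (‖w‖ * ‖g‖) ≤ 4 * (Fintype.card (Ix k) : ℝ) * (W * r) := by gcongr
  have h5 : 0 ≤ 4 * (Fintype.card (Ix k) : ℝ) * (W * r) := by positivity
  unfold tau
  rw [Prod.norm_def, max_le_iff]
  constructor
  · refine (norm_add_le _ _).trans ?_
    have := norm_fst_le g
    have := norm_fst_le w

    linarith
  · refine (norm_add_le _ _).trans ?_
    have := norm_snd_le g
    simp only [Real.norm_eq_abs] at *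
    linarith

theorem subst_le {T : Heis l k → Heis l k} (hT : MeasurePreserving T volume volume) {r r' : ℝ}
    (hm : Set.MapsTo T (CB r) (CB r')) {F : Heis l k → ℝ≥0∞} (hF : Measurable F) :
    ∫⁻ g in CB r, F (T g) ≤ ∫⁻ g in CB r', F g := by
  calc ∫⁻ g in CB r, F (T g) ≤ ∫⁻ g in T ⁻¹' (CB r'), F (T g) := lintegral_mono_set hm
    _ = _ := hT.setLIntegral_comp_preimage measurableSet_closedBall hF

structure GoodMap (a : Fin (l + 1) → ℝ) (T : Heis l k → Heis l k) (r r' : ℝ) (D : ℝ≥0∞) : Prop where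
  mp : MeasurePreserving T volume volume
  cont : Continuous T
  maps : Set.MapsTo T (CB r) (CB r')
  le : ∀ f : Heis l k → ℝ, ContDiff ℝ 1 f → 
    ∫⁻ g in CB r, ‖f (T g) - f g‖ₑ ≤ D * ∫⁻ g in CB r', ‖gradNorm l k a f g‖ₑ

theorem GoodMap.comp {a : Fin (l + 1) → ℝ} {T1 T2 : Heis l k → Heis l k} {r r1 r2 : ℝ} {D1 D2 : ℝ≥0∞}
    (h1 : GoodMap a T1 r r1 D1) (h2 : GoodMap a T2 r1 r2 D2) (hr : r1 ≤ r2) : GoodMap a (T2 ∘ T1) r r2 (D1 + D2) := by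
  refine ⟨h2.mp.comp h1.mp, h2.cont.comp h1.cont, h2.maps.comp h1.maps, fun f hf => ?_⟩
  have hf' := hf.continuous
  have c2 := h2.cont
  have c1 := h1.cont
  have m1 : Measurable fun g => ‖f (T1 g) - f g‖ₑ := by
    refine Continuous.measurable (Continuous.enorm ?_); fun_prop
  have m2 : Measurable fun g => ‖f (T2 g) - f g‖ₑ := by
    refine Continuous.measurable (Continuous.enorm ?_); fun_prop
  calc ∫⁻ g in CB r, ‖f ((T2 ∘ T1) g) - f g‖ₑ 
      ≤ ∫⁻ g in CB r, (‖f (T1 g) - f g‖ₑ + ‖f (T2 (T1 g)) - f (T1 g)‖ₑ) := by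
        refine lintegral_mono fun g => ?_
        have e : f ((T2 ∘ T1) g) - f g = (f (T1 g) - f g) + (f (T2 (T1 g)) - f (T1 g)) := by
          simp only [Function.comp]; ring
        rw [e]; exact enorm_add_le _ _
    _ = (∫⁻ g in CB r, ‖f (T1 g) - f g‖ₑ) + ∫⁻ g in CB r, ‖f (T2 (T1 g)) - f (T1 g)‖ₑ := lintegral_add_left m1 _
    _ ≤ D1 * (∫⁻ g in CB r2, ‖gradNorm l k a f g‖ₑ) + D2 * ∫⁻ g in CB r2, ‖gradNorm l k a f g‖ₑ := by
        refine add_le_add ((h1.le f hf).trans ?_) ((subst_le h1.mp h1.maps m2).trans (h2.le f hf))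
        exact mul_le_mul' le_rfl (lintegral_mono_set (Metric.closedBall_subset_closedBall hr))
    _ = _ := (add_mul _ _ _).symm

theorem flow_le (a : Fin (l + 1) → ℝ) {f : Heis l k → ℝ} (hf : ContDiff ℝ 1 f) (w g : Heis l k) {W : ℝ} (hw : ‖w‖ ≤ W) :
    ‖f (tau a w g) - f g‖ₑ ≤ ∫⁻ s in Set.Ioc (0 : ℝ) 1, 
      ENNReal.ofReal (2 * (Fintype.card (Ix k) : ℝ) * W) * ‖gradNorm l k a f (tau a (s • w) g)‖ₑ := by
  have hd : ∀ s : ℝ, HasDerivAt (fun s : ℝ => f (g + s • Hv a w g)) (fderiv ℝ f (g + s • Hv a w g) (Hv a w g)) s := by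
    intro s
    have h1 := (hf.differentiable (by norm_num) (g + s • Hv a w g)).hasFDerivAt
    have h2 : HasDerivAt (fun s : ℝ => g + s • Hv a w g) (Hv a w g) s := by
      simpa using ((hasDerivAt_id s).smul_const (Hv a w g)).const_add g
    exact h1.comp_hasDerivAt s h2
  have hc : Continuous fun s : ℝ => fderiv ℝ f (g + s • Hv a w g) (Hv a w g) := by
    have := hf.continuous_fderiv (by norm_num)
    fun_prop
  have h1 := intervalIntegral.integral_eq_sub_of_hasDerivAt (a := 0) (b := 1) (fun s _ => hd s) (hc.intervalIntegrable _ _)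
  rw [tau_eq, tau_eq, one_smul] at h1
  have e0 : tau a ((0 : ℝ) • w) g = g := by rw [← tau_eq]; simp
  rw [e0] at h1
  rw [← h1, intervalIntegral.integral_of_le (by norm_num)]
  refine (enorm_integral_le_lintegral_enorm _).trans (lintegral_mono fun s => ?_)
  have h2 := abs_dHv a (hf.differentiable (by norm_num) (tau a (s • w) g)) w
  rw [Hv_tau] at h2
  rw [tau_eq, Real.enorm_eq_ofReal_abs, Real.enorm_eq_ofReal (gradNorm_nonneg _ _ _), ← ENNReal.ofReal_mul (by
    have := (norm_nonneg w).trans hw; positivity)]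
  refine ENNReal.ofReal_le_ofReal (h2.trans ?_)
  have := gradNorm_nonneg a f (tau a (s • w) g)
  gcongr

theorem good_tau {a : Fin (l + 1) → ℝ} (h : Hy k a) {w : Heis l k} {W : ℝ} (hw : ‖w‖ ≤ W) (r : ℝ) :
    GoodMap a (tau a w) r (r + W + 4 * (Fintype.card (Ix k) : ℝ) * (W * r)) 
      (ENNReal.ofReal (2 * (Fintype.card (Ix k) : ℝ) * W)) := by
  refine ⟨mp_tau a w, continuous_tau a w, fun g hg => ?_, fun f hf => ?_⟩
  · simp only [CB, mem_closedBall_zero_iff] at hg ⊢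
    exact tau_norm h hw hg
  · have hG := continuous_gradNorm a hf
    have hc : Continuous fun q : Heis l k × ℝ => ENNReal.ofReal (2 * (Fintype.card (Ix k) : ℝ) * W) *
        ‖gradNorm l k a f (tau a (q.2 • w) q.1)‖ₑ := by
      refine (ENNReal.continuous_const_mul ENNReal.ofReal_ne_top).comp (Continuous.enorm (hG.comp ?_))
      have : (fun q : Heis l k × ℝ => tau a (q.2 • w) q.1) = fun q => q.1 + q.2 • ((w.1, omg a w q.1) : Heis l k) := by
        funext q; rw [← tau_eq]; rfl
      rw [this]; fun_prop
    refine (lintegral_mono fun g => flow_le a hf w g hw).trans ?_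
    rw [lintegral_lintegral_swap hc.measurable.aemeasurable]
    have hb : ∀ s ∈ Set.Ioc (0 : ℝ) 1, ∫⁻ g in CB r, ENNReal.ofReal (2 * (Fintype.card (Ix k) : ℝ) * W) *
        ‖gradNorm l k a f (tau a (s • w) g)‖ₑ ≤ ENNReal.ofReal (2 * (Fintype.card (Ix k) : ℝ) * W) *
        ∫⁻ g in CB (r + W + 4 * (Fintype.card (Ix k) : ℝ) * (W * r)), ‖gradNorm l k a f g‖ₑ := by
      intro s hs
      have hsw : ‖s • w‖ ≤ W := by
        rw [norm_smul, Real.norm_eq_abs, abs_of_pos hs.1]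
        exact (mul_le_of_le_one_left (norm_nonneg _) hs.2).trans hw
      rw [lintegral_const_mul' _ _ ENNReal.ofReal_ne_top]
      refine mul_le_mul' le_rfl ?_
      refine subst_le (T := tau a (s • w)) (F := fun g => ‖gradNorm l k a f g‖ₑ) (mp_tau a _) (fun g hg => ?_) hG.enorm.measurable
      simp only [CB, mem_closedBall_zero_iff] at hg ⊢
      exact tau_norm h hsw hg
    refine (setLIntegral_mono' measurableSet_Ioc hb).trans ?_
    simp

def Rm (a : Fin (l + 1) → ℝ) (x g : Heis l k) : Heis l k := (g.1 + x.1, g.2 + (x.2 + omg a x g))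

theorem Rm_eq {a : Fin (l + 1) → ℝ} (p : Ix k) (hp : bI a p ≠ 0) (x g : Heis l k) : Rm a x g =
    (tau a (-((-x.2 / (4 * bI a p)) • eY p)) ∘ (tau a (-eX p) ∘ (tau a ((-x.2 / (4 * bI a p)) • eY p) ∘ (tau a (eX p) ∘ tau a x)))) g := by
  obtain ⟨c, hc⟩ : ∃ c, c = -x.2 / (4 * bI a p) := ⟨_, rfl⟩
  rw [← hc]
  have hc' : x.2 = - (4 * bI a p * c) := by rw [hc]; field_simp
  obtain ⟨w1, h1⟩ : ∃ w1 : Heis l k, w1 = eX p := ⟨_, rfl⟩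
  obtain ⟨w2, h2⟩ : ∃ w2 : Heis l k, w2 = c • eY p := ⟨_, rfl⟩
  have ho : omg a w2 w1 = - (2 * bI a p * c) := by
    rw [omg_apply, Finset.sum_eq_single p]
    · rw [h1, h2]; simp only [map_smul, reL_eX, imL_eX, reL_eY, imL_eY]; simp
    · intro q _ hq
      rw [h1, h2]; simp only [map_smul, reL_eX, imL_eX, reL_eY, imL_eY]; simp [Ne.symm hq]
    · simp
  rw [← h1, ← h2]
  have neg : ∀ w y : Heis l k, omg a (-w) y = - omg a w y := fun w y => by
    rw [omg_swap, map_neg, omg_swap a y w]; simp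
  have step : ∀ w y : Heis l k, ∀ z : Heis l k, omg a z (tau a w y) = omg a z y + omg a z w := fun w y z => by
    rw [← map_add]; exact omg_congr a z rfl
  simp only [Function.comp]
  refine Prod.ext ?_ ?_
  · simp only [Rm, tau, Prod.fst_neg]; abel
  · have e : ∀ w y : Heis l k, (tau a w y).2 = y.2 + omg a w y := fun w y => rfl
    simp only [e, step, neg, map_neg, omg_self]
    rw [omg_swap a w1 w2, ho]
    change g.2 + (x.2 + omg a x g) = _
    rw [hc']; ring

theorem good_R {a : Fin (l + 1) → ℝ} (h : Hy k a) {r ρ : ℝ} (hr : 0 ≤ r) (hρ : 0 ≤ ρ) : 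
    ∃ (r' : ℝ) (D : ℝ≥0∞), D ≠ ∞ ∧ ∀ x : Heis l k, ‖x‖ ≤ ρ → GoodMap a (Rm a x) r r' D := by
  let p : Ix k := ⟨0, ⟨0, h.hk 0⟩⟩
  have hp : 0 < bI a p := h.a0 _
  let W1 : ℝ := ‖(eX p : Heis l k)‖
  let W2 : ℝ := ρ / (4 * bI a p) * ‖(eY p : Heis l k)‖
  have hW1 : 0 ≤ W1 := norm_nonneg _
  have hW2 : 0 ≤ W2 := by positivity
  let F : ℝ → ℝ → ℝ := fun r W => r + W + 4 * (Fintype.card (Ix k) : ℝ) * (W * r)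
  have hF : ∀ r W, 0 ≤ r → 0 ≤ W → r ≤ F r W := fun r W h1 h2 => by
    have : 0 ≤ 4 * (Fintype.card (Ix k) : ℝ) * (W * r) := by positivity
    simp only [F]; linarith
  let G : ℝ → ℝ≥0∞ := fun W => ENNReal.ofReal (2 * (Fintype.card (Ix k) : ℝ) * W)
  have q1 := hF _ _ hr hρ
  have q2 := hF _ _ (hr.trans q1) hW1
  have q3 := hF _ _ ((hr.trans q1).trans q2) hW2
  have q4 := hF _ _ (((hr.trans q1).trans q2).trans q3) hW1
  have q5 := hF _ _ ((((hr.trans q1).trans q2).trans q3).trans q4) hW2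
  refine ⟨F (F (F (F (F r ρ) W1) W2) W1) W2, (((G ρ + G W1) + G W2) + G W1) + G W2, by simp [G], fun x hx => ?_⟩
  have hw2 : ‖(-x.2 / (4 * bI a p)) • (eY p : Heis l k)‖ ≤ W2 := by
    rw [norm_smul, Real.norm_eq_abs, abs_div, abs_neg, abs_of_pos (by positivity : 0 < 4 * bI a p)]
    simp only [W2]
    have : |x.2| ≤ ρ := (norm_snd_le x).trans hx
    gcongr
  have t := (((((good_tau h hx r).comp (good_tau h (le_refl W1) _) q2).comp (good_tau h hw2 _) q3).comp
    (good_tau h (w := -eX p) (W := W1) (by rw [norm_neg]) _) q4).comp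
    (good_tau h (w := -((-x.2 / (4 * bI a p)) • eY p)) (W := W2) (by rw [norm_neg]; exact hw2) _) q5)
  have e : Rm a x = _ := funext fun g => Rm_eq p hp.ne' x g
  rw [e]
  exact t

theorem local_poincare {a : Fin (l + 1) → ℝ} (h : Hy k a) {r : ℝ} (hr : 0 ≤ r) :
    ∃ (r' : ℝ) (D : ℝ≥0∞), D ≠ ∞ ∧ ∀ f : Heis l k → ℝ, ContDiff ℝ 1 f →
      ∫⁻ g in CB r, ∫⁻ g' in CB r, ‖f g' - f g‖ₑ ≤ D * ∫⁻ g in CB r', ‖gradNorm l k a f g‖ₑ := by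
  obtain ⟨ρ, hρ⟩ : ∃ ρ : ℝ, ρ = 2 * r + 4 * (Fintype.card (Ix k) : ℝ) * (2 * r * r) := ⟨_, rfl⟩
  have hρ0 : 0 ≤ ρ := by rw [hρ]; positivity
  obtain ⟨r', D, hD, hgood⟩ := good_R h hr hρ0
  refine ⟨r', D * volume (CB (l := l) (k := k) ρ), ENNReal.mul_ne_top hD measure_closedBall_lt_top.ne, fun f hf => ?_⟩
  have hf' := hf.continuous
  have hRc : Continuous fun q : Heis l k × Heis l k => Rm a q.2 q.1 := by
    have e : (fun q : Heis l k × Heis l k => Rm a q.2 q.1) = fun q => 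
      (q.1.1 + q.2.1, q.1.2 + (q.2.2 + ∑ p : Ix k, (2 * bI a p * reL p q.2 * imL p q.1 - 2 * bI a p * imL p q.2 * reL p q.1))) := by
      funext q; unfold Rm; rw [omg_apply]
    rw [e]; fun_prop
  have hcq : Continuous fun q : Heis l k × Heis l k => ‖f (Rm a q.2 q.1) - f q.1‖ₑ := by
    refine Continuous.enorm ?_
    exact (hf'.comp hRc).sub (hf'.comp continuous_fst)
  have s1 : ∀ g ∈ CB (l := l) (k := k) r, ∫⁻ g' in CB r, ‖f g' - f g‖ₑ ≤ ∫⁻ x in CB ρ, ‖f (Rm a x g) - f g‖ₑ := by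
    intro g hg
    simp only [CB, mem_closedBall_zero_iff] at hg
    have hmp : MeasurePreserving (fun x : Heis l k => Rm a x g) volume volume := by
      have hc : Continuous fun z : ((i : Fin (l + 1)) → (Fin (k i) → ℂ)) => g.2 - omg a g (z, 0) := by fun_prop
      have := mp_shift (l := l) (k := k) g.1 hc
      have e : (fun x : Heis l k => Rm a x g) = fun x : Heis l k => ((x.1 + g.1, x.2 + (g.2 - omg a g (x.1, 0))) : Heis l k) := by
        funext x
        unfold Rm
        rw [omg_swap a x g, omg_congr a g (g := x) (g' := (x.1, 0)) rfl]
        refine Prod.ext (add_comm _ _) ?_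
        simp only; ring
      rw [e]; exact this
    have hF : Measurable fun g' => ‖f g' - f g‖ₑ := (hf'.sub continuous_const).enorm.measurable
    rw [← hmp.setLIntegral_comp_preimage measurableSet_closedBall hF]
    refine lintegral_mono_set fun x hx => ?_
    simp only [CB, Set.mem_preimage, mem_closedBall_zero_iff] at hx ⊢
    have h1 : ‖x.1‖ ≤ 2 * r := by
      have e : x.1 = (Rm a x g).1 - g.1 := by simp [Rm]
      rw [e]
      refine (norm_sub_le _ _).trans ?_
      have := (norm_fst_le (Rm a x g)).trans hx
      have := (norm_fst_le g).trans hg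
      linarith
    have h0 : ‖((x.1, 0) : Heis l k)‖ ≤ 2 * r := by
      rw [Prod.norm_def, max_le_iff]; exact ⟨h1, by simp; exact hr⟩
    have h2 : |omg a x g| ≤ 4 * (Fintype.card (Ix k) : ℝ) * (2 * r * r) := by
      rw [omg_swap, omg_congr a g (g := x) (g' := (x.1, 0)) rfl, ← omg_swap]
      refine (omg_bd h _ _).trans ?_
      gcongr
    have hcc : 0 ≤ 4 * (Fintype.card (Ix k) : ℝ) * (2 * r * r) := by positivity
    rw [Prod.norm_def, max_le_iff]
    refine ⟨by rw [hρ]; linarith, ?_⟩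
    have e : x.2 = (Rm a x g).2 - g.2 - omg a x g := by simp [Rm]
    rw [e]
    refine (norm_sub_le _ _).trans ?_
    have h3 := norm_sub_le (Rm a x g).2 g.2
    have h4 := (norm_snd_le (Rm a x g)).trans hx
    have h5 := (norm_snd_le g).trans hg
    rw [Real.norm_eq_abs (omg a x g), hρ]
    linarith
  calc ∫⁻ g in CB r, ∫⁻ g' in CB r, ‖f g' - f g‖ₑ ≤ ∫⁻ g in CB r, ∫⁻ x in CB ρ, ‖f (Rm a x g) - f g‖ₑ :=
        setLIntegral_mono' measurableSet_closedBall s1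
    _ = ∫⁻ x in CB ρ, ∫⁻ g in CB r, ‖f (Rm a x g) - f g‖ₑ := lintegral_lintegral_swap hcq.measurable.aemeasurable
    _ ≤ ∫⁻ x in CB (l := l) (k := k) ρ, D * ∫⁻ g in CB r', ‖gradNorm l k a f g‖ₑ := by
        refine setLIntegral_mono' measurableSet_closedBall fun x hx => ?_
        simp only [CB, mem_closedBall_zero_iff] at hx
        exact (hgood x hx).le f hf
    _ = _ := by
        rw [setLIntegral_const]; ring

end Cheeger

namespace Cheeger

variable {l k}

/-! ### the unit ball -/

theorem muF_neg (x : ℝ) : muF (-x) = - muF x := by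
  unfold muF
  rw [mul_neg, Real.sin_neg, Real.sin_neg, ← neg_div]; congr 1 <;> ring

theorem muF_zero : muF 0 = 0 := by simp [muF]

theorem sdiv_neg (x : ℝ) : sdiv (-x) = sdiv x := by
  unfold sdiv
  by_cases h : x = 0
  · simp [h]
  · rw [if_neg (neg_ne_zero.mpr h), if_neg h, Real.sin_neg, neg_div_neg_eq]

theorem sdiv_ge_one {x : ℝ} (hx : |x| < Real.pi) : 1 ≤ sdiv x := by
  wlog h : 0 ≤ x generalizing x
  · rw [← sdiv_neg]; exact this (by rwa [abs_neg]) (by linarith)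
  rw [abs_of_nonneg h] at hx
  unfold sdiv
  split_ifs with h0
  · exact le_rfl
  · have hp : 0 < x := lt_of_le_of_ne h (Ne.symm h0)
    rw [le_div_iff₀ (Real.sin_pos_of_pos_of_lt_pi hp hx), one_mul]
    exact Real.sin_le h

theorem sdiv_le {x : ℝ} (hx : |x| ≤ Real.pi / 2) : sdiv x ≤ Real.pi / 2 := by
  wlog h : 0 ≤ x generalizing x
  · rw [← sdiv_neg]; exact this (by rwa [abs_neg]) (by linarith)
  rw [abs_of_nonneg h] at hx
  have hpi := Real.pi_gt_three
  unfold sdiv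
  split_ifs with h0
  · linarith
  · have hp : 0 < x := lt_of_le_of_ne h (Ne.symm h0)
    rw [div_le_iff₀ (Real.sin_pos_of_pos_of_lt_pi hp (by linarith))]
    have := Real.mul_le_sin h hx
    calc x = Real.pi / 2 * (2 / Real.pi * x) := by field_simp
      _ ≤ _ := by gcongr

theorem muF_nonneg {x : ℝ} (h : 0 ≤ x) : 0 ≤ muF x := by
  unfold muF
  have := Real.sin_le (by linarith : 0 ≤ 2 * x)
  exact div_nonneg (by linarith) (by positivity)

theorem abs_muF_le {x : ℝ} (hx : |x| < Real.pi) : |muF x| ≤ 2 / 3 * |x| * sdiv x ^ 2 := by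
  wlog h : 0 ≤ x generalizing x
  · have := this (x := -x) (by rwa [abs_neg]) (by linarith)
    rwa [muF_neg, abs_neg, abs_neg, sdiv_neg] at this
  rw [abs_of_nonneg (muF_nonneg h), abs_of_nonneg h]
  rw [abs_of_nonneg h] at hx
  unfold sdiv
  split_ifs with h0
  · rw [h0, muF_zero]; simp
  · have hp : 0 < x := lt_of_le_of_ne h (Ne.symm h0)
    have hs := Real.sin_pos_of_pos_of_lt_pi hp hx
    have := Real.sin_gt_sub_cube (by linarith : 0 < 2 * x)
    unfold muF
    rw [div_pow, ← mul_div_assoc, div_le_div_iff₀ (by positivity) (by positivity)]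
    have h1 : 2 * x - Real.sin (2 * x) ≤ 4 / 3 * x ^ 3 := by nlinarith
    have := mul_le_mul_of_nonneg_right h1 (by positivity : 0 ≤ Real.sin x ^ 2)
    nlinarith

theorem muF_ge {x : ℝ} (h1 : Real.pi / 2 ≤ x) (h2 : x < Real.pi) : Real.pi / 2 / Real.sin x ^ 2 ≤ muF x := by
  have hs := Real.sin_pos_of_pos_of_lt_pi (by linarith [Real.pi_pos] : 0 < x) h2
  have h3 : Real.sin (2 * x) ≤ 0 := by
    have := Real.sin_nonpos_of_nonpos_of_neg_pi_le (x := 2 * x - 2 * Real.pi) (by linarith) (by linarith)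
    rwa [Real.sin_sub_two_pi] at this
  unfold muF
  rw [div_div, mul_comm 2 (Real.sin x ^ 2), ← div_div, ← div_div, div_div _ _ (2:ℝ), div_div _ _ (2:ℝ)]
  rw [div_le_div_iff₀ (by positivity) (by positivity)]
  have : Real.pi ≤ 2 * x - Real.sin (2 * x) := by linarith
  nlinarith [mul_le_mul_of_nonneg_right this (by positivity : 0 ≤ Real.sin x ^ 2)]

theorem continuousAt_muF {x : ℝ} (hx : |x| < Real.pi) : ContinuousAt muF x := by
  by_cases h0 : x = 0
  · subst h0
    unfold ContinuousAt
    rw [muF_zero]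
    have h1 : Tendsto (fun x : ℝ => 2 / 3 * |x| * 4) (𝓝 0) (𝓝 0) := by
      have : Continuous fun x : ℝ => 2 / 3 * |x| * 4 := by fun_prop
      simpa using this.tendsto 0
    refine squeeze_zero_norm' ?_ h1
    filter_upwards [Metric.ball_mem_nhds (0 : ℝ) one_pos] with y hy
    rw [Metric.mem_ball, Real.dist_eq, sub_zero] at hy
    have hpi := Real.pi_gt_three
    have hpi4 := Real.pi_le_four
    have a1 := abs_muF_le (x := y) (by linarith)
    have a2 := sdiv_le (x := y) (by linarith)
    have a3 := sdiv_ge_one (x := y) (by linarith)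
    rw [Real.norm_eq_abs]
    refine a1.trans ?_
    gcongr
    nlinarith
  · have hs : Real.sin x ≠ 0 := by
      rw [abs_lt] at hx
      rcases lt_or_gt_of_ne h0 with h | h
      · exact (Real.sin_neg_of_neg_of_neg_pi_lt h hx.1).ne
      · exact (Real.sin_pos_of_pos_of_lt_pi h hx.2).ne'
    unfold muF
    refine ContinuousAt.div (by fun_prop) (by fun_prop) (by positivity)

theorem theta_exists {a : Fin (l + 1) → ℝ} (h : Hy k a) {q : Fin (l + 1) → ℝ} (hq : ∀ j, 0 ≤ q j)
    (hl : 0 < q (Fin.last l)) (t : ℝ) :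
    ∃ θ : ℝ, θ ∈ Set.Ioo (-Real.pi) Real.pi ∧ t = ∑ j, a j * muF (a j * θ) * q j := by
  wlog ht : 0 ≤ t generalizing t
  · obtain ⟨θ, hθ, e⟩ := this (-t) (by linarith)
    refine ⟨-θ, ⟨by linarith [hθ.2], by linarith [hθ.1]⟩, ?_⟩
    rw [← neg_neg t, e, ← Finset.sum_neg_distrib]
    refine Finset.sum_congr rfl fun j _ => ?_
    rw [mul_neg, muF_neg]; ring
  obtain ⟨ε, hε⟩ : ∃ ε : ℝ, ε = min 1 (q (Fin.last l) / (t + 1)) := ⟨_, rfl⟩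
  have he0 : 0 < ε := by rw [hε]; exact lt_min one_pos (by positivity)
  have he1 : ε ≤ 1 := by rw [hε]; exact min_le_left _ _
  have he2 : ε * (t + 1) ≤ q (Fin.last l) := by
    rw [← le_div_iff₀ (by positivity), hε]; exact min_le_right _ _
  have hpi := Real.pi_gt_three
  have hbd : ∀ θ ∈ Set.Icc 0 (Real.pi - ε), ∀ j, |a j * θ| < Real.pi := by
    intro θ hθ j
    have := h.a0 j
    have := h.a1 j
    rw [abs_of_nonneg (mul_nonneg (h.a0 j).le hθ.1)]
    have : a j * θ ≤ θ := mul_le_of_le_one_left hθ.1 (h.a1 j)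
    linarith [hθ.2]
  have hc : ContinuousOn (fun θ : ℝ => ∑ j, a j * muF (a j * θ) * q j) (Set.Icc 0 (Real.pi - ε)) := by
    refine continuousOn_finsetSum _ fun j _ => ?_
    refine ContinuousOn.mul (ContinuousOn.mul continuousOn_const ?_) continuousOn_const
    intro θ hθ
    refine ContinuousAt.continuousWithinAt ?_
    exact ContinuousAt.comp (f := fun θ => a j * θ) (g := muF) (continuousAt_muF (hbd θ hθ j)) (by fun_prop)
  have hle : (0 : ℝ) ≤ Real.pi - ε := by linarith
  have hiv := intermediate_value_Icc hle hc
  have hmem : t ∈ Set.Icc ((fun θ : ℝ => ∑ j, a j * muF (a j * θ) * q j) 0)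
      ((fun θ : ℝ => ∑ j, a j * muF (a j * θ) * q j) (Real.pi - ε)) := by
    constructor
    · simp [muF_zero]; exact ht
    · have h1 := Finset.single_le_sum (f := fun j => a j * muF (a j * (Real.pi - ε)) * q j) (s := univ)
        (fun j _ => mul_nonneg (mul_nonneg (h.a0 j).le (muF_nonneg (mul_nonneg (h.a0 j).le hle))) (hq j))
        (Finset.mem_univ (Fin.last l))
      refine le_trans ?_ h1
      simp only [h.al, one_mul]
      have h2 := muF_ge (x := Real.pi - ε) (by linarith) (by linarith)
      rw [Real.sin_pi_sub] at h2
      have hs : 0 < Real.sin ε := Real.sin_pos_of_pos_of_lt_pi he0 (by linarith)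
      have hs' := Real.sin_le he0.le
      have h3 : 1 / ε ≤ muF (Real.pi - ε) := by
        refine le_trans ?_ h2
        rw [div_le_div_iff₀ he0 (by positivity)]
        nlinarith
      have h4 : 1 / ε * q (Fin.last l) ≤ muF (Real.pi - ε) * q (Fin.last l) := by gcongr
      refine le_trans ?_ h4
      rw [one_div_mul_eq_div, le_div_iff₀ he0]
      nlinarith
  obtain ⟨θ, hθ, e⟩ := hiv hmem
  exact ⟨θ, ⟨by linarith [hθ.1], by linarith [hθ.2]⟩, e.symm⟩

theorem zN_nonneg (g : Heis l k) (j : Fin (l + 1)) : 0 ≤ zNormSq l k g.1 j :=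
  Finset.sum_nonneg fun _ _ => Complex.normSq_nonneg _

theorem zN_sum (g : Heis l k) : ∑ j, zNormSq l k g.1 j = rr g := by
  unfold rr
  rw [sum_Ix]
  refine Finset.sum_congr rfl fun j _ => Finset.sum_congr rfl fun m _ => ?_
  rw [nq_normSq]

theorem zN_pos {g : Heis l k} {j : Fin (l + 1)} (hg : g.1 j ≠ 0) : 0 < zNormSq l k g.1 j := by
  refine lt_of_le_of_ne (zN_nonneg g j) fun h0 => hg ?_
  have := (Finset.sum_eq_zero_iff_of_nonneg (fun m _ => Complex.normSq_nonneg (g.1 j m))).mp h0.symm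
  funext m
  exact Complex.normSq_eq_zero.mp (this m (Finset.mem_univ m))

theorem theta_spec {a : Fin (l + 1) → ℝ} (h : Hy k a) {g : Heis l k} (hg : g.1 (Fin.last l) ≠ 0) :
    thetaOf l k a g ∈ Set.Ioo (-Real.pi) Real.pi ∧
      g.2 = ∑ j, a j * muF (a j * thetaOf l k a g) * zNormSq l k g.1 j :=
  Classical.epsilon_spec (p := fun θ : ℝ => θ ∈ Set.Ioo (-Real.pi) Real.pi ∧
    g.2 = ∑ j, a j * muF (a j * θ) * zNormSq l k g.1 j) (theta_exists h (zN_nonneg g) (zN_pos hg) g.2)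

theorem ccDistSq_eq (a : Fin (l + 1) → ℝ) {g : Heis l k} (hg : g.1 (Fin.last l) ≠ 0) :
    ccDistSq l k a g = ∑ j, (sdiv (a j * thetaOf l k a g)) ^ 2 * zNormSq l k g.1 j := by
  unfold ccDistSq; rw [if_pos (Or.inl hg)]

theorem abs_a_theta {a : Fin (l + 1) → ℝ} (h : Hy k a) (j : Fin (l + 1)) (θ : ℝ) : |a j * θ| ≤ |θ| := by
  rw [abs_mul, abs_of_pos (h.a0 j)]
  exact mul_le_of_le_one_left (abs_nonneg _) (h.a1 j)

theorem mem_ball_iff (a : Fin (l + 1) → ℝ) {g : Heis l k} : g ∈ ballCC l k a ↔ ccDistSq l k a g < 1 := by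
  unfold ballCC ccDist
  rw [Set.mem_setOf_eq, Real.sqrt_lt' one_pos, one_pow]

theorem ball_bdd {a : Fin (l + 1) → ℝ} (h : Hy k a) {g : Heis l k} (hg : g.1 (Fin.last l) ≠ 0)
    (hb : g ∈ ballCC l k a) : g ∈ CB (l := l) (k := k) 6 := by
  obtain ⟨hθ, ht⟩ := theta_spec h hg
  rw [mem_ball_iff, ccDistSq_eq a hg] at hb
  obtain ⟨θ, e⟩ : ∃ θ, θ = thetaOf l k a g := ⟨_, rfl⟩
  rw [← e] at hθ ht hb
  have hθ' : |θ| < Real.pi := abs_lt.mpr hθ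
  have hj : ∀ j, |a j * θ| < Real.pi := fun j => (abs_a_theta h j θ).trans_lt hθ'
  have hpi4 := Real.pi_le_four
  have hr : rr g ≤ 1 := by
    rw [← zN_sum]
    refine le_trans (Finset.sum_le_sum fun j _ => ?_) hb.le
    refine le_mul_of_one_le_left (zN_nonneg g j) ?_
    have := sdiv_ge_one (hj j)
    nlinarith
  have ht' : |tL g| ≤ 4 := by
    change |g.2| ≤ 4
    rw [ht]
    refine (Finset.abs_sum_le_sum_abs _ _).trans ?_
    have : ∀ j ∈ (univ : Finset (Fin (l + 1))), |a j * muF (a j * θ) * zNormSq l k g.1 j| ≤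
        4 * (sdiv (a j * θ) ^ 2 * zNormSq l k g.1 j) := by
      intro j _
      rw [abs_mul, abs_mul, abs_of_pos (h.a0 j), abs_of_nonneg (zN_nonneg g j), ← mul_assoc]
      refine mul_le_mul_of_nonneg_right ?_ (zN_nonneg g j)
      refine (mul_le_of_le_one_left (abs_nonneg _) (h.a1 j)).trans ?_
      refine (abs_muF_le (hj j)).trans ?_
      refine mul_le_mul_of_nonneg_right ?_ (sq_nonneg _)
      have := hj j
      linarith
    refine (Finset.sum_le_sum this).trans ?_
    rw [← Finset.mul_sum]; linarith
  have := norm_le_of hr ht'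
  rw [mem_closedBall_zero_iff]
  linarith

theorem ball_open {a : Fin (l + 1) → ℝ} (h : Hy k a) {g : Heis l k} (h1 : |g.2| < zNormSq l k g.1 (Fin.last l))
    (h2 : rr g < 1 / 4) : g ∈ ballCC l k a := by
  have hl : 0 < zNormSq l k g.1 (Fin.last l) := (abs_nonneg _).trans_lt h1
  have hg : g.1 (Fin.last l) ≠ 0 := by
    intro h0
    unfold zNormSq at hl
    rw [h0] at hl
    simp at hl
  obtain ⟨hθ, ht⟩ := theta_spec h hg
  rw [mem_ball_iff, ccDistSq_eq a hg]
  obtain ⟨θ, e⟩ : ∃ θ, θ = thetaOf l k a g := ⟨_, rfl⟩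
  rw [← e] at hθ ht ⊢
  have hpi := Real.pi_gt_three
  have hpi4 := Real.pi_le_four
  have hθ' : |θ| < Real.pi := abs_lt.mpr hθ
  have key : |θ| ≤ Real.pi / 2 := by
    by_contra hcon
    rw [not_le] at hcon
    have e1 : |g.2| = ∑ j, a j * muF (a j * |θ|) * zNormSq l k g.1 j := by
      have hnn : 0 ≤ ∑ j, a j * muF (a j * |θ|) * zNormSq l k g.1 j := Finset.sum_nonneg fun j _ =>
        mul_nonneg (mul_nonneg (h.a0 j).le (muF_nonneg (mul_nonneg (h.a0 j).le (abs_nonneg _)))) (zN_nonneg g j)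
      rcases abs_choice θ with hc | hc
      · rw [hc] at hnn ⊢; rw [← ht] at hnn ⊢; exact abs_of_nonneg hnn
      · rw [hc] at hnn ⊢
        have : ∑ j, a j * muF (a j * -θ) * zNormSq l k g.1 j = - g.2 := by
          rw [ht, ← Finset.sum_neg_distrib]
          refine Finset.sum_congr rfl fun j _ => ?_
          rw [mul_neg, muF_neg]; ring
        rw [this] at hnn ⊢
        exact abs_of_nonpos (by linarith)
    have h3 := Finset.single_le_sum (f := fun j => a j * muF (a j * |θ|) * zNormSq l k g.1 j) (s := univ)
        (fun j _ => mul_nonneg (mul_nonneg (h.a0 j).le (muF_nonneg (mul_nonneg (h.a0 j).le (abs_nonneg _)))) (zN_nonneg g j))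
        (Finset.mem_univ (Fin.last l))
    simp only [h.al, one_mul] at h3
    rw [← e1] at h3
    have h4 := muF_ge hcon.le hθ'
    have h5 : 1 ≤ Real.pi / 2 / Real.sin |θ| ^ 2 := by
      have hs := Real.sin_pos_of_pos_of_lt_pi (by linarith : 0 < |θ|) hθ'
      rw [le_div_iff₀ (by positivity)]
      have := Real.sin_le_one |θ|
      nlinarith
    nlinarith
  have hb : ∀ j ∈ (univ : Finset (Fin (l + 1))), sdiv (a j * θ) ^ 2 * zNormSq l k g.1 j ≤ 4 * zNormSq l k g.1 j := by
    intro j _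
    refine mul_le_mul_of_nonneg_right ?_ (zN_nonneg g j)
    have a1 := sdiv_le ((abs_a_theta h j θ).trans key)
    have a2 := sdiv_ge_one ((abs_a_theta h j θ).trans_lt hθ')
    nlinarith
  refine (Finset.sum_le_sum hb).trans_lt ?_
  rw [← Finset.mul_sum, zN_sum]; linarith

theorem ball_pos {a : Fin (l + 1) → ℝ} (h : Hy k a) : 0 < volume (ballCC l k a) := by
  have hsub : {g : Heis l k | |g.2| < zNormSq l k g.1 (Fin.last l) ∧ rr g < 1 / 4} ⊆ ballCC l k a :=
    fun g hg => ball_open h hg.1 hg.2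
  refine lt_of_lt_of_le ?_ (measure_mono hsub)
  refine IsOpen.measure_pos _ ?_ ?_
  · have hc1 : Continuous fun g : Heis l k => zNormSq l k g.1 (Fin.last l) := by
      unfold zNormSq
      refine continuous_finsetSum _ fun j _ => Complex.continuous_normSq.comp (by fun_prop)
    have hc2 : Continuous (rr : Heis l k → ℝ) := by
      unfold rr nq; fun_prop
    exact (isOpen_lt (continuous_snd.abs) hc1).inter (isOpen_lt hc2 continuous_const)
  · refine ⟨(1 / 4 : ℝ) • eX h.i0, ?_⟩
    have hrr : rr ((1 / 4 : ℝ) • (eX h.i0 : Heis l k)) = 1 / 16 := by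
      unfold rr nq
      simp only [map_smul, reL_eX, imL_eX]
      rw [Finset.sum_eq_single h.i0]
      · simp; norm_num
      · intro q _ hq; simp [Ne.symm hq]
      · simp
    refine ⟨?_, by rw [hrr]; norm_num⟩
    have e0 : ((1 / 4 : ℝ) • (eX h.i0 : Heis l k)).2 = 0 := by simp [eX]
    rw [e0, abs_zero]
    refine zN_pos fun h0 => ?_
    have := congrFun h0 ⟨0, h.hk _⟩
    have e1 : reL h.i0 ((1 / 4 : ℝ) • (eX h.i0 : Heis l k)) = 1 / 4 := by simp only [map_smul, reL_eX]; simp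
    rw [reL_apply] at e1
    change (((1 / 4 : ℝ) • (eX h.i0 : Heis l k)).1 (Fin.last l) ⟨0, h.hk _⟩).re = 1 / 4 at e1
    rw [this] at e1
    norm_num at e1

theorem null_last {a : Fin (l + 1) → ℝ} (h : Hy k a) : ∀ᵐ g : Heis l k, g.1 (Fin.last l) ≠ 0 := by
  have h1 : volume ((LinearMap.ker (reL h.i0 : Heis l k →L[ℝ] ℝ).toLinearMap : Submodule ℝ (Heis l k)) : Set (Heis l k)) = 0 := by
    refine Measure.addHaar_submodule volume _ fun htop => ?_
    have : (eX h.i0 : Heis l k) ∈ LinearMap.ker (reL h.i0 : Heis l k →L[ℝ] ℝ).toLinearMap := by rw [htop]; trivial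
    rw [LinearMap.mem_ker] at this
    have e : reL h.i0 (eX h.i0 : Heis l k) = 1 := by rw [reL_eX, if_pos rfl]
    exact one_ne_zero (e.symm.trans this)
  rw [ae_iff]
  refine measure_mono_null (fun g hg => ?_) h1
  rw [Set.mem_setOf_eq, not_not] at hg
  change reL h.i0 g = 0
  rw [reL_apply]
  change (g.1 (Fin.last l) _).re = 0
  rw [hg]; rfl

theorem ball_ae {a : Fin (l + 1) → ℝ} (h : Hy k a) : ballCC l k a ≤ᵐ[volume] CB (l := l) (k := k) 6 := by
  filter_upwards [null_last h] with g hg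
  exact fun hb => ball_bdd h hg hb

theorem ball_finite {a : Fin (l + 1) → ℝ} (h : Hy k a) : volume (ballCC l k a) < ⊤ :=
  (measure_mono_ae (ball_ae h)).trans_lt measure_closedBall_lt_top

end Cheeger

namespace Cheeger

variable {l k}

open scoped ENNReal

/-! ### conclusion -/

theorem Phi_lower {a : Fin (l + 1) → ℝ} (h : Hy k a) (r : ℝ) :
    ∃ c : ℝ, 0 < c ∧ ∀ g ∈ CB (l := l) (k := k) r, c ≤ Phi a g := by
  rcases (CB (l := l) (k := k) r).eq_empty_or_nonempty with he | hne
  · exact ⟨1, one_pos, fun g hg => by rw [he] at hg; exact absurd hg (Set.notMem_empty g)⟩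
  · obtain ⟨g0, _, hmin⟩ := (isCompact_closedBall (0 : Heis l k) r).exists_isMinOn hne (continuous_Phi h).continuousOn
    exact ⟨Phi a g0, Phi_pos h g0, fun g hg => hmin hg⟩

theorem sub_mean {a : Fin (l + 1) → ℝ} (h : Hy k a) {r : ℝ} (hr : 6 ≤ r) {f : Heis l k → ℝ} (hf : ContDiff ℝ 1 f)
    (hs : HasCompactSupport f) (g : Heis l k) :
    ‖f g - meanB l k a f‖ₑ ≤ (volume (ballCC l k a))⁻¹ * ∫⁻ g' in CB r, ‖f g' - f g‖ₑ := by
  have hv0 := ball_pos h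
  have hv1 := ball_finite h
  have hvr : 0 < (volume (ballCC l k a)).toReal := ENNReal.toReal_pos hv0.ne' hv1.ne
  have hfi : Integrable f := hf.continuous.integrable_of_hasCompactSupport hs
  have : Fact (volume (ballCC l k a) < ⊤) := ⟨hv1⟩
  have i1 : Integrable (fun _ : Heis l k => f g) (volume.restrict (ballCC l k a)) := integrable_const _
  have e1 : f g - meanB l k a f = (volume (ballCC l k a)).toReal⁻¹ * ∫ g' in ballCC l k a, (f g - f g') := by
    rw [integral_sub i1 hfi.restrict, setIntegral_const]
    unfold meanB
    rw [smul_eq_mul, Measure.real]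
    field_simp
  rw [e1, enorm_mul, Real.enorm_eq_ofReal (by positivity), ENNReal.ofReal_inv_of_pos hvr, ENNReal.ofReal_toReal hv1.ne]
  refine mul_le_mul' le_rfl ?_
  refine (enorm_integral_le_lintegral_enorm _).trans ?_
  have hle : volume.restrict (ballCC l k a) ≤ volume.restrict (CB r) :=
    Measure.restrict_mono_ae ((ball_ae h).trans (Eventually.of_forall fun g hg => Metric.closedBall_subset_closedBall hr hg))
  refine (lintegral_mono' hle le_rfl).trans (lintegral_mono fun g' => ?_)
  rw [← enorm_neg, neg_sub]

theorem cheeger {a : Fin (l + 1) → ℝ} (h : Hy k a) : ∃ C : ℝ, 0 < C ∧ 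
    ∀ f : Heis l k → ℝ, ContDiff ℝ 1 f → HasCompactSupport f → 
      ∫ g, |f g - meanB l k a f| * Phi a g ≤ C * (∫ g, gradNorm l k a f g * Phi a g) := by
  obtain ⟨R, C, hR, hC, hG⟩ := global h
  obtain ⟨r, hr⟩ : ∃ r : ℝ, r = max R 6 := ⟨_, rfl⟩
  have hrR : R ≤ r := hr ▸ le_max_left _ _
  have hr6 : 6 ≤ r := hr ▸ le_max_right _ _
  obtain ⟨r', D, hD, hP⟩ := local_poincare h (by linarith : 0 ≤ r)
  obtain ⟨c, hc, hcP⟩ := Phi_lower h r'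
  have hv0 := ball_pos h
  obtain ⟨E, hE⟩ : ∃ E : ℝ≥0∞, E = (volume (ballCC l k a))⁻¹ * D := ⟨_, rfl⟩
  have hEt : E ≠ ∞ := by rw [hE]; exact ENNReal.mul_ne_top (ENNReal.inv_ne_top.mpr hv0.ne') hD
  refine ⟨C + C * (E.toReal * c⁻¹), by positivity, fun f hf hs => ?_⟩
  have hf' := hf.continuous
  refine (hG f hf hs (meanB l k a f)).trans ?_
  have hgc := continuous_gradNorm a hf
  have i4 : Integrable fun g => gradNorm l k a f g * Phi a g :=
    (hgc.mul (continuous_Phi h)).integrable_of_hasCompactSupport (gradNorm_compact a hf hs).mul_right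
  have i5 : Integrable (gradNorm l k a f) := hgc.integrable_of_hasCompactSupport (gradNorm_compact a hf hs)
  have s1 : ∫⁻ g in CB r, ‖f g - meanB l k a f‖ₑ ≤ E * ∫⁻ g in CB r', ‖gradNorm l k a f g‖ₑ := by
    refine (lintegral_mono fun g => sub_mean h hr6 hf hs g).trans ?_
    rw [lintegral_const_mul' _ _ (ENNReal.inv_ne_top.mpr hv0.ne'), hE, mul_assoc]
    exact mul_le_mul' le_rfl (hP f hf)
  have s2 : ∫⁻ g in CB r', ‖gradNorm l k a f g‖ₑ = ENNReal.ofReal (∫ g in CB r', gradNorm l k a f g) := by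
    rw [ofReal_integral_eq_lintegral_ofReal i5.restrict (Eventually.of_forall fun g => gradNorm_nonneg a f g)]
    refine lintegral_congr fun g => ?_
    rw [Real.enorm_eq_ofReal (gradNorm_nonneg a f g)]
  have s3 : ∫ g in CB r, |f g - meanB l k a f| ≤ E.toReal * ∫ g in CB r', gradNorm l k a f g := by
    have hc2 : Continuous fun g => |f g - meanB l k a f| := (hf'.sub continuous_const).abs
    rw [integral_eq_lintegral_of_nonneg_ae (Eventually.of_forall fun g => abs_nonneg _) hc2.aestronglyMeasurable]
    have e : ∫⁻ g in CB r, ENNReal.ofReal |f g - meanB l k a f| = ∫⁻ g in CB r, ‖f g - meanB l k a f‖ₑ :=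
      lintegral_congr fun g => (Real.enorm_eq_ofReal_abs _).symm
    rw [e]
    rw [s2] at s1
    refine (ENNReal.toReal_mono (ENNReal.mul_ne_top hEt ENNReal.ofReal_ne_top) s1).trans (le_of_eq ?_)
    rw [ENNReal.toReal_mul, ENNReal.toReal_ofReal (integral_nonneg fun g => gradNorm_nonneg a f g)]
  have s4 : ∫ g in CB r', gradNorm l k a f g ≤ c⁻¹ * ∫ g, gradNorm l k a f g * Phi a g := by
    have t1 : ∫ g in CB r', gradNorm l k a f g ≤ ∫ g in CB r', c⁻¹ * (gradNorm l k a f g * Phi a g) := by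
      refine setIntegral_mono_on i5.integrableOn (i4.const_mul c⁻¹).integrableOn measurableSet_closedBall fun g hg => ?_
      have h1 := hcP g hg
      have h2 := gradNorm_nonneg a f g
      rw [inv_mul_eq_div, le_div_iff₀ hc]
      gcongr
    refine t1.trans ?_
    rw [integral_const_mul]
    refine mul_le_mul_of_nonneg_left ?_ (by positivity)
    exact setIntegral_le_integral i4 (Eventually.of_forall fun g => mul_nonneg (gradNorm_nonneg a f g) (Phi_pos h g).le)
  have s5 : ∫ g in CB R, |f g - meanB l k a f| ≤ ∫ g in CB r, |f g - meanB l k a f| := by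
    refine setIntegral_mono_set ?_ (Eventually.of_forall fun g => abs_nonneg _)
      (Eventually.of_forall fun g hg => Metric.closedBall_subset_closedBall hrR hg)
    exact ((hf'.sub continuous_const).abs).continuousOn.integrableOn_compact (isCompact_closedBall _ _)
  have s6 : ∫ g in CB R, |f g - meanB l k a f| ≤ E.toReal * (c⁻¹ * ∫ g, gradNorm l k a f g * Phi a g) :=
    (s5.trans s3).trans (mul_le_mul_of_nonneg_left s4 ENNReal.toReal_nonneg)
  have s7 := mul_le_mul_of_nonneg_left s6 hC.le
  refine (add_le_add le_rfl s7).trans (le_of_eq ?_)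
  ring

end Cheeger

/-- Cheeger type inequality. For all `f ∈ C_c^∞(ℍ)` one has
`∫_ℍ |f − m_f| p dm ≲ ∫_ℍ |∇f| p dm`, where `p = p₁` is the heat kernel at time `1`,
`m_f` is the mean of `f` over the Carnot–Carathéodory unit ball, and the implied constant
depends only on `(𝒦,𝒜)`. -/
theorem statement4 (l : ℕ) (k : Fin (l + 1) → ℕ) (hk : ∀ i, 0 < k i)
    (a : Fin (l + 1) → ℝ) (ha0 : 0 < a 0) (haMono : StrictMono a)
    (haLast : a (Fin.last l) = 1) :
    ∃ C > (0 : ℝ), ∀ f : Heis l k → ℝ, ContDiff ℝ (⊤ : ℕ∞) f → HasCompactSupport f →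
      ∫ g : Heis l k, |f g - meanB l k a f| * heatKernel l k a 1 g ≤
        C * ∫ g : Heis l k, gradNorm l k a f g * heatKernel l k a 1 g := by
  have h : Cheeger.Hy k a := ⟨hk, fun i => ha0.trans_le (haMono.monotone (Fin.zero_le i)),
    fun i => haLast ▸ haMono.monotone (Fin.le_last i), haLast⟩
  obtain ⟨C, hC, hmain⟩ := Cheeger.cheeger h
  refine ⟨C, hC, fun f hf hs => ?_⟩
  have h1 := hmain f (hf.of_le (by exact_mod_cast le_top)) hs
  simp only [Cheeger.heatKernel_eq h]
  have e1 : ∀ g : Heis l k, |f g - meanB l k a f| * (Cheeger.C0 k * Cheeger.Phi a g) =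
      Cheeger.C0 k * (|f g - meanB l k a f| * Cheeger.Phi a g) := fun g => by ring
  have e2 : ∀ g : Heis l k, gradNorm l k a f g * (Cheeger.C0 k * Cheeger.Phi a g) =
      Cheeger.C0 k * (gradNorm l k a f g * Cheeger.Phi a g) := fun g => by ring
  simp only [e1, e2, integral_const_mul]
  have := mul_le_mul_of_nonneg_left h1 (Cheeger.C0_pos k).le
  refine this.trans (le_of_eq ?_)
  ring

end
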